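/- arXiv:2102.04401 — 5 statements merged into one kernel-verified Lean document; each statement's English description precedes it below -/
import Mathlib

section
/- There exist universal constants c₀ > 0 and c > 0 such that the following holds for every integer d ≥ 2. Let p : ℝ → ℝ be a degree-d polynomial on the circle, i.e., p(θ) = q(cos θ, sin θ) for some bivariate real polynomial q of total degree at most d, and let B : ℝ → {−1, 1} be measurable and 2π-periodic. Set t = c₀ · (log d)/d. Then (1/2π) ∫₀^{2π} |p(θ) − B(θ)| dθ ≥ (c/log d) · Pr_{φ∼Unif([0, 2π])}[B(φ − t) ≠ B(φ + t)]. -/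
open MeasureTheory

/-- A Schwartz function whose Fourier transform equals `1` near the origin. -/
theorem exists_schwartzMap_integral_exp_mul_eq_one :
    ∃ κ : SchwartzMap ℝ ℂ, ∀ ω : ℝ, |ω| ≤ 1 →
      ∫ y : ℝ, Complex.exp (((ω * y : ℝ) : ℂ) * Complex.I) * κ y = 1 := by
  let b : ContDiffBump (0 : ℝ) := ⟨1, 2, one_pos, one_lt_two⟩
  have hc : HasCompactSupport (fun x => (b x : ℂ)) :=
    b.hasCompactSupport.comp_left (g := fun r : ℝ => (r : ℂ)) Complex.ofReal_zero
  have hs : ContDiff ℝ (⊤ : ℕ∞) (fun x => (b x : ℂ)) :=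
    Complex.ofRealCLM.contDiff.comp b.contDiff
  let g : SchwartzMap ℝ ℂ := hc.toSchwartzMap hs
  refine ⟨FourierTransform.fourierInv g, fun ω hω => ?_⟩
  have h1 : FourierTransform.fourier (FourierTransform.fourierInv g) (-ω / (2 * Real.pi)) = 1 := by
    rw [FourierTransform.fourier_fourierInv_eq]
    change ((b (-ω / (2 * Real.pi)) : ℝ) : ℂ) = 1
    rw [b.one_of_mem_closedBall, Complex.ofReal_one]
    rw [mem_closedBall_zero_iff, Real.norm_eq_abs, abs_div, abs_neg,
      abs_of_pos Real.two_pi_pos]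
    change _ ≤ (1 : ℝ)
    rw [div_le_one Real.two_pi_pos]
    linarith [Real.pi_gt_three]
  rw [SchwartzMap.fourier_coe, Real.fourier_eq'] at h1
  rw [← h1]
  congr 1
  ext y
  rw [smul_eq_mul]
  congr 4
  have := Real.pi_pos.ne'
  simp only [inner]
  change ω * y = -2 * Real.pi * (-ω / (2 * Real.pi) * y)
  field_simp

theorem SchwartzMap.exists_integral_norm_translate_sub_le (κ : SchwartzMap ℝ ℂ) :
    ∃ L : ℝ, ∀ h : ℝ, |h| ≤ 1 → ∫ x, ‖κ (x + h) - κ x‖ ≤ L * |h| := by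
  let D := SchwartzMap.derivCLM ℂ ℂ κ
  have hD : ∀ x, D x = deriv κ x := fun x => SchwartzMap.derivCLM_apply ℂ κ x
  obtain ⟨C₀, hC₀, h₀⟩ := D.decay 0 0
  obtain ⟨C₂, hC₂, h₂⟩ := D.decay 2 0
  simp only [norm_iteratedFDeriv_zero, pow_zero, one_mul, hD] at h₀ h₂
  have hderiv : ∀ x y, |y - x| ≤ 1 → ‖deriv κ y‖ ≤ 3 * (C₀ + C₂) * (1 + x ^ 2)⁻¹ := by
    intro x y hxy
    rw [← div_eq_mul_inv, le_div_iff₀ (by positivity)]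
    have h3 : 1 + x ^ 2 ≤ 3 * (1 + y ^ 2) := by
      nlinarith [abs_le.1 hxy, sq_nonneg (2 * y - x), sq_abs (y - x), abs_nonneg (y - x)]
    have h4 := h₀ y
    have h5 := h₂ y
    rw [Real.norm_eq_abs, sq_abs] at h5
    nlinarith [norm_nonneg (deriv κ y)]
  refine ⟨∫ x : ℝ, 3 * (C₀ + C₂) * (1 + x ^ 2)⁻¹, fun h hh => ?_⟩
  rw [← integral_mul_const]
  refine integral_mono ?_ ((integrable_inv_one_add_sq.const_mul _).mul_const _) fun x => ?_
  · exact ((κ.integrable.comp_add_right h).sub κ.integrable).norm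
  · have := Convex.norm_image_sub_le_of_norm_deriv_le (𝕜 := ℝ) (f := κ) (s := Metric.closedBall x 1)
      (x := x) (y := x + h) (C := 3 * (C₀ + C₂) * (1 + x ^ 2)⁻¹)
      (fun y _ => κ.differentiableAt)
      (fun y hy => hderiv x y (by simpa [Real.dist_eq] using hy)) (convex_closedBall x 1)
      (by simp) (by simpa [Real.dist_eq] using hh)
    simpa using this

/-- An integrable kernel, Lipschitz under translation in `L¹`, which reproduces all sinusoids of
frequency at most `1`. -/
theorem exists_reproducing_kernel : ∃ (k : ℝ → ℝ) (L : ℝ), Integrable k ∧ 1 ≤ L ∧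
    (∀ h : ℝ, |h| ≤ 1 → ∫ x, |k (x + h) - k x| ≤ L * |h|) ∧
    ∀ ω : ℝ, |ω| ≤ 1 →
      ∫ y, k y * Real.cos (ω * y) = 1 ∧ ∫ y, k y * Real.sin (ω * y) = 0 := by
  obtain ⟨κ, hκ⟩ := exists_schwartzMap_integral_exp_mul_eq_one
  obtain ⟨L, hL⟩ := κ.exists_integral_norm_translate_sub_le
  refine ⟨fun x => (κ x).re, max L 1, κ.integrable.re,
    le_max_right _ _, fun h hh => ?_, fun ω hω => ?_⟩
  · calc ∫ x, |(κ (x + h)).re - (κ x).re| ≤ ∫ x, ‖κ (x + h) - κ x‖ := by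
          have hi := (κ.integrable (μ := volume).comp_add_right h).sub κ.integrable
          refine integral_mono hi.re.abs hi.norm fun x => ?_
          simpa using Complex.abs_re_le_norm (κ (x + h) - κ x)
      _ ≤ L * |h| := hL h hh
      _ ≤ max L 1 * |h| := by gcongr; exact le_max_left _ _
  · have hintegrable : ∀ ω : ℝ,
        Integrable fun y : ℝ => Complex.exp (((ω * y : ℝ) : ℂ) * Complex.I) * κ y := fun ω =>
      κ.integrable.bdd_mul (c := 1) (by fun_prop)
        (.of_forall fun y => (Complex.norm_exp_ofReal_mul_I _).le)
    have h1 := hκ ω hω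
    have h2 := hκ (-ω) (by rwa [abs_neg])
    have hre : ∀ y : ℝ, (κ y).re * Real.cos (ω * y) =
        (((Complex.exp (((ω * y : ℝ) : ℂ) * Complex.I) * κ y) +
          (Complex.exp (((-ω * y : ℝ) : ℂ) * Complex.I) * κ y)) / 2).re := by
      intro y
      simp [Complex.exp_ofReal_mul_I_re, Complex.exp_ofReal_mul_I_im, -Complex.ofReal_mul,
        -Complex.ofReal_neg]
      ring
    have him : ∀ y : ℝ, (κ y).re * Real.sin (ω * y) =
        (((Complex.exp (((ω * y : ℝ) : ℂ) * Complex.I) * κ y) -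
          (Complex.exp (((-ω * y : ℝ) : ℂ) * Complex.I) * κ y)) / 2).im := by
      intro y
      simp [Complex.exp_ofReal_mul_I_re, Complex.exp_ofReal_mul_I_im, -Complex.ofReal_mul,
        -Complex.ofReal_neg]
      ring
    simp_rw [hre, him]
    constructor
    · have := integral_re (𝕜 := ℂ) (((hintegrable ω).add (hintegrable (-ω))).div_const 2)
      simp only [RCLike.re_eq_complex_re, Pi.add_apply] at this
      rw [this, integral_div, integral_add (hintegrable _) (hintegrable _), h1, h2]
      norm_num
    · have := integral_im (𝕜 := ℂ) (((hintegrable ω).sub (hintegrable (-ω))).div_const 2)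
      simp only [RCLike.im_eq_complex_im, Pi.sub_apply] at this
      rw [this, integral_div, integral_sub (hintegrable _) (hintegrable _), h1, h2]
      norm_num

/-- The span of the sinusoids of frequency at most `r`. -/
def sinusoidSpan (r : ℝ) : Submodule ℝ (ℝ → ℝ) :=
  Submodule.span ℝ {g | ∃ ω φ : ℝ, |ω| ≤ r ∧ g = fun θ => Real.cos (ω * θ + φ)}

theorem cos_mem_sinusoidSpan {r ω : ℝ} (hω : |ω| ≤ r) (φ : ℝ) :
    (fun θ => Real.cos (ω * θ + φ)) ∈ sinusoidSpan r :=
  Submodule.subset_span ⟨ω, φ, hω, rfl⟩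

theorem sinusoidSpan_mono {r s : ℝ} (h : r ≤ s) : sinusoidSpan r ≤ sinusoidSpan s :=
  Submodule.span_mono fun _ ⟨ω, φ, hω, hg⟩ => ⟨ω, φ, hω.trans h, hg⟩

theorem cos_add_mul_mem_sinusoidSpan (ψ : ℝ) {r : ℝ} {g : ℝ → ℝ} (hg : g ∈ sinusoidSpan r) :
    (fun θ => Real.cos (θ + ψ) * g θ) ∈ sinusoidSpan (r + 1) := by
  induction hg using Submodule.span_induction with
  | mem g hg =>
    obtain ⟨ω, φ, hω, rfl⟩ := hg
    have h1 : |ω + 1| ≤ r + 1 := (abs_add_le _ _).trans (by simpa using hω)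
    have h2 : |ω - 1| ≤ r + 1 := (abs_sub _ _).trans (by simpa using hω)
    have := Submodule.smul_mem _ (1 / 2 : ℝ) (Submodule.add_mem _
      (cos_mem_sinusoidSpan h1 (φ + ψ)) (cos_mem_sinusoidSpan h2 (φ - ψ)))
    refine (congrArg (· ∈ sinusoidSpan (r + 1)) (funext fun θ => ?_)).mpr this
    simp only [Pi.smul_apply, Pi.add_apply, smul_eq_mul]
    rw [show (ω + 1) * θ + (φ + ψ) = (ω * θ + φ) + (θ + ψ) by ring,
      show (ω - 1) * θ + (φ - ψ) = (ω * θ + φ) - (θ + ψ) by ring, Real.cos_add (ω * θ + φ),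
      Real.cos_sub (ω * θ + φ)]
    ring
  | zero =>
    simp only [Pi.zero_apply, mul_zero]
    exact Submodule.zero_mem _
  | add x y _ _ hx hy =>
    convert Submodule.add_mem _ hx hy using 1
    ext θ
    simp [mul_add]
  | smul a x _ hx =>
    convert Submodule.smul_mem _ a hx using 1
    ext θ
    simp only [Pi.smul_apply, smul_eq_mul]
    ring

theorem cos_pow_mul_sin_pow_mem_sinusoidSpan (a b : ℕ) :
    (fun θ => Real.cos θ ^ a * Real.sin θ ^ b) ∈ sinusoidSpan (a + b) := by
  induction a with
  | zero =>
    induction b with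
    | zero => simpa using cos_mem_sinusoidSpan (r := 0) (ω := 0) (by simp) 0
    | succ b ih =>
      rw [Nat.cast_succ, ← add_assoc]
      refine (congrArg (· ∈ sinusoidSpan _) (funext fun θ => ?_)).mpr
        (cos_add_mul_mem_sinusoidSpan (-(Real.pi / 2)) ih)
      rw [← sub_eq_add_neg, Real.cos_sub_pi_div_two]
      ring
  | succ a ih =>
    rw [Nat.cast_succ, add_right_comm]
    refine (congrArg (· ∈ sinusoidSpan _) (funext fun θ => ?_)).mpr
      (cos_add_mul_mem_sinusoidSpan 0 ih)
    rw [add_zero]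
    ring

theorem eval_cos_sin_mem_sinusoidSpan {q : MvPolynomial (Fin 2) ℝ} {d : ℕ}
    (hq : q.totalDegree ≤ d) :
    (fun θ => MvPolynomial.eval ![Real.cos θ, Real.sin θ] q) ∈ sinusoidSpan d := by
  have h : (fun θ => MvPolynomial.eval ![Real.cos θ, Real.sin θ] q) =
      ∑ m ∈ q.support, q.coeff m • fun θ => Real.cos θ ^ m 0 * Real.sin θ ^ m 1 := by
    ext θ
    rw [MvPolynomial.eval_eq', Finset.sum_apply]
    simp [Fin.prod_univ_two]
  rw [h]
  refine Submodule.sum_mem _ fun m hm => Submodule.smul_mem _ _ ?_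
  refine sinusoidSpan_mono ?_ (cos_pow_mul_sin_pow_mem_sinusoidSpan _ _)
  have h1 := (MvPolynomial.le_totalDegree hm).trans hq
  rw [Finsupp.sum_fintype _ _ (fun _ => rfl), Fin.sum_univ_two] at h1
  exact_mod_cast h1

theorem bounded_of_mem_sinusoidSpan {r : ℝ} {g : ℝ → ℝ} (hg : g ∈ sinusoidSpan r) :
    Continuous g ∧ ∃ C : ℝ, ∀ θ, |g θ| ≤ C := by
  induction hg using Submodule.span_induction with
  | mem g hg =>
    obtain ⟨ω, φ, -, rfl⟩ := hg
    exact ⟨by fun_prop, 1, fun θ => Real.abs_cos_le_one _⟩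
  | zero => exact ⟨continuous_zero, 0, by simp⟩
  | add x y _ _ hx hy =>
    obtain ⟨hx, C, hC⟩ := hx
    obtain ⟨hy, D, hD⟩ := hy
    exact ⟨hx.add hy, C + D, fun θ => (abs_add_le _ _).trans (add_le_add (hC θ) (hD θ))⟩
  | smul a x _ hx =>
    obtain ⟨hx, C, hC⟩ := hx
    refine ⟨hx.const_smul a, |a| * C, fun θ => ?_⟩
    rw [Pi.smul_apply, smul_eq_mul, abs_mul]
    exact mul_le_mul_of_nonneg_left (hC θ) (abs_nonneg a)

theorem integrable_kernel_mul {k g : ℝ → ℝ} (hk : Integrable k) (hg : Measurable g) {C : ℝ}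
    (hC : ∀ θ, |g θ| ≤ C) (s θ : ℝ) : Integrable fun y => k y * g (θ - s * y) :=
  hk.mul_bdd (c := C) (hg.comp (by fun_prop)).aestronglyMeasurable (.of_forall fun _ => hC _)

theorem integral_kernel_mul_eq_of_mem_sinusoidSpan {k : ℝ → ℝ} (hk : Integrable k)
    (hrep : ∀ ω : ℝ, |ω| ≤ 1 →
      ∫ y, k y * Real.cos (ω * y) = 1 ∧ ∫ y, k y * Real.sin (ω * y) = 0)
    {r : ℝ} (hr : 0 < r) {g : ℝ → ℝ} (hg : g ∈ sinusoidSpan r) (θ : ℝ) :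
    ∫ y, k y * g (θ - r⁻¹ * y) = g θ := by
  have hintegrable : ∀ g ∈ sinusoidSpan r, Integrable fun y => k y * g (θ - r⁻¹ * y) := by
    intro g hg
    obtain ⟨hc, C, hC⟩ := bounded_of_mem_sinusoidSpan hg
    exact integrable_kernel_mul hk hc.measurable hC _ _
  induction hg using Submodule.span_induction with
  | mem g hg =>
    obtain ⟨ω, φ, hω, rfl⟩ := hg
    obtain ⟨hcos, hsin⟩ := hrep (ω * r⁻¹) (by
      rw [abs_mul, abs_inv, abs_of_pos hr, ← div_eq_mul_inv]
      exact (div_le_one hr).2 hω)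
    have hic : Integrable fun y => k y * Real.cos (ω * r⁻¹ * y) :=
      hk.mul_bdd (c := 1) (by fun_prop) (.of_forall fun _ => Real.abs_cos_le_one _)
    have his : Integrable fun y => k y * Real.sin (ω * r⁻¹ * y) :=
      hk.mul_bdd (c := 1) (by fun_prop) (.of_forall fun _ => Real.abs_sin_le_one _)
    have h : ∀ y, k y * Real.cos (ω * (θ - r⁻¹ * y) + φ) =
        Real.cos (ω * θ + φ) * (k y * Real.cos (ω * r⁻¹ * y)) +
          Real.sin (ω * θ + φ) * (k y * Real.sin (ω * r⁻¹ * y)) := by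
      intro y
      rw [show ω * (θ - r⁻¹ * y) + φ = (ω * θ + φ) - ω * r⁻¹ * y by ring, Real.cos_sub]
      ring
    simp_rw [h]
    rw [integral_add (hic.const_mul _) (his.const_mul _), integral_const_mul, integral_const_mul,
      hcos, hsin]
    ring
  | zero => simp
  | add x y hx' hy' hx hy =>
    simp only [Pi.add_apply, mul_add]
    rw [integral_add (hintegrable x hx') (hintegrable y hy'), hx, hy]
  | smul a x _ hx =>
    simp only [Pi.smul_apply, smul_eq_mul, mul_left_comm _ a]
    rw [integral_const_mul, hx]


theorem abs_smoothing_sub_le {k B : ℝ → ℝ} {L s : ℝ} (hk : Integrable k)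
    (hL : ∀ h : ℝ, |h| ≤ 1 → ∫ x, |k (x + h) - k x| ≤ L * |h|)
    (hB : Measurable B) (hB1 : ∀ θ, |B θ| ≤ 1) (hs : 0 < s) {θ θ' : ℝ} (hθ : |θ' - θ| ≤ s) :
    |(∫ y, k y * B (θ' - s * y)) - ∫ y, k y * B (θ - s * y)| ≤ L * (|θ' - θ| / s) := by
  set h := (θ' - θ) / s with hh
  have hθ' : θ' = θ + s * h := by rw [hh]; field_simp; ring
  have habs : |h| = |θ' - θ| / s := by rw [hh, abs_div, abs_of_pos hs]
  have hh1 : |h| ≤ 1 := by rw [habs]; exact (div_le_one hs).2 hθ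
  have hkh : Integrable fun y => k (y + h) := hk.comp_add_right h
  have h1 : ∫ y, k y * B (θ' - s * y) = ∫ y, k (y + h) * B (θ - s * y) := by
    rw [← integral_add_right_eq_self (fun y => k y * B (θ' - s * y)) h]
    congr 1
    ext y
    rw [hθ', show θ + s * h - s * (y + h) = θ - s * y by ring]
  rw [h1, ← integral_sub (integrable_kernel_mul hkh hB hB1 s θ)
    (integrable_kernel_mul hk hB hB1 s θ), ← habs]
  refine (abs_integral_le_integral_abs).trans (le_trans ?_ (hL h hh1))
  refine integral_mono ((integrable_kernel_mul hkh hB hB1 s θ).sub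
    (integrable_kernel_mul hk hB hB1 s θ)).abs (hkh.sub hk).abs fun y => ?_
  change |k (y + h) * B (θ - s * y) - k y * B (θ - s * y)| ≤ |k (y + h) - k y|
  rw [← sub_mul, abs_mul]
  exact mul_le_of_le_one_right (abs_nonneg _) (hB1 _)

theorem integrable_uncurry_kernel_mul {k g : ℝ → ℝ} (hk : Integrable k) (hg : Measurable g)
    {C : ℝ} (hC : ∀ θ, |g θ| ≤ C) (s : ℝ) (μ : Measure ℝ) [IsFiniteMeasure μ] :
    Integrable (Function.uncurry fun θ y => k y * g (θ - s * y)) (μ.prod volume) :=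
  (hk.comp_snd μ).mul_bdd (c := C) (hg.comp (by fun_prop)).aestronglyMeasurable
    (.of_forall fun _ => hC _)

theorem integral_integral_kernel_mul_periodic {k g : ℝ → ℝ} {T : ℝ} (hT : 0 ≤ T)
    (hk : Integrable k) (hg : Measurable g) {C : ℝ} (hC : ∀ θ, |g θ| ≤ C)
    (hper : Function.Periodic g T) (s : ℝ) :
    ∫ θ in 0..T, ∫ y, k y * g (θ - s * y) = (∫ y, k y) * ∫ θ in 0..T, g θ := by
  rw [intervalIntegral.integral_of_le hT,
    integral_integral_swap (integrable_uncurry_kernel_mul hk hg hC s _), ← integral_mul_const]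
  congr 1
  ext y
  rw [integral_const_mul, ← intervalIntegral.integral_of_le hT,
    intervalIntegral.integral_comp_sub_right (fun θ => g θ)]
  have := hper.intervalIntegral_add_eq (0 - s * y) 0
  rw [zero_add] at this
  rw [← this]
  ring_nf

/-- A kernel reproducing `p` turns an `L¹` approximation `p` of `B` into a bound on the distance
from `B` to its own smoothing. -/
theorem integral_abs_smoothing_sub_le {k p B : ℝ → ℝ} {T s : ℝ} (hT : 0 ≤ T) (hk : Integrable k)
    (hp : Continuous p) {C : ℝ} (hC : ∀ θ, |p θ| ≤ C) (hpT : Function.Periodic p T)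
    (hB : Measurable B) (hB1 : ∀ θ, |B θ| ≤ 1) (hBT : Function.Periodic B T)
    (hrep : ∀ θ, ∫ y, k y * p (θ - s * y) = p θ)
    (hf : Continuous fun θ => ∫ y, k y * B (θ - s * y)) :
    ∫ θ in 0..T, |(∫ y, k y * B (θ - s * y)) - B θ| ≤
      ((∫ y, |k y|) + 1) * ∫ θ in 0..T, |p θ - B θ| := by
  have hm : Measurable fun θ => |p θ - B θ| := (hp.measurable.sub hB).abs
  have hb : ∀ θ, |(|p θ - B θ|)| ≤ C + 1 := fun θ => by
    rw [abs_abs]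
    exact (abs_sub _ _).trans (add_le_add (hC θ) (hB1 θ))
  have hper : Function.Periodic (fun θ => |p θ - B θ|) T := fun θ => by
    simp only [hpT θ, hBT θ]
  rw [add_mul, one_mul, ← integral_integral_kernel_mul_periodic hT hk.abs hm hb hper s]
  have hI := integrable_uncurry_kernel_mul hk.abs hm hb s (volume.restrict (Set.Ioc 0 T))
  have hi1 : IntervalIntegrable (fun θ => ∫ y, |k y| * |p (θ - s * y) - B (θ - s * y)|)
      volume 0 T := by
    rw [intervalIntegrable_iff_integrableOn_Ioc_of_le hT]
    exact hI.integral_prod_left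
  have hi2 : IntervalIntegrable (fun θ => |p θ - B θ|) volume 0 T := by
    rw [intervalIntegrable_iff_integrableOn_Ioc_of_le hT]
    exact Integrable.of_bound hm.aestronglyMeasurable (C + 1) (.of_forall hb)
  have hi3 : IntervalIntegrable (fun θ => |(∫ y, k y * B (θ - s * y)) - B θ|) volume 0 T := by
    refine ((hf.intervalIntegrable 0 T).sub ?_).abs
    rw [intervalIntegrable_iff_integrableOn_Ioc_of_le hT]
    exact Integrable.of_bound hB.aestronglyMeasurable 1 (.of_forall hB1)
  rw [← intervalIntegral.integral_add hi1 hi2]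
  refine intervalIntegral.integral_mono_on hT hi3 (hi1.add hi2) fun θ _ => ?_
  refine (abs_sub_le _ (p θ) _).trans (add_le_add_left ?_ _)
  nth_rewrite 1 [← hrep θ]
  rw [← integral_sub (integrable_kernel_mul hk hB hB1 s θ)
    (integrable_kernel_mul hk hp.measurable hC s θ)]
  refine abs_integral_le_integral_abs.trans (le_of_eq ?_)
  congr 1
  ext y
  rw [← mul_sub, abs_mul, abs_sub_comm]

/-- The measure of the jump set of a sign function `B` is controlled by its `L¹` distance to a
function `f` which remains small near its zeros. -/
theorem measureReal_jump_le {f B : ℝ → ℝ} {T t r M : ℝ} (hT : 0 ≤ T) (ht : 0 ≤ t) (hr : 0 < r)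
    (hf : Continuous f) (hM : ∀ θ, |f θ| ≤ M) (hfT : Function.Periodic f T)
    (hB : Measurable B) (hB1 : ∀ θ, B θ = 1 ∨ B θ = -1) (hBT : Function.Periodic B T)
    (hzero : ∀ θ θ', f θ = 0 → |θ' - θ| ≤ r → |f θ'| ≤ 1 / 2) :
    volume.real {φ ∈ Set.Ioc 0 T | B (φ - t) ≠ B (φ + t)} ≤
      (2 + 2 * (t + r) / r) * ∫ θ in 0..T, |f θ - B θ| := by
  set E : ℝ → ℝ := fun θ => |f θ - B θ| with hE
  have hB1' : ∀ θ, |B θ| ≤ 1 := fun θ => by rcases hB1 θ with h | h <;> simp [h]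
  have hEm : Measurable E := (hf.measurable.sub hB).abs
  have hE0 : ∀ θ, 0 ≤ E θ := fun θ => abs_nonneg _
  have hEb : ∀ θ, |E θ| ≤ M + 1 := fun θ => by
    rw [hE, abs_abs]
    exact (abs_sub _ _).trans (add_le_add (hM θ) (hB1' θ))
  have hEper : Function.Periodic E T := fun θ => by
    simp only [hE, hfT θ, hBT θ]
  set w : ℝ → ℝ := (Set.Icc (-(t + r)) (t + r)).indicator 1 with hw
  have hwi : Integrable w := (integrable_indicator_iff measurableSet_Icc).2
    (integrableOn_const (by simp) (by simp))
  have hwint : ∫ y, w y = 2 * (t + r) := by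
    rw [hw, integral_indicator_one measurableSet_Icc, Measure.real, Real.volume_Icc,
      ENNReal.toReal_ofReal (by linarith)]
    ring
  set G : ℝ → ℝ := fun φ => ∫ y, w y * E (φ - 1 * y) with hG
  have hGint : ∫ φ in 0..T, G φ = 2 * (t + r) * ∫ θ in 0..T, E θ := by
    rw [hG, integral_integral_kernel_mul_periodic hT hwi hEm hEb hEper, hwint]
  have hG0 : ∀ φ, 0 ≤ G φ := fun φ => integral_nonneg fun y =>
    mul_nonneg (Set.indicator_nonneg (fun _ _ => zero_le_one) y) (hE0 _)
  have hGi : IntegrableOn G (Set.Ioc 0 T) :=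
    (integrable_uncurry_kernel_mul hwi hEm hEb 1 (volume.restrict (Set.Ioc 0 T))).integral_prod_left
  have hshift : ∀ a, ∫ φ in 0..T, E (φ + a) = ∫ θ in 0..T, E θ := fun a => by
    rw [intervalIntegral.integral_comp_add_right]
    have := hEper.intervalIntegral_add_eq (0 + a) 0
    rw [zero_add] at this
    rw [zero_add, add_comm T, this, zero_add]
  have hsi : ∀ a, IntegrableOn (fun φ => E (φ + a)) (Set.Ioc 0 T) := fun a =>
    Integrable.of_bound (hEm.comp (by fun_prop)).aestronglyMeasurable (M + 1)
      (.of_forall fun _ => hEb _)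
  have hHi := ((hsi (-t)).add (hsi t)).add (hGi.const_mul r⁻¹)
  have hmark := mul_meas_ge_le_integral_of_nonneg
    (.of_forall fun φ => add_nonneg (add_nonneg (hE0 _) (hE0 _))
      (mul_nonneg (inv_nonneg.2 hr.le) (hG0 φ))) hHi 1
  have hHint : ∫ φ in Set.Ioc 0 T, (E (φ + -t) + E (φ + t) + r⁻¹ * G φ) =
      (2 + 2 * (t + r) / r) * ∫ θ in 0..T, E θ := by
    rw [integral_add (f := fun φ => E (φ + -t) + E (φ + t)) ((hsi (-t)).add (hsi t))
      (hGi.const_mul r⁻¹), integral_add (hsi _) (hsi _),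
      integral_const_mul, ← intervalIntegral.integral_of_le hT,
      ← intervalIntegral.integral_of_le hT, ← intervalIntegral.integral_of_le hT, hshift, hshift,
      hGint]
    field_simp
    ring
  rw [hHint, one_mul, measureReal_restrict_apply' measurableSet_Ioc] at hmark
  refine le_trans (measureReal_mono ?_ ?_) hmark
  · rintro φ ⟨hφ, hne⟩
    refine ⟨?_, hφ⟩
    change 1 ≤ E (φ + -t) + E (φ + t) + r⁻¹ * G φ
    rw [← sub_eq_add_neg]
    by_cases hz : ∃ x ∈ Set.Icc (φ - t) (φ + t), f x = 0
    · obtain ⟨x, hx, hfx⟩ := hz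
      have hGr : r ≤ G φ := by
        have h1 : ∫ y, (Set.Icc (φ - x - r) (φ - x + r)).indicator (fun _ => (1 / 2 : ℝ)) y = r := by
          rw [integral_indicator measurableSet_Icc, setIntegral_const, Measure.real,
            Real.volume_Icc, ENNReal.toReal_ofReal (by linarith), smul_eq_mul]
          ring
        rw [← h1]
        refine integral_mono ((integrable_indicator_iff measurableSet_Icc).2
          (integrableOn_const (by simp) (by simp))) (integrable_kernel_mul hwi hEm hEb 1 φ)
          fun y =>
            Set.indicator_le' (g := fun y => w y * E (φ - 1 * y)) (fun y hy => ?_)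
              (fun y _ => ?_) y
        · have hyw : w y = 1 := Set.indicator_of_mem
            (Set.mem_Icc.2 ⟨by linarith [hy.1, hx.2], by linarith [hy.2, hx.1]⟩) _
          rw [hyw, one_mul]
          have h2 := abs_le.1 (hzero x (φ - 1 * y) hfx
            (abs_le.2 ⟨by linarith [hy.2], by linarith [hy.1]⟩))
          rcases hB1 (φ - 1 * y) with h | h <;> simp only [hE, h]
          · exact le_abs.2 (Or.inr (by linarith))
          · exact le_abs.2 (Or.inl (by linarith))
        · exact mul_nonneg (Set.indicator_nonneg (fun _ _ => zero_le_one) y) (hE0 _)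
      have h3 : 1 ≤ r⁻¹ * G φ := by
        rw [inv_mul_eq_div]
        exact (one_le_div hr).2 hGr
      linarith [hE0 (φ - t), hE0 (φ + t)]
    · have h0 : (0 : ℝ) ∉ Set.uIcc (f (φ - t)) (f (φ + t)) := by
        intro h
        obtain ⟨x, hx, hfx⟩ := intermediate_value_uIcc hf.continuousOn h
        rw [Set.uIcc_of_le (by linarith)] at hx
        exact hz ⟨x, hx, hfx⟩
      have hE1 : 1 ≤ E (φ - t) + E (φ + t) := by
        rw [Set.mem_uIcc] at h0
        have ha := neg_abs_le (f (φ - t) - B (φ - t))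
        have hb := neg_abs_le (f (φ + t) - B (φ + t))
        have ha' := le_abs_self (f (φ - t) - B (φ - t))
        have hb' := le_abs_self (f (φ + t) - B (φ + t))
        have ha0 := hE0 (φ - t)
        have hb0 := hE0 (φ + t)
        simp only [hE] at ha0 hb0 ⊢
        by_contra! hlt
        rcases hB1 (φ - t) with h | h <;> rcases hB1 (φ + t) with h' | h' <;>
          simp only [h, h'] at hne ha hb ha' hb' ha0 hb0 hlt
        · exact hne rfl
        · exact h0 (Or.inr ⟨by linarith, by linarith⟩)
        · exact h0 (Or.inl ⟨by linarith, by linarith⟩)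
        · exact hne rfl
      linarith [mul_nonneg (inv_nonneg.2 hr.le) (hG0 φ)]
  · exact ((measure_mono Set.inter_subset_right).trans_lt measure_Ioc_lt_top).ne

/-- There exist universal constants `c₀, c > 0` such that for every integer `d ≥ 2`, every
degree-`d` polynomial `p` on the circle and every measurable `2π`-periodic `±1`-valued `B`,
with `t = c₀ log d / d`,
`(1/2π) ∫₀^{2π} |p(θ) − B(θ)| dθ ≥ (c/log d) · Pr_{φ∼Unif[0,2π]}[B(φ−t) ≠ B(φ+t)]`. -/
theorem stmt_11 : ∃ c₀ > (0:ℝ), ∃ c > (0:ℝ), ∀ d : ℕ, 2 ≤ d →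
    ∀ p B : ℝ → ℝ,
    (∃ q : MvPolynomial (Fin 2) ℝ, q.totalDegree ≤ d ∧
      ∀ θ : ℝ, p θ = MvPolynomial.eval ![Real.cos θ, Real.sin θ] q) →
    Measurable B → (∀ θ, B θ = 1 ∨ B θ = -1) →
    (∀ θ, B (θ + 2 * Real.pi) = B θ) →
    (c / Real.log d) *
        ((volume {φ ∈ Set.Ioc (0:ℝ) (2 * Real.pi) |
            B (φ - c₀ * Real.log d / d) ≠ B (φ + c₀ * Real.log d / d)}).toReal /
          (2 * Real.pi)) ≤
      (1 / (2 * Real.pi)) * ∫ θ in (0:ℝ)..(2 * Real.pi), |p θ - B θ| := by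
  obtain ⟨k, L, hk, hL1, hL, hrep⟩ := exists_reproducing_kernel
  set M := ∫ y, |k y| with hM
  have hM0 : 0 ≤ M := integral_nonneg fun y => abs_nonneg _
  have hL0 : 0 < L := one_pos.trans_le hL1
  refine ⟨1, one_pos, ((8 + 4 * L) * (M + 1))⁻¹, by positivity, ?_⟩
  rintro d hd p B ⟨q, hq, hpq⟩ hB hB1 hBT
  have hd0 : (0 : ℝ) < d := by exact_mod_cast (by lia : 0 < d)
  have hlog : 1 / 2 ≤ Real.log d := by
    have h2 : Real.log 2 ≤ Real.log d := Real.log_le_log two_pos (by exact_mod_cast hd)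
    linarith [Real.log_two_gt_d9]
  have hlog0 : 0 < Real.log d := by linarith
  have hs : (0 : ℝ) < (d : ℝ)⁻¹ := inv_pos.2 hd0
  have hB1' : ∀ θ, |B θ| ≤ 1 := fun θ => by rcases hB1 θ with h | h <;> simp [h]
  have hp : p ∈ sinusoidSpan d := by
    rw [funext hpq]
    exact eval_cos_sin_mem_sinusoidSpan hq
  have hpT : Function.Periodic p (2 * Real.pi) := fun θ => by
    rw [hpq, hpq, Real.cos_add_two_pi, Real.sin_add_two_pi]
  obtain ⟨hpc, C, hC⟩ := bounded_of_mem_sinusoidSpan hp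
  set f : ℝ → ℝ := fun θ => ∫ y, k y * B (θ - (d : ℝ)⁻¹ * y) with hf
  have hlip : ∀ θ θ', |θ' - θ| ≤ (d : ℝ)⁻¹ → |f θ' - f θ| ≤ L * d * |θ' - θ| := by
    intro θ θ' h
    have := abs_smoothing_sub_le hk hL hB hB1' hs h
    rwa [div_inv_eq_mul, mul_comm |θ' - θ|, ← mul_assoc] at this
  have hfc : Continuous f := continuous_iff_continuousAt.2 fun θ =>
    continuousAt_of_locally_lipschitz hs (L * d) fun θ' h => hlip θ θ' (le_of_lt h)
  have hfT : Function.Periodic f (2 * Real.pi) := fun θ => by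
    simp only [hf]
    congr 1
    ext y
    rw [add_sub_right_comm, hBT]
  have hfM : ∀ θ, |f θ| ≤ M := fun θ => by
    refine abs_integral_le_integral_abs.trans (integral_mono
      (integrable_kernel_mul hk hB hB1' _ θ).abs hk.abs fun y => ?_)
    simp only [abs_mul]
    exact mul_le_of_le_one_right (abs_nonneg _) (hB1' _)
  have hsmooth := integral_abs_smoothing_sub_le Real.two_pi_pos.le hk hpc hC hpT hB hB1' hBT
    (integral_kernel_mul_eq_of_mem_sinusoidSpan hk hrep hd0 hp) hfc
  have ht : 0 ≤ 1 * Real.log d / d := by positivity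
  have hr : 0 < (2 * L * d)⁻¹ := by positivity
  have hjump := measureReal_jump_le Real.two_pi_pos.le ht hr hfc hfM hfT hB hB1 hBT
    fun θ θ' h0 h => by
      have h1 : (2 * L * d)⁻¹ ≤ (d : ℝ)⁻¹ := by
        apply inv_anti₀ hd0
        nlinarith
      have h2 := hlip θ θ' (h.trans h1)
      rw [h0, sub_zero] at h2
      calc |f θ'| ≤ L * d * |θ' - θ| := h2
        _ ≤ L * d * (2 * L * d)⁻¹ := by gcongr
        _ = 1 / 2 := by field_simp
  set I := ∫ θ in (0 : ℝ)..(2 * Real.pi), |p θ - B θ| with hI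
  have hI0 : 0 ≤ I := intervalIntegral.integral_nonneg Real.two_pi_pos.le fun _ _ => abs_nonneg _
  have hconst : 2 + 2 * (1 * Real.log d / d + (2 * L * d)⁻¹) / (2 * L * d)⁻¹ =
      4 + 4 * L * Real.log d := by
    field_simp
    ring
  rw [hconst] at hjump
  have hmain : volume.real {φ ∈ Set.Ioc (0:ℝ) (2 * Real.pi) |
      B (φ - 1 * Real.log d / d) ≠ B (φ + 1 * Real.log d / d)} ≤
      Real.log d * ((8 + 4 * L) * (M + 1)) * I := by
    refine hjump.trans ((mul_le_mul_of_nonneg_left hsmooth (by positivity)).trans ?_)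
    rw [← mul_assoc, ← mul_assoc]
    refine mul_le_mul_of_nonneg_right (mul_le_mul_of_nonneg_right ?_ (by positivity)) hI0
    linarith
  rw [Measure.real] at hmain
  rw [mul_div_assoc', one_div_mul_eq_div]
  refine div_le_div_of_nonneg_right ?_ Real.two_pi_pos.le
  rw [inv_eq_one_div, div_div, one_div_mul_eq_div, div_le_iff₀ (by positivity)]
  linarith
end

section
/- Let d ≥ 1 be an integer and let p : ℝ → ℝ be a degree-d polynomial on the circle, i.e., p(θ) = q(cos θ, sin θ) for some bivariate real polynomial q of total degree at most d. Then for every integer k ≥ 1 and every θ ∈ ℝ, the k-th derivative of p satisfies |p^{(k)}(θ)| ≤ 2 d^{k+1} · (1/2π) ∫₀^{2π} |p(φ)| dφ. -/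
open MeasureTheory

/-- The character `θ ↦ exp (i n θ)`. -/
noncomputable def circleExp (n : ℤ) (θ : ℝ) : ℂ := Complex.exp (n * Complex.I * θ)

/-- Complex trigonometric polynomials of degree at most `d`. -/
noncomputable def trigPoly (d : ℕ) : Submodule ℂ (ℝ → ℂ) :=
  Submodule.span ℂ (circleExp '' (Finset.Icc (-(d : ℤ)) d : Finset ℤ))

theorem circleExp_mul (m n : ℤ) : circleExp m * circleExp n = circleExp (m + n) := by
  funext θ
  simp only [circleExp, Pi.mul_apply, ← Complex.exp_add]
  push_cast
  ring_nf

theorem circleExp_mem_trigPoly {d : ℕ} {n : ℤ} (h₁ : -(d : ℤ) ≤ n) (h₂ : n ≤ d) :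
    circleExp n ∈ trigPoly d :=
  Submodule.subset_span ⟨n, by simp [h₁, h₂], rfl⟩

theorem trigPoly_mono {a b : ℕ} (h : a ≤ b) : trigPoly a ≤ trigPoly b := by
  refine Submodule.span_mono (Set.image_mono ?_)
  intro n hn
  simp only [Finset.coe_Icc, Set.mem_Icc] at hn ⊢
  omega

theorem trigPoly_mul_le (a b : ℕ) : trigPoly a * trigPoly b ≤ trigPoly (a + b) := by
  rw [trigPoly, trigPoly, Submodule.span_mul_span, Submodule.span_le]
  rintro _ ⟨_, ⟨m, hm, rfl⟩, _, ⟨n, hn, rfl⟩, rfl⟩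
  simp only [Finset.coe_Icc, Set.mem_Icc] at hm hn
  simp only [circleExp_mul]
  exact circleExp_mem_trigPoly (by push_cast; omega) (by push_cast; omega)

theorem pow_mem_trigPoly {f : ℝ → ℂ} (hf : f ∈ trigPoly 1) (n : ℕ) : f ^ n ∈ trigPoly n := by
  induction n with
  | zero =>
    have h : (f ^ 0) = circleExp 0 := by
      funext θ
      simp [circleExp]
    rw [h]
    exact circleExp_mem_trigPoly (by simp) (by simp)
  | succ n ih =>
    rw [pow_succ]
    exact trigPoly_mul_le n 1 (Submodule.mul_mem_mul ih hf)

theorem cos_mem_trigPoly : (fun θ : ℝ => Complex.cos θ) ∈ trigPoly 1 := by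
  have h : (fun θ : ℝ => Complex.cos θ) =
      (1 / 2 : ℂ) • circleExp 1 + (1 / 2 : ℂ) • circleExp (-1) := by
    funext θ
    simp only [Complex.cos, circleExp, Pi.add_apply, Pi.smul_apply, smul_eq_mul]
    push_cast
    ring_nf
  rw [h]
  exact add_mem (Submodule.smul_mem _ _ (circleExp_mem_trigPoly (by simp) (by simp)))
    (Submodule.smul_mem _ _ (circleExp_mem_trigPoly (by simp) (by simp)))

theorem sin_mem_trigPoly : (fun θ : ℝ => Complex.sin θ) ∈ trigPoly 1 := by
  have h : (fun θ : ℝ => Complex.sin θ) =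
      (Complex.I / 2) • circleExp (-1) + (-(Complex.I / 2)) • circleExp 1 := by
    funext θ
    simp only [Complex.sin, circleExp, Pi.add_apply, Pi.smul_apply, smul_eq_mul]
    push_cast
    ring_nf
  rw [h]
  exact add_mem (Submodule.smul_mem _ _ (circleExp_mem_trigPoly (by simp) (by simp)))
    (Submodule.smul_mem _ _ (circleExp_mem_trigPoly (by simp) (by simp)))

theorem eval_cos_sin_mem_trigPoly {d : ℕ} (q : MvPolynomial (Fin 2) ℝ) (hq : q.totalDegree ≤ d) :
    (fun θ : ℝ => ((MvPolynomial.eval ![Real.cos θ, Real.sin θ] q : ℝ) : ℂ)) ∈ trigPoly d := by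
  have h : (fun θ : ℝ => ((MvPolynomial.eval ![Real.cos θ, Real.sin θ] q : ℝ) : ℂ)) =
      ∑ m ∈ q.support, ((q.coeff m : ℝ) : ℂ) •
        ((fun θ : ℝ => Complex.cos θ) ^ m 0 * (fun θ : ℝ => Complex.sin θ) ^ m 1) := by
    funext θ
    simp [MvPolynomial.eval_eq', Finset.sum_apply, Fin.prod_univ_two]
  rw [h]
  refine Submodule.sum_mem _ fun m hm => Submodule.smul_mem _ _ ?_
  have hdeg : m 0 + m 1 ≤ d := by
    have := (MvPolynomial.le_totalDegree hm).trans hq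
    rwa [Finsupp.sum_fintype _ _ (fun _ => rfl), Fin.sum_univ_two] at this
  exact trigPoly_mono hdeg (trigPoly_mul_le _ _ (Submodule.mul_mem_mul
    (pow_mem_trigPoly cos_mem_trigPoly _) (pow_mem_trigPoly sin_mem_trigPoly _)))

theorem exists_sum_of_mem_trigPoly {d : ℕ} {f : ℝ → ℂ} (hf : f ∈ trigPoly d) :
    ∃ c : ℤ → ℂ, ∀ θ, f θ = ∑ n ∈ Finset.Icc (-(d : ℤ)) d, c n * circleExp n θ := by
  obtain ⟨c, hc⟩ := (Submodule.mem_span_image_finset_iff_exists_fun ℂ).1 hf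
  refine ⟨fun n => if h : n ∈ Finset.Icc (-(d : ℤ)) d then c ⟨n, h⟩ else 0, fun θ => ?_⟩
  rw [← hc, Finset.sum_apply, ← Finset.sum_coe_sort (Finset.Icc (-(d : ℤ)) d)]
  refine Finset.sum_congr rfl fun n _ => ?_
  simp only [n.2, dite_true, Pi.smul_apply, smul_eq_mul]

theorem norm_circleExp (n : ℤ) (θ : ℝ) : ‖circleExp n θ‖ = 1 := by
  rw [circleExp, show (n : ℂ) * Complex.I * θ = ((n * θ : ℝ) : ℂ) * Complex.I by push_cast; ring]
  exact Complex.norm_exp_ofReal_mul_I _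

theorem continuous_circleExp (n : ℤ) : Continuous (circleExp n) := by
  unfold circleExp
  fun_prop

theorem hasDerivAt_circleExp (n : ℤ) (θ : ℝ) :
    HasDerivAt (circleExp n) (n * Complex.I * circleExp n θ) θ := by
  have h := ((Complex.ofRealCLM.hasDerivAt (x := θ)).const_mul ((n : ℂ) * Complex.I)).cexp
  refine h.congr_deriv ?_
  simp [circleExp, mul_comm]

theorem integral_circleExp (n : ℤ) :
    ∫ φ in (0 : ℝ)..(2 * Real.pi), circleExp n φ = if n = 0 then (2 * Real.pi : ℂ) else 0 := by
  split_ifs with h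
  · subst h
    simp [circleExp]
  · have hn : (n : ℂ) * Complex.I ≠ 0 := by simp [h]
    simp only [circleExp]
    rw [integral_exp_mul_complex hn]
    have h1 : Complex.exp (n * Complex.I * ((2 * Real.pi : ℝ) : ℂ)) = 1 := by
      rw [← Complex.exp_int_mul_two_pi_mul_I n]
      push_cast
      ring_nf
    rw [h1]
    simp

/-- Each coefficient of a trigonometric polynomial is bounded by its mean absolute value. -/
theorem norm_coeff_le_of_eq_sum {s : Finset ℤ} {f : ℝ → ℂ} {c : ℤ → ℂ}
    (hf : ∀ θ, f θ = ∑ n ∈ s, c n * circleExp n θ) {m : ℤ} (hm : m ∈ s) :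
    ‖c m‖ ≤ (1 / (2 * Real.pi)) * ∫ φ in (0 : ℝ)..(2 * Real.pi), ‖f φ‖ := by
  have hpi : 0 < 2 * Real.pi := Real.two_pi_pos
  have key : ∫ φ in (0 : ℝ)..(2 * Real.pi), f φ * circleExp (-m) φ = c m * (2 * Real.pi) := by
    have h : ∀ φ, f φ * circleExp (-m) φ = ∑ n ∈ s, c n * circleExp (n - m) φ := by
      intro φ
      rw [hf, Finset.sum_mul]
      refine Finset.sum_congr rfl fun n _ => ?_
      rw [mul_assoc, ← Pi.mul_apply (circleExp n), circleExp_mul, sub_eq_add_neg]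
    simp only [h]
    rw [intervalIntegral.integral_finsetSum fun n _ =>
      ((continuous_circleExp (n - m)).const_mul (c n)).intervalIntegrable _ _]
    simp only [intervalIntegral.integral_const_mul, integral_circleExp, sub_eq_zero]
    simp [hm]
  have hle : ‖c m * (2 * Real.pi)‖ ≤ ∫ φ in (0 : ℝ)..(2 * Real.pi), ‖f φ‖ := by
    rw [← key]
    refine (intervalIntegral.norm_integral_le_integral_norm hpi.le).trans_eq ?_
    simp [norm_circleExp]
  rw [norm_mul, show ‖(2 * Real.pi : ℂ)‖ = 2 * Real.pi by
    simp [abs_of_pos Real.pi_pos]] at hle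
  rwa [one_div, ← div_eq_inv_mul, le_div_iff₀ hpi]

theorem iteratedDeriv_eq_re_sum {s : Finset ℤ} {p : ℝ → ℝ} {c : ℤ → ℂ}
    (hp : ∀ θ, (p θ : ℂ) = ∑ n ∈ s, c n * circleExp n θ) (k : ℕ) :
    iteratedDeriv k p =
      fun θ => (∑ n ∈ s, c n * ((n * Complex.I) ^ k * circleExp n θ)).re := by
  induction k with
  | zero =>
    funext θ
    simp [← hp]
  | succ k ih =>
    rw [iteratedDeriv_succ, ih]
    funext θ
    have h : HasDerivAt (fun θ => ∑ n ∈ s, c n * ((n * Complex.I) ^ k * circleExp n θ))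
        (∑ n ∈ s, c n * ((n * Complex.I) ^ k * (n * Complex.I * circleExp n θ))) θ :=
      HasDerivAt.fun_sum fun n _ =>
        ((hasDerivAt_circleExp n θ).const_mul _).const_mul _
    refine (Complex.reCLM.hasFDerivAt.comp_hasDerivAt θ h).deriv.trans ?_
    simp only [Complex.reCLM_apply, pow_succ, mul_assoc]

theorem sum_abs_pow_le (d : ℕ) {k : ℕ} (hk : 0 < k) :
    ∑ n ∈ Finset.Icc (-(d : ℤ)) d, |(n : ℝ)| ^ k ≤ 2 * (d : ℝ) ^ (k + 1) := by
  have h0 : (0 : ℤ) ∈ Finset.Icc (-(d : ℤ)) d := by simp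
  rw [← Finset.add_sum_erase _ _ h0]
  have hcard : ((Finset.Icc (-(d : ℤ)) d).erase 0).card = 2 * d := by
    rw [Finset.card_erase_of_mem h0, Int.card_Icc]
    omega
  have hle := Finset.sum_le_card_nsmul ((Finset.Icc (-(d : ℤ)) d).erase 0)
    (fun n : ℤ => |(n : ℝ)| ^ k) ((d : ℝ) ^ k) (fun n hn => by
      have hn' := Finset.mem_Icc.1 (Finset.mem_of_mem_erase hn)
      have : |(n : ℝ)| ≤ d := by exact_mod_cast abs_le.2 hn'
      gcongr)
  rw [hcard, nsmul_eq_mul] at hle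
  push_cast at hle
  rw [Int.cast_zero, abs_zero, zero_pow hk.ne', zero_add, pow_succ']
  linarith

/-- Derivative bound for polynomials on the circle: if `p(θ) = q(cos θ, sin θ)` for a
bivariate polynomial `q` of total degree at most `d`, then for every `k ≥ 1` and `θ ∈ ℝ`,
`|p^{(k)}(θ)| ≤ 2 d^{k+1} · (1/2π) ∫₀^{2π} |p(φ)| dφ`. -/
theorem stmt_12 (d : ℕ) (hd : 0 < d) (p : ℝ → ℝ)
    (hp : ∃ q : MvPolynomial (Fin 2) ℝ, q.totalDegree ≤ d ∧
      ∀ θ : ℝ, p θ = MvPolynomial.eval ![Real.cos θ, Real.sin θ] q)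
    (k : ℕ) (hk : 0 < k) (θ : ℝ) :
    |iteratedDeriv k p θ| ≤
      2 * (d : ℝ) ^ (k + 1) *
        ((1 / (2 * Real.pi)) * ∫ φ in (0:ℝ)..(2 * Real.pi), |p φ|) := by
  obtain ⟨q, hq, hpq⟩ := hp
  obtain ⟨c, hc⟩ := exists_sum_of_mem_trigPoly (eval_cos_sin_mem_trigPoly q hq)
  simp only [← hpq] at hc
  rw [iteratedDeriv_eq_re_sum hc k]
  set A := (1 / (2 * Real.pi)) * ∫ φ in (0:ℝ)..(2 * Real.pi), |p φ| with hA
  have hcoeff : ∀ n ∈ Finset.Icc (-(d : ℤ)) d, ‖c n‖ ≤ A := fun n hn => by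
    simpa [hA] using norm_coeff_le_of_eq_sum hc hn
  have hA0 : 0 ≤ A := (norm_nonneg _).trans (hcoeff 0 (by simp))
  calc _ ≤ ‖∑ n ∈ Finset.Icc (-(d : ℤ)) d, c n * ((n * Complex.I) ^ k * circleExp n θ)‖ :=
        Complex.abs_re_le_norm _
    _ ≤ ∑ n ∈ Finset.Icc (-(d : ℤ)) d, |(n : ℝ)| ^ k * A := by
        refine norm_sum_le_of_le _ fun n hn => ?_
        rw [norm_mul, norm_mul, norm_circleExp, norm_pow, norm_mul, Complex.norm_I,
          Complex.norm_intCast, mul_one, mul_one, mul_comm]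
        gcongr
        exact hcoeff n hn
    _ ≤ 2 * (d : ℝ) ^ (k + 1) * A := by
        rw [← Finset.sum_mul]
        exact mul_le_mul_of_nonneg_right (sum_abs_pow_le d hk) hA0
end

section
/- Let p ∈ [1, 2] and let ReLU : ℝ → ℝ be defined by ReLU(t) = max{0, t}. There exist constants c > 0, C > 0, and ε₀ > 0 (depending only on p) such that for all ε ∈ (0, ε₀): (i) every polynomial P : ℝ → ℝ satisfying (E_{x∼γ₁}[|ReLU(x) − P(x)|^p])^{1/p} ≤ ε has degree at least c · ε^{−2p/(p+1)}; and (ii) there exists a polynomial P of degree at most C · ε^{−2p/(p+1)} satisfying (E_{x∼γ₁}[|ReLU(x) − P(x)|^p])^{1/p} ≤ ε. (Note 2p/(p+1) = 2/(1 + 1/p); for p = 1 the exponent is 1, and for p = 2 it is 4/3.) -/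
open MeasureTheory ProbabilityTheory

namespace ReLUApprox

open Polynomial

/-- The polynomials with `u₀ = y²` and `uᵢ₊₁ = 4 uᵢ (1 - uᵢ)`, so that `uᵢ (sin θ) = sin² (2ⁱ θ)`. -/
noncomputable def logisticPoly : ℕ → ℝ[X]
  | 0 => X ^ 2
  | i + 1 => 4 * logisticPoly i * (1 - logisticPoly i)

/-- The polynomial `∏_{i < r} (1 - uᵢ)`, whose value at `sin θ` is
`(sin (2ʳ θ) / (2ʳ sin θ))²`. -/
noncomputable def fejerPoly : ℕ → ℝ[X]
  | 0 => 1
  | r + 1 => fejerPoly r * (1 - logisticPoly r)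

lemma eval_logisticPoly_succ (i : ℕ) (y : ℝ) : (logisticPoly (i + 1)).eval y =
    4 * (logisticPoly i).eval y * (1 - (logisticPoly i).eval y) := by
  simp [logisticPoly]

lemma eval_fejerPoly_succ (r : ℕ) (y : ℝ) : (fejerPoly (r + 1)).eval y =
    (fejerPoly r).eval y * (1 - (logisticPoly r).eval y) := by
  simp [fejerPoly]

lemma four_pow_mul_sq_mul_eval_fejerPoly (r : ℕ) (y : ℝ) :
    4 ^ r * y ^ 2 * (fejerPoly r).eval y = (logisticPoly r).eval y := by
  induction r with
  | zero => simp [fejerPoly, logisticPoly]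
  | succ r ih =>
    rw [eval_fejerPoly_succ, eval_logisticPoly_succ, ← ih]
    ring

lemma eval_logisticPoly_mem (i : ℕ) {y : ℝ} (hy : y ^ 2 ≤ 1) :
    0 ≤ (logisticPoly i).eval y ∧ (logisticPoly i).eval y ≤ 1 := by
  induction i with
  | zero => simp [logisticPoly, hy, sq_nonneg]
  | succ i ih =>
    rw [eval_logisticPoly_succ]
    obtain ⟨h0, h1⟩ := ih
    constructor
    · have : 0 ≤ 1 - (logisticPoly i).eval y := by linarith
      positivity
    · nlinarith [sq_nonneg (2 * (logisticPoly i).eval y - 1)]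

lemma eval_fejerPoly_mem (r : ℕ) {y : ℝ} (hy : y ^ 2 ≤ 1) :
    0 ≤ (fejerPoly r).eval y ∧ (fejerPoly r).eval y ≤ 1 := by
  induction r with
  | zero => simp [fejerPoly]
  | succ r ih =>
    rw [eval_fejerPoly_succ]
    obtain ⟨h0, h1⟩ := ih
    obtain ⟨u0, u1⟩ := eval_logisticPoly_mem r hy
    constructor
    · exact mul_nonneg h0 (by linarith)
    · nlinarith

lemma eval_logisticPoly_le (i : ℕ) {y : ℝ} (hy : y ^ 2 ≤ 1) :
    (logisticPoly i).eval y ≤ 4 ^ i * y ^ 2 := by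
  rw [← four_pow_mul_sq_mul_eval_fejerPoly]
  exact mul_le_of_le_one_right (by positivity) (eval_fejerPoly_mem i hy).2

lemma le_eval_fejerPoly (r : ℕ) {y : ℝ} (hy : y ^ 2 ≤ 1) :
    1 - 4 ^ r * y ^ 2 / 3 ≤ (fejerPoly r).eval y := by
  suffices 1 - (4 ^ r - 1) * y ^ 2 / 3 ≤ (fejerPoly r).eval y by
    nlinarith [sq_nonneg y]
  induction r with
  | zero => simp [fejerPoly]
  | succ r ih =>
    rw [eval_fejerPoly_succ]
    have h1 := eval_fejerPoly_mem r hy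
    have h2 := eval_logisticPoly_mem r hy
    have h3 := eval_logisticPoly_le r hy
    have : (fejerPoly r).eval y * (logisticPoly r).eval y ≤ (logisticPoly r).eval y :=
      mul_le_of_le_one_left h2.1 h1.2
    rw [pow_succ]
    linarith

lemma eight_mul_abs_eval_logisticPoly_le (i : ℕ) {y : ℝ} (hy : 1 ≤ y ^ 2) :
    8 * |(logisticPoly i).eval y| ≤ (8 * y ^ 2) ^ 2 ^ i := by
  induction i with
  | zero => simp [logisticPoly]
  | succ i ih =>
    rw [eval_logisticPoly_succ, abs_mul, abs_mul, pow_succ 2 i, pow_mul]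
    set B := (8 * y ^ 2) ^ 2 ^ i
    have hB : 8 ≤ B := by
      calc (8 : ℝ) ≤ 8 * y ^ 2 := by linarith
        _ ≤ B := le_self_pow₀ (by linarith) (by positivity)
    have h1 : |1 - (logisticPoly i).eval y| ≤ 1 + |(logisticPoly i).eval y| := by
      simpa using abs_sub 1 ((logisticPoly i).eval y)
    have h2 := abs_nonneg ((logisticPoly i).eval y)
    have h4 : |(4 : ℝ)| = 4 := by norm_num
    rw [h4]
    calc 8 * (4 * |(logisticPoly i).eval y| * |1 - (logisticPoly i).eval y|)
        ≤ 4 * B * (B / 8 + B / 8) := by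
          have : |1 - (logisticPoly i).eval y| ≤ B / 8 + B / 8 := by linarith
          have h5 := mul_le_mul ih this (abs_nonneg _) (by positivity)
          linarith
      _ = B ^ 2 := by ring

lemma mul_abs_eval_fejerPoly_le (r : ℕ) {y : ℝ} (hy : 1 ≤ y ^ 2) :
    8 * y ^ 2 * |(fejerPoly r).eval y| ≤ (8 * y ^ 2) ^ 2 ^ r := by
  induction r with
  | zero => simp [fejerPoly]
  | succ r ih =>
    rw [eval_fejerPoly_succ, abs_mul, pow_succ 2 r, pow_mul]
    have hu := eight_mul_abs_eval_logisticPoly_le r hy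
    set B := (8 * y ^ 2) ^ 2 ^ r
    have hB : 8 ≤ B := by
      calc (8 : ℝ) ≤ 8 * y ^ 2 := by linarith
        _ ≤ B := le_self_pow₀ (by linarith) (by positivity)
    have h1 : |1 - (logisticPoly r).eval y| ≤ 1 + |(logisticPoly r).eval y| := by
      simpa using abs_sub 1 ((logisticPoly r).eval y)
    have : |1 - (logisticPoly r).eval y| ≤ B := by linarith
    have h5 := mul_le_mul ih this (abs_nonneg _) (by positivity)
    nlinarith

lemma natDegree_logisticPoly_le (i : ℕ) : (logisticPoly i).natDegree ≤ 2 ^ (i + 1) := by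
  induction i with
  | zero => simp [logisticPoly]
  | succ i ih =>
    have : logisticPoly (i + 1) = C 4 * logisticPoly i * (1 - logisticPoly i) := rfl
    rw [this, mul_assoc]
    refine (natDegree_C_mul_le _ _).trans (natDegree_mul_le.trans ?_)
    have := natDegree_sub_le (1 : ℝ[X]) (logisticPoly i)
    simp only [natDegree_one] at this
    rw [pow_succ]
    omega

lemma natDegree_fejerPoly_le (r : ℕ) : (fejerPoly r).natDegree + 2 ≤ 2 ^ (r + 1) := by
  induction r with
  | zero => simp [fejerPoly]
  | succ r ih =>
    have h0 : (fejerPoly (r + 1)).natDegree ≤ _ := natDegree_mul_le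
    have := natDegree_sub_le (1 : ℝ[X]) (logisticPoly r)
    have h1 := natDegree_logisticPoly_le r
    simp only [natDegree_one] at this
    rw [pow_succ]
    omega

lemma eval_neg_logisticPoly (i : ℕ) (y : ℝ) :
    (logisticPoly i).eval (-y) = (logisticPoly i).eval y := by
  induction i with
  | zero => simp [logisticPoly]
  | succ i ih => rw [eval_logisticPoly_succ, eval_logisticPoly_succ, ih]

lemma eval_neg_fejerPoly (r : ℕ) (y : ℝ) :
    (fejerPoly r).eval (-y) = (fejerPoly r).eval y := by
  induction r with
  | zero => simp [fejerPoly]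
  | succ r ih => rw [eval_fejerPoly_succ, eval_fejerPoly_succ, ih, eval_neg_logisticPoly]

lemma exists_derivative_eq (K : ℝ[X]) :
    ∃ A : ℝ[X], derivative A = K ∧ A.natDegree ≤ K.natDegree + 1 := by
  refine ⟨∑ i ∈ Finset.range (K.natDegree + 1), monomial (i + 1) (K.coeff i / (i + 1)), ?_, ?_⟩
  · conv_rhs => rw [K.as_sum_range]
    rw [derivative_sum]
    refine Finset.sum_congr rfl fun i _ => ?_
    rw [derivative_monomial]
    have : (i : ℝ) + 1 ≠ 0 := by positivity
    simp only [Nat.add_sub_cancel]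
    congr 1
    push_cast
    field_simp
  · refine natDegree_sum_le_of_forall_le _ _ fun i hi => ?_
    exact (natDegree_monomial_le _).trans (by simp at hi; omega)

lemma exists_odd_derivative_eq (K : ℝ[X]) (hK : ∀ y, K.eval (-y) = K.eval y) :
    ∃ A : ℝ[X], (∀ y, HasDerivAt (fun y => A.eval y) (K.eval y) y) ∧
      (∀ y, A.eval (-y) = -A.eval y) ∧ A.natDegree ≤ K.natDegree + 1 := by
  obtain ⟨B, hB, hd⟩ := exists_derivative_eq K
  refine ⟨C (1 / 2) * (B - B.comp (-X)), fun y => ?_, fun y => ?_, ?_⟩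
  · refine (Polynomial.hasDerivAt (C (1 / 2) * (B - B.comp (-X))) y).congr_deriv ?_
    simp [derivative_comp, hB, hK]
    ring
  · simp only [eval_mul, eval_C, eval_sub, eval_comp, eval_neg, eval_X, neg_neg]
    ring
  · refine (natDegree_C_mul_le _ _).trans ((natDegree_sub_le _ _).trans ?_)
    rw [natDegree_comp]
    simpa using hd

/-- An odd polynomial approximation of the sign function on `[-1, 1]` at scale `2⁻ʳ`. -/
lemma exists_sign_approx (r : ℕ) : ∃ S : ℝ[X], S.natDegree + 3 ≤ 2 ^ (r + 2) ∧
    (∀ y, S.eval (-y) = -S.eval y) ∧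
    (∀ y, 0 ≤ y → y ≤ 1 → |1 - S.eval y| ≤ 1 ∧ (2 ^ r * y) ^ 3 * |1 - S.eval y| ≤ 1) ∧
    (∀ y, 1 ≤ |y| → |S.eval y| ≤ 3 * 2 ^ r * |y| * (8 * y ^ 2) ^ (2 * 2 ^ r - 2)) := by
  set m : ℝ := 2 ^ r with hm
  have hm0 : 1 ≤ m := one_le_pow₀ (by norm_num)
  have hm4 : (4 : ℝ) ^ r = m ^ 2 := by rw [hm, ← pow_mul, mul_comm, pow_mul]; norm_num
  set k : ℝ → ℝ := fun y => (fejerPoly r).eval y with hk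
  obtain ⟨A, hA, hodd, hdeg⟩ := exists_odd_derivative_eq (fejerPoly r ^ 2)
    (fun y => by simp [eval_neg_fejerPoly])
  set a : ℝ → ℝ := fun y => A.eval y with ha
  have hA' : ∀ y, HasDerivAt a (k y ^ 2) y := fun y => by simpa using hA y
  have hdiff : Differentiable ℝ a := fun y => (hA' y).differentiableAt
  have hmono : Monotone a := monotone_of_deriv_nonneg hdiff fun y => by
    rw [(hA' y).deriv]; positivity
  have ha0 : a 0 = 0 := by have := hodd 0; simp at this; simp [ha]; linarith
  have hminv : m⁻¹ ≤ 1 := inv_le_one_of_one_le₀ hm0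
  have hZ1 : 4 / 9 / m ≤ a m⁻¹ := by
    have := (convex_Icc (0 : ℝ) m⁻¹).mul_sub_le_image_sub_of_le_deriv (f := a) (C := 4 / 9)
      hdiff.continuous.continuousOn hdiff.differentiableOn (fun y hy => by
        rw [interior_Icc] at hy
        rw [(hA' y).deriv]
        have hmy : m * y ≤ 1 := by
          have := mul_le_mul_of_nonneg_left hy.2.le (zero_le_one.trans hm0)
          rwa [mul_inv_cancel₀ (by positivity)] at this
        have hmy2 : m ^ 2 * y ^ 2 ≤ 1 := by
          rw [← mul_pow]; exact pow_le_one₀ (mul_nonneg (by positivity) hy.1.le) hmy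
        have hy1 : y ^ 2 ≤ 1 := pow_le_one₀ hy.1.le (hy.2.le.trans hminv)
        have h2 := le_eval_fejerPoly r hy1
        rw [hm4] at h2
        have : 2 / 3 ≤ k y := by simp only [hk]; linarith
        nlinarith) 0 (by simp; linarith) m⁻¹ (by simp; linarith) (by positivity)
    simp only [ha0, sub_zero] at this
    rwa [div_eq_mul_inv]
  have hZ : 4 / 9 / m ≤ a 1 := hZ1.trans (hmono hminv)
  have hZ0 : 0 < a 1 := lt_of_lt_of_le (by positivity) hZ
  have hZinv : (a 1)⁻¹ ≤ 9 / 4 * m := by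
    rw [inv_le_comm₀ hZ0 (by positivity)]
    refine le_trans (le_of_eq ?_) hZ
    field_simp
  refine ⟨C (a 1)⁻¹ * A, ?_, fun y => ?_, fun y hy0 hy1 => ?_, fun y hy => ?_⟩
  · have h1 := natDegree_C_mul_le (a 1)⁻¹ A
    have h2 := natDegree_pow_le (p := fejerPoly r) (n := 2)
    have h3 := natDegree_fejerPoly_le r
    rw [pow_succ]
    omega
  · simp [hodd]
  · have e : 1 - (C (a 1)⁻¹ * A).eval y = (a 1 - a y) * (a 1)⁻¹ := by
      simp only [eval_mul, eval_C, ha]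
      have : A.eval 1 ≠ 0 := hZ0.ne'
      field_simp
    have h1 : 0 ≤ a 1 - a y := sub_nonneg.2 (hmono hy1)
    have h2 : 0 ≤ a y := by rw [← ha0]; exact hmono hy0
    rw [e, abs_of_nonneg (by positivity)]
    constructor
    · rw [← div_eq_mul_inv, div_le_one hZ0]; linarith
    · rcases hy0.eq_or_lt with rfl | hy0
      · simp
      have key : a 1 - a y ≤ 1 / (3 * m ^ 4 * y ^ 3) := by
        have hd : ∀ s ∈ Set.Icc y 1, HasDerivAt (fun s => a s + 1 / (3 * m ^ 4) * (s ^ 3)⁻¹)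
            (k s ^ 2 - 1 / (m ^ 4 * s ^ 4)) s := fun s hs => by
          have hs0 : 0 < s := hy0.trans_le hs.1
          refine ((hA' s).add (((hasDerivAt_pow 3 s).fun_inv (by positivity)).const_mul
            (1 / (3 * m ^ 4)))).congr_deriv ?_
          field_simp
          norm_num
          ring
        have hanti : AntitoneOn (fun s => a s + 1 / (3 * m ^ 4) * (s ^ 3)⁻¹) (Set.Icc y 1) := by
          refine antitoneOn_of_deriv_nonpos (convex_Icc _ _)
            (fun s hs => (hd s hs).continuousAt.continuousWithinAt) (fun s hs => ?_)
            (fun s hs => ?_)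
          · exact (hd s (interior_subset hs)).differentiableAt.differentiableWithinAt
          · have hs := interior_subset hs
            rw [(hd s hs).deriv]
            have hs0 : 0 < s := hy0.trans_le hs.1
            have hs2 : s ^ 2 ≤ 1 := pow_le_one₀ hs0.le hs.2
            have h3 := four_pow_mul_sq_mul_eval_fejerPoly r s
            have h4 := (eval_logisticPoly_mem r hs2).2
            have h5 := (eval_fejerPoly_mem r hs2).1
            rw [hm4] at h3
            have h6 : k s ≤ 1 / (m ^ 2 * s ^ 2) := by
              rw [le_div_iff₀ (by positivity)]; simp only [hk]; linarith
            have h7 : k s ^ 2 ≤ (1 / (m ^ 2 * s ^ 2)) ^ 2 := pow_le_pow_left₀ h5 h6 2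
            have h8 : (1 / (m ^ 2 * s ^ 2)) ^ 2 = 1 / (m ^ 4 * s ^ 4) := by
              rw [div_pow, mul_pow]; ring
            linarith
        have := hanti (Set.left_mem_Icc.2 hy1) (Set.right_mem_Icc.2 hy1) hy1
        simp only at this
        have e2 : 1 / (3 * m ^ 4 * y ^ 3) = 1 / (3 * m ^ 4) * (y ^ 3)⁻¹ := by
          field_simp
        rw [e2]
        have : 0 ≤ 1 / (3 * m ^ 4) * ((1 : ℝ) ^ 3)⁻¹ := by positivity
        linarith
      calc (m * y) ^ 3 * ((a 1 - a y) * (a 1)⁻¹)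
          ≤ (m * y) ^ 3 * (1 / (3 * m ^ 4 * y ^ 3) * (9 / 4 * m)) := by gcongr
        _ = 3 / 4 := by field_simp; norm_num
        _ ≤ 1 := by norm_num
  · simp only [eval_mul, eval_C]
    rw [abs_mul, abs_of_pos (inv_pos.2 hZ0)]
    set M := (8 * y ^ 2) ^ (2 * 2 ^ r - 2) with hM
    have hy2 : 1 ≤ y ^ 2 := by rw [← sq_abs]; exact one_le_pow₀ hy
    have hM1 : 1 ≤ M := one_le_pow₀ (by linarith)
    have hbd : ∀ s ∈ Set.Icc (-|y|) |y|, ‖k s ^ 2‖ ≤ M := fun s hs => by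
      rw [Real.norm_eq_abs, abs_pow]
      rcases le_total (s ^ 2) 1 with h | h
      · have := eval_fejerPoly_mem r h
        rw [abs_of_nonneg this.1]
        exact (pow_le_one₀ this.1 this.2).trans hM1
      · have h3 := mul_abs_eval_fejerPoly_le r h
        have h4 : (8 * s ^ 2) ^ 2 ^ r = 8 * s ^ 2 * (8 * s ^ 2) ^ (2 ^ r - 1) := by
          rw [← pow_succ']; congr 1; have := Nat.one_le_two_pow (n := r); omega
        rw [h4] at h3
        have h5 := le_of_mul_le_mul_left h3 (by positivity)
        have h6 : s ^ 2 ≤ y ^ 2 := sq_le_sq.2 (abs_le.2 hs)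
        calc |k s| ^ 2 ≤ ((8 * s ^ 2) ^ (2 ^ r - 1)) ^ 2 := pow_le_pow_left₀ (abs_nonneg _) h5 2
          _ ≤ ((8 * y ^ 2) ^ (2 ^ r - 1)) ^ 2 := by gcongr
          _ = M := by rw [← pow_mul, hM]; congr 1; omega
    have h7 := (convex_Icc (-|y|) |y|).norm_image_sub_le_of_norm_hasDerivWithin_le
      (fun s _ => (hA' s).hasDerivWithinAt) hbd (x := 0) (y := y) (by simp)
      ⟨neg_abs_le y, le_abs_self y⟩
    rw [ha0, sub_zero, sub_zero, Real.norm_eq_abs, Real.norm_eq_abs] at h7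
    calc (a 1)⁻¹ * |A.eval y| ≤ 9 / 4 * m * (M * |y|) := by gcongr
      _ ≤ 3 * m * (M * |y|) := by gcongr; norm_num
      _ = 3 * m * |y| * M := by ring

lemma exists_reLU_approx (r : ℕ) {R : ℝ} (hR : 0 < R) : ∃ P : ℝ[X],
    P.natDegree ≤ 4 * 2 ^ r ∧
    (∀ x, |x| ≤ R → |max 0 x - P.eval x| ≤ R / 2 ^ r * (1 + (x / (R / 2 ^ r)) ^ 2)⁻¹) ∧
    (∀ x, R ≤ |x| → |max 0 x - P.eval x| ≤ R * 2 ^ r * (8 * x ^ 2 / R ^ 2) ^ (2 * 2 ^ r)) := by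
  obtain ⟨S, hdeg, hodd, hin, hout⟩ := exists_sign_approx r
  refine ⟨C (1 / 2) * (X + X * S.comp (C R⁻¹ * X)), ?_, fun x hx => ?_, fun x hx => ?_⟩
  · refine (natDegree_C_mul_le _ _).trans ((natDegree_add_le _ _).trans (max_le ?_ ?_))
    · rw [natDegree_X]; have := Nat.one_le_two_pow (n := r); omega
    · refine natDegree_mul_le.trans ?_
      have h1 : (S.comp (C R⁻¹ * X)).natDegree ≤ S.natDegree * 1 := by
        rw [natDegree_comp]
        gcongr
        exact (natDegree_C_mul_le _ _).trans natDegree_X.le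
      rw [natDegree_X]
      rw [pow_add] at hdeg
      omega
  all_goals
    have herr : |max 0 x - (C (1 / 2) * (X + X * S.comp (C R⁻¹ * X))).eval x| =
        |x| * |1 - S.eval (|x| / R)| / 2 := by
      have : max 0 x - (C (1 / 2) * (X + X * S.comp (C R⁻¹ * X))).eval x =
          |x| * (1 - S.eval (|x| / R)) / 2 := by
        simp only [eval_mul, eval_C, eval_add, eval_X, eval_comp]
        rcases le_total 0 x with h | h
        · rw [max_eq_right h, abs_of_nonneg h, div_eq_inv_mul x R]
          ring
        · rw [max_eq_left h, abs_of_nonpos h, div_eq_inv_mul (-x) R, mul_neg, hodd]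
          ring
      rw [this, abs_div, abs_mul, abs_abs, abs_two]
    rw [herr]
    set m : ℝ := 2 ^ r with hm
    have hm1 : 1 ≤ m := one_le_pow₀ (by norm_num)
    obtain ⟨y, rfl⟩ : ∃ y, x = R * y := ⟨x / R, by field_simp⟩
    have habs : |R * y| = R * |y| := by rw [abs_mul, abs_of_pos hR]
    rw [habs] at hx ⊢
    have e1 : R * |y| / R = |y| := by field_simp
    rw [e1]
  · have hy : |y| ≤ 1 := by
      have := (div_le_one hR).2 hx
      rwa [e1] at this
    obtain ⟨h1, h2⟩ := hin |y| (abs_nonneg _) hy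
    have e2 : R * y / (R / m) = m * y := by field_simp
    rw [e2, ← sq_abs (m * y), abs_mul, abs_of_pos (by positivity : 0 < m)]
    set t := m * |y| with ht
    have ht0 : 0 ≤ t := by positivity
    have e3 : R * |y| = R / m * t := by rw [ht]; field_simp
    rw [e3, mul_assoc, mul_div_assoc]
    gcongr
    rw [← one_div, le_div_iff₀ (by positivity)]
    set d := |1 - S.eval (|y|)|
    have hd : 0 ≤ d := abs_nonneg _
    rcases le_total t 1 with h | h
    · have a1 : t * d ≤ 1 := mul_le_one₀ h hd h1
      have a2 : t ^ 2 ≤ 1 := pow_le_one₀ ht0 h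
      nlinarith [mul_nonneg ht0 hd]
    · have a1 : t * d ≤ t ^ 3 * d := by gcongr; exact le_self_pow₀ h (by norm_num)
      have a2 : t * d * t ^ 2 = t ^ 3 * d := by ring
      nlinarith
  · have hy : 1 ≤ |y| := by
      have := (one_le_div hR).2 hx
      rwa [e1] at this
    have h1 := hout |y| (by rwa [abs_abs])
    rw [abs_abs, sq_abs] at h1
    have e2 : 8 * (R * y) ^ 2 / R ^ 2 = 8 * y ^ 2 := by field_simp
    rw [e2]
    have hy2 : 1 ≤ y ^ 2 := by rw [← sq_abs]; exact one_le_pow₀ hy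
    set n := 2 ^ r with hn
    have hn1 : 1 ≤ n := Nat.one_le_two_pow
    set Q := (8 * y ^ 2) ^ (2 * n - 2) with hQ
    have hQ1 : 1 ≤ Q := one_le_pow₀ (by linarith)
    have hb : 1 ≤ m * |y| * Q := one_le_mul_of_one_le_of_one_le
      (one_le_mul_of_one_le_of_one_le hm1 hy) hQ1
    have h3 : |1 - S.eval (|y|)| ≤ 4 * (m * |y| * Q) := by
      have := abs_sub 1 (S.eval |y|)
      rw [abs_one] at this
      linarith
    have e4 : (8 * y ^ 2) ^ (2 * n) = Q * (8 * y ^ 2) ^ 2 := by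
      rw [hQ, ← pow_add]; congr 1; omega
    calc R * |y| * |1 - S.eval (|y|)| / 2 ≤ R * |y| * (4 * (m * |y| * Q)) / 2 := by gcongr
      _ = R * m * (Q * (2 * y ^ 2)) := by rw [← sq_abs y]; ring
      _ ≤ R * m * (Q * (8 * y ^ 2) ^ 2) := by gcongr; nlinarith
      _ = _ := by rw [e4]

lemma gaussianPDFReal_zero_one (x : ℝ) :
    gaussianPDFReal 0 1 x = (√(2 * Real.pi))⁻¹ * Real.exp (-(x ^ 2) / 2) := by
  simp [gaussianPDFReal]

lemma gaussianPDFReal_zero_one_le (x : ℝ) : gaussianPDFReal 0 1 x ≤ Real.exp (-(x ^ 2) / 2) := by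
  rw [gaussianPDFReal_zero_one]
  refine mul_le_of_le_one_left (Real.exp_pos _).le (inv_le_one_of_one_le₀ ?_)
  rw [Real.one_le_sqrt]
  linarith [Real.pi_gt_three]

lemma integrable_inv_one_add_div_sq {h : ℝ} (hh : 0 < h) :
    Integrable fun x : ℝ => (1 + (x / h) ^ 2)⁻¹ :=
  integrable_inv_one_add_sq.comp_div hh.ne'

lemma integral_inv_one_add_div_sq {h : ℝ} (hh : 0 < h) :
    ∫ x : ℝ, (1 + (x / h) ^ 2)⁻¹ = h * Real.pi := by
  rw [Measure.integral_comp_div (fun x : ℝ => (1 + x ^ 2)⁻¹), integral_univ_inv_one_add_sq,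
    abs_of_pos hh, smul_eq_mul]

lemma tail_pow_le (r : ℕ) (x : ℝ) :
    (8 * x ^ 2 / (1024 * 2 ^ r)) ^ (4 * 2 ^ r) ≤ ((2 ^ r : ℝ) ^ 5)⁻¹ * Real.exp (x ^ 2 / 4) := by
  set n : ℕ := 2 ^ r with hn
  have hn1 : 1 ≤ n := Nat.one_le_two_pow
  have hm : (2 : ℝ) ^ r = n := by simp [hn]
  rw [hm]
  have hn0 : (0 : ℝ) < n := by exact_mod_cast hn1
  have h1 := Real.pow_div_factorial_le_exp (x := x ^ 2 / 4) (by positivity) (4 * n)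
  rw [div_le_iff₀ (by positivity)] at h1
  have h2 : (((4 * n).factorial : ℕ) : ℝ) ≤ (4 * n) ^ (4 * n) := by
    exact_mod_cast Nat.factorial_le_pow (4 * n)
  have h3 : (n : ℝ) ≤ 2 ^ n := by exact_mod_cast Nat.lt_two_pow_self.le
  have h4 : (n : ℝ) ^ 5 ≤ 8 ^ (4 * n) := by
    calc (n : ℝ) ^ 5 ≤ (2 ^ n) ^ 5 := by gcongr
      _ = 2 ^ (n * 5) := by rw [pow_mul]
      _ ≤ 2 ^ (3 * (4 * n)) := pow_le_pow_right₀ one_le_two (by omega)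
      _ = _ := by rw [pow_mul]; norm_num
  have e : 8 * x ^ 2 / (1024 * n) = x ^ 2 / 4 * (1 / (32 * n)) := by field_simp; ring
  rw [e, mul_pow]
  calc (x ^ 2 / 4) ^ (4 * n) * (1 / (32 * (n : ℝ))) ^ (4 * n)
      ≤ Real.exp (x ^ 2 / 4) * (4 * n) ^ (4 * n) * (1 / (32 * (n : ℝ))) ^ (4 * n) := by
        gcongr
        exact h1.trans (by gcongr)
    _ = (8 ^ (4 * n))⁻¹ * Real.exp (x ^ 2 / 4) := by
        rw [mul_assoc, ← mul_pow]
        have : 4 * (n : ℝ) * (1 / (32 * n)) = 8⁻¹ := by field_simp; norm_num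
        rw [this, inv_pow, mul_comm]
    _ ≤ _ := by gcongr

/-- A polynomial of degree `≤ 4 m`, `m = 2ʳ`, with `‖ReLU - P‖_p^p = O(m^(-(p+1)/2))`. -/
lemma exists_reLU_approx_integral {p : ℝ} (hp1 : 1 ≤ p) (hp2 : p ≤ 2) (r : ℕ) : ∃ P : ℝ[X],
    P.natDegree ≤ 4 * 2 ^ r ∧
    ∫ x, |max 0 x - P.eval x| ^ p ∂(gaussianReal 0 1) ≤
      140000 * ((2 : ℝ) ^ r) ^ (-((p + 1) / 2)) := by
  set m : ℝ := 2 ^ r with hm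
  have hm1 : 1 ≤ m := one_le_pow₀ (by norm_num)
  have hm0 : 0 < m := by positivity
  set R : ℝ := 32 * √m with hRdef
  have hsm : √m ^ 2 = m := Real.sq_sqrt hm0.le
  have hsm0 : 0 < √m := Real.sqrt_pos.2 hm0
  have hR : 0 < R := by positivity
  have hR2 : R ^ 2 = 1024 * m := by rw [hRdef, mul_pow, hsm]; norm_num
  have hR1 : 1 ≤ R := by
    have : 1 ≤ √m := Real.one_le_sqrt.2 hm1
    linarith
  set h : ℝ := R / m with hh
  have hh0 : 0 < h := by positivity
  have hheq : h = 32 * m ^ (-(1 / 2) : ℝ) := by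
    rw [hh, hRdef, Real.rpow_neg hm0.le, ← Real.sqrt_eq_rpow]
    field_simp
    rw [hsm]
  obtain ⟨P, hdeg, hin, hout⟩ := exists_reLU_approx r hR
  refine ⟨P, hdeg, ?_⟩
  have hpt : ∀ x : ℝ, |max 0 x - P.eval x| ^ p ≤
      h ^ p * (1 + (x / h) ^ 2)⁻¹ + 1024 * (m ^ 2)⁻¹ * Real.exp (x ^ 2 / 4) := fun x => by
    rcases le_total |x| R with hx | hx
    · refine le_add_of_le_of_nonneg ?_ (by positivity)
      refine (Real.rpow_le_rpow (abs_nonneg _) (hin x hx) (by linarith)).trans ?_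
      rw [Real.mul_rpow hh0.le (by positivity)]
      refine mul_le_mul_of_nonneg_left ?_ (by positivity)
      refine Real.rpow_le_self_of_le_one (by positivity) (inv_le_one_of_one_le₀ ?_) hp1
      linarith [sq_nonneg (x / (R / 2 ^ r))]
    · refine le_add_of_nonneg_of_le (by positivity) ?_
      refine (Real.rpow_le_rpow (abs_nonneg _) (hout x hx) (by linarith)).trans ?_
      have hx2 : R ^ 2 ≤ x ^ 2 := by rw [← sq_abs x]; gcongr
      have hb : 1 ≤ 8 * x ^ 2 / R ^ 2 := by
        rw [one_le_div (by positivity)]; linarith [sq_nonneg x]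
      have hb1 : 1 ≤ R * m * (8 * x ^ 2 / R ^ 2) ^ (2 * 2 ^ r) :=
        one_le_mul_of_one_le_of_one_le (one_le_mul_of_one_le_of_one_le hR1 hm1) (one_le_pow₀ hb)
      refine (Real.rpow_le_rpow_of_exponent_le hb1 hp2).trans ?_
      have ht := tail_pow_le r x
      have e : 4 * 2 ^ r = 2 * 2 ^ r * 2 := by ring
      rw [e, pow_mul] at ht
      rw [Real.rpow_two, mul_pow, mul_pow, hR2]
      calc 1024 * m * m ^ 2 * ((8 * x ^ 2 / (1024 * m)) ^ (2 * 2 ^ r)) ^ 2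
          ≤ 1024 * m * m ^ 2 * ((m ^ 5)⁻¹ * Real.exp (x ^ 2 / 4)) := by gcongr
        _ = _ := by field_simp
  have hpdf : ∀ x : ℝ, gaussianPDFReal 0 1 x • |max 0 x - P.eval x| ^ p ≤
      h ^ p * (1 + (x / h) ^ 2)⁻¹ + 1024 * (m ^ 2)⁻¹ * Real.exp (-(1 / 4) * x ^ 2) := fun x => by
    rw [smul_eq_mul]
    have h0 : 0 ≤ h ^ p * (1 + (x / h) ^ 2)⁻¹ := by positivity
    calc gaussianPDFReal 0 1 x * |max 0 x - P.eval x| ^ p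
        ≤ Real.exp (-(x ^ 2) / 2) *
          (h ^ p * (1 + (x / h) ^ 2)⁻¹ + 1024 * (m ^ 2)⁻¹ * Real.exp (x ^ 2 / 4)) := by
          gcongr
          · exact gaussianPDFReal_zero_one_le x
          · exact hpt x
      _ = Real.exp (-(x ^ 2) / 2) * (h ^ p * (1 + (x / h) ^ 2)⁻¹) +
          1024 * (m ^ 2)⁻¹ * (Real.exp (-(x ^ 2) / 2) * Real.exp (x ^ 2 / 4)) := by ring
      _ ≤ _ := by
          refine add_le_add ?_ (mul_le_mul_of_nonneg_left ?_ (by positivity))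
          · refine mul_le_of_le_one_left h0 (Real.exp_le_one_iff.2 ?_)
            linarith [sq_nonneg x]
          · rw [← Real.exp_add]
            refine Real.exp_le_exp.2 (le_of_eq ?_)
            ring
  rw [integral_gaussianReal_eq_integral_smul one_ne_zero]
  have i1 := (integrable_inv_one_add_div_sq hh0).const_mul (h ^ p)
  have i2 := (integrable_exp_neg_mul_sq (by norm_num : (0 : ℝ) < 1 / 4)).const_mul
    (1024 * (m ^ 2)⁻¹)
  refine (integral_mono_of_nonneg (.of_forall fun x => ?_) (i1.add i2) (.of_forall hpdf)).trans ?_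
  · exact smul_nonneg (gaussianPDFReal_nonneg _ _ _) (by positivity)
  rw [integral_add' i1 i2, integral_const_mul, integral_const_mul, integral_gaussian,
    integral_inv_one_add_div_sq hh0]
  have s1 : √(Real.pi / (1 / 4)) ≤ 4 := by
    rw [Real.sqrt_le_left (by norm_num)]
    linarith [Real.pi_le_four]
  have s2 : h ^ p * (h * Real.pi) ≤ 32768 * m ^ (-((p + 1) / 2)) * 4 := by
    rw [← mul_assoc]
    refine mul_le_mul ?_ Real.pi_le_four Real.pi_pos.le (by positivity)
    · rw [← Real.rpow_add_one hh0.ne', hheq, Real.mul_rpow (by norm_num) (by positivity),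
        ← Real.rpow_mul hm0.le]
      gcongr
      · calc (32 : ℝ) ^ (p + 1) ≤ 32 ^ (3 : ℝ) := by gcongr <;> linarith
          _ = 32768 := by norm_num
      · linarith
  have s3 : (m ^ 2)⁻¹ ≤ m ^ (-((p + 1) / 2)) := by
    rw [← Real.rpow_two, ← Real.rpow_neg hm0.le]
    exact Real.rpow_le_rpow_of_exponent_le hm1 (by linarith)
  have s4 : 1024 * (m ^ 2)⁻¹ * √(Real.pi / (1 / 4)) ≤ 1024 * m ^ (-((p + 1) / 2)) * 4 := by
    gcongr
  have : 0 < m ^ (-((p + 1) / 2)) := by positivity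
  linarith

open Real in
lemma integral_cos_mul_sin_pow (j : ℕ) : ∀ k : ℕ, j < 2 * k →
    ∫ θ in (-(π / 2))..(π / 2), cos (2 * k * θ) * sin θ ^ j = 0 := by
  induction j using Nat.twoStepInduction with
  | zero =>
    intro k hk
    have hk0 : (2 * k : ℝ) ≠ 0 := by
      have : 0 < k := by omega
      positivity
    simp only [pow_zero, mul_one]
    rw [intervalIntegral.integral_comp_mul_left (fun x => cos x) hk0, integral_cos]
    have e : 2 * (k : ℝ) * (π / 2) = k * π := by ring
    rw [mul_neg, sin_neg, e, sin_nat_mul_pi]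
    simp
  | one =>
    intro k hk
    have := intervalIntegral.integral_comp_neg (a := -(π / 2)) (b := π / 2)
      (fun θ => cos (2 * k * θ) * sin θ ^ 1)
    rw [neg_neg] at this
    simp only [mul_neg, cos_neg, sin_neg, pow_one, intervalIntegral.integral_neg] at this ⊢
    linarith
  | more j ih _ =>
    intro k hk
    obtain ⟨k, rfl⟩ : ∃ k', k = k' + 1 := ⟨k - 1, by omega⟩
    have e : ∀ θ : ℝ, cos (2 * (k + 1 : ℕ) * θ) * sin θ ^ (j + 2) =
        1 / 2 * (cos (2 * (k + 1 : ℕ) * θ) * sin θ ^ j) -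
        1 / 4 * (cos (2 * (k + 2 : ℕ) * θ) * sin θ ^ j) -
        1 / 4 * (cos (2 * k * θ) * sin θ ^ j) := fun θ => by
      have h1 : 2 * ((k + 2 : ℕ) : ℝ) * θ = 2 * (k + 1 : ℕ) * θ + 2 * θ := by push_cast; ring
      have h2 : 2 * (k : ℝ) * θ = 2 * (k + 1 : ℕ) * θ - 2 * θ := by push_cast; ring
      rw [h1, h2, cos_add, cos_sub, pow_add, sin_sq_eq_half_sub]
      ring
    simp only [e]
    have hc : ∀ k : ℕ, ∀ c : ℝ, IntervalIntegrable (fun θ => c * (cos (2 * k * θ) * sin θ ^ j))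
        volume (-(π / 2)) (π / 2) :=
      fun k c => Continuous.intervalIntegrable (by fun_prop) _ _
    rw [intervalIntegral.integral_sub ((hc _ _).sub (hc _ _)) (hc _ _),
      intervalIntegral.integral_sub (hc _ _) (hc _ _)]
    simp only [intervalIntegral.integral_const_mul]
    rw [ih (k + 1) (by omega), ih (k + 2) (by omega), ih k (by omega)]
    ring

open Real in
lemma integral_cos_mul_abs_sin_le (k : ℕ) (hk : 1 ≤ k) :
    ∫ θ in (-(π / 2))..(π / 2), cos (2 * k * θ) * |sin θ| ≤ -(1 / (2 * (k : ℝ) ^ 2)) := by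
  have hk1 : (1 : ℝ) ≤ k := by exact_mod_cast hk
  have hpi := pi_pos
  have hc : Continuous fun θ : ℝ => cos (2 * k * θ) * |sin θ| := by fun_prop
  have hhalf : ∫ θ in (0)..(π / 2), cos (2 * k * θ) * |sin θ| = -(1 / (4 * (k : ℝ) ^ 2 - 1)) := by
    have h1 : ∫ θ in (0)..(π / 2), cos (2 * k * θ) * |sin θ| =
        ∫ θ in (0)..(π / 2), cos (2 * k * θ) * sin θ := by
      refine intervalIntegral.integral_congr fun θ hθ => ?_
      rw [Set.uIcc_of_le (by positivity)] at hθ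
      rw [abs_of_nonneg (sin_nonneg_of_nonneg_of_le_pi hθ.1 (by linarith [hθ.2]))]
    rw [h1, intervalIntegral.integral_eq_sub_of_hasDerivAt (f := fun θ =>
      -(cos ((2 * k + 1) * θ) / (2 * (2 * k + 1))) + cos ((2 * k - 1) * θ) / (2 * (2 * k - 1)))]
    · have e1 : (2 * (k : ℝ) + 1) * (π / 2) = k * π + π / 2 := by ring
      have e2 : (2 * (k : ℝ) - 1) * (π / 2) = k * π - π / 2 := by ring
      simp only [e1, e2, cos_add_pi_div_two, cos_sub_pi_div_two, sin_nat_mul_pi, mul_zero, cos_zero]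
      have : 2 * (k : ℝ) - 1 ≠ 0 := by linarith
      have h3 : 4 * (k : ℝ) ^ 2 - 1 = (2 * k - 1) * (2 * k + 1) := by ring
      rw [h3]
      field_simp
      ring
    · intro θ _
      have d1 : HasDerivAt (fun θ : ℝ => cos ((2 * k + 1) * θ))
          (-sin ((2 * k + 1) * θ) * (2 * k + 1)) θ := by
        simpa using ((hasDerivAt_id θ).const_mul (2 * (k : ℝ) + 1)).cos
      have d2 : HasDerivAt (fun θ : ℝ => cos ((2 * k - 1) * θ))
          (-sin ((2 * k - 1) * θ) * (2 * k - 1)) θ := by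
        simpa using ((hasDerivAt_id θ).const_mul (2 * (k : ℝ) - 1)).cos
      refine ((d1.div_const _).fun_neg.add (d2.div_const _)).congr_deriv ?_
      have h1 : (2 * (k : ℝ) + 1) * θ = 2 * k * θ + θ := by ring
      have h2 : (2 * (k : ℝ) - 1) * θ = 2 * k * θ - θ := by ring
      have : 2 * (k : ℝ) - 1 ≠ 0 := by linarith
      rw [h1, h2, sin_add, sin_sub]
      field_simp
      ring
    · exact Continuous.intervalIntegrable (by fun_prop) _ _
  have hneg : ∫ θ in (-(π / 2))..(0), cos (2 * k * θ) * |sin θ| =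
      ∫ θ in (0)..(π / 2), cos (2 * k * θ) * |sin θ| := by
    have := intervalIntegral.integral_comp_neg (a := 0) (b := π / 2)
      (fun θ => cos (2 * k * θ) * |sin θ|)
    simp only [mul_neg, cos_neg, sin_neg, abs_neg, neg_zero] at this
    exact this.symm
  rw [← intervalIntegral.integral_add_adjacent_intervals (b := 0)
    (hc.intervalIntegrable _ _) (hc.intervalIntegrable _ _), hneg, hhalf]
  have : 1 / (2 * (k : ℝ) ^ 2) ≤ 2 * (1 / (4 * (k : ℝ) ^ 2 - 1)) := by
    rw [mul_one_div, div_le_div_iff₀ (by positivity) (by nlinarith)]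
    nlinarith
  linarith

/-- `W` behaves like a cosine polynomial with frequencies in `[-2 b, 2 b]` and nonnegative
coefficients: modulated to frequencies in `[2 a, 2 B]`, it annihilates polynomials in `sin θ` of
degree below `2 a`, and pairs with `-|sin θ|` to at least `W(0) / (2 B²)`. -/
def IsPosCosPoly (a B b : ℕ) (W : ℝ → ℝ) : Prop :=
  Continuous W ∧ ∀ M : ℕ, a + b ≤ M → M + b ≤ B →
    (∀ j < 2 * a, ∫ θ in (-(Real.pi / 2))..(Real.pi / 2),
      W θ * Real.cos (2 * M * θ) * Real.sin θ ^ j = 0) ∧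
    ∫ θ in (-(Real.pi / 2))..(Real.pi / 2), W θ * Real.cos (2 * M * θ) * |Real.sin θ| ≤
      -(W 0 / (2 * (B : ℝ) ^ 2))

lemma isPosCosPoly_one {a : ℕ} (ha : 1 ≤ a) (B : ℕ) : IsPosCosPoly a B 0 fun _ => 1 := by
  refine ⟨continuous_const, fun M h1 h2 => ⟨fun j hj => ?_, ?_⟩⟩
  · simpa using integral_cos_mul_sin_pow j M (by omega)
  · simp only [one_mul]
    refine (integral_cos_mul_abs_sin_le M (by omega)).trans ?_
    have : (M : ℝ) ≤ B := by exact_mod_cast h2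
    have : (0 : ℝ) < M := by exact_mod_cast (by omega : 0 < M)
    gcongr

open Real in
lemma IsPosCosPoly.mul_cos_sq {a B b : ℕ} {W : ℝ → ℝ} (hW : IsPosCosPoly a B b W) (j : ℕ) :
    IsPosCosPoly a B (b + j) fun θ => W θ * cos (j * θ) ^ 2 := by
  obtain ⟨hc, hW⟩ := hW
  refine ⟨by fun_prop, fun M h1 h2 => ?_⟩
  obtain ⟨N, rfl⟩ : ∃ N, M = N + j := ⟨M - j, by omega⟩
  obtain ⟨p1, q1⟩ := hW N (by omega) (by omega)
  obtain ⟨p2, q2⟩ := hW (N + j) (by omega) (by omega)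
  obtain ⟨p3, q3⟩ := hW (N + j + j) (by omega) (by omega)
  have key : ∀ g : ℝ → ℝ, Continuous g → ∫ θ in (-(π / 2))..(π / 2),
      W θ * cos (j * θ) ^ 2 * cos (2 * (N + j : ℕ) * θ) * g θ =
      1 / 4 * (∫ θ in (-(π / 2))..(π / 2), W θ * cos (2 * N * θ) * g θ) +
      1 / 2 * (∫ θ in (-(π / 2))..(π / 2), W θ * cos (2 * (N + j : ℕ) * θ) * g θ) +
      1 / 4 * (∫ θ in (-(π / 2))..(π / 2), W θ * cos (2 * (N + j + j : ℕ) * θ) * g θ) := by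
    intro g hg
    have hi : ∀ k : ℕ, ∀ c : ℝ, IntervalIntegrable (fun θ => c * (W θ * cos (2 * k * θ) * g θ))
        volume (-(π / 2)) (π / 2) :=
      fun k c => Continuous.intervalIntegrable (by fun_prop) _ _
    simp only [← intervalIntegral.integral_const_mul]
    rw [← intervalIntegral.integral_add (hi _ _) (hi _ _),
      ← intervalIntegral.integral_add ((hi _ _).add (hi _ _)) (hi _ _)]
    refine intervalIntegral.integral_congr fun θ _ => ?_
    have e1 : 2 * (N : ℝ) * θ = 2 * (N + j : ℕ) * θ - 2 * (j * θ) := by push_cast; ring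
    have e2 : 2 * ((N + j + j : ℕ) : ℝ) * θ = 2 * (N + j : ℕ) * θ + 2 * (j * θ) := by
      push_cast; ring
    rw [e1, e2, cos_add, cos_sub, cos_sq (j * θ)]
    ring
  refine ⟨fun i hi => ?_, ?_⟩
  · rw [key (fun θ => sin θ ^ i) (by fun_prop), p1 i hi, p2 i hi, p3 i hi]
    ring
  · rw [key (fun θ => |sin θ|) (by fun_prop)]
    simp only [mul_zero, cos_zero, one_pow, mul_one]
    linarith

open Real in
lemma isPosCosPoly_cos_pow {a : ℕ} (ha : 1 ≤ a) (B L : ℕ) :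
    IsPosCosPoly a B L fun θ => (cos θ ^ 2) ^ L := by
  induction L with
  | zero => simpa using isPosCosPoly_one ha B
  | succ L ih => simpa [pow_succ _ L] using ih.mul_cos_sq 1

open Real in
lemma isPosCosPoly_cos_pow_mul_prod {a : ℕ} (ha : 1 ≤ a) (B L r : ℕ) :
    IsPosCosPoly a B (L + (2 ^ r - 1))
      fun θ => (cos θ ^ 2) ^ L * ∏ i ∈ Finset.range r, cos (2 ^ i * θ) ^ 2 := by
  induction r with
  | zero => simpa using isPosCosPoly_cos_pow ha B L
  | succ r ih =>
    have e : L + (2 ^ (r + 1) - 1) = L + (2 ^ r - 1) + 2 ^ r := by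
      have := Nat.one_le_two_pow (n := r)
      rw [pow_succ]; omega
    rw [e]
    simpa [Finset.prod_range_succ, mul_assoc] using ih.mul_cos_sq (2 ^ r)

lemma four_pow_mul_sin_sq_mul_prod (r : ℕ) (θ : ℝ) :
    4 ^ r * Real.sin θ ^ 2 * ∏ i ∈ Finset.range r, Real.cos (2 ^ i * θ) ^ 2 =
      Real.sin (2 ^ r * θ) ^ 2 := by
  induction r with
  | zero => simp
  | succ r ih =>
    have e : (2 : ℝ) ^ (r + 1) * θ = 2 * (2 ^ r * θ) := by ring
    rw [Finset.prod_range_succ, e, Real.sin_two_mul, mul_pow, mul_pow, ← ih]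
    ring

lemma integrable_eval_gaussianReal (P : ℝ[X]) :
    Integrable (fun x => P.eval x) (gaussianReal 0 1) := by
  simp only [eval_eq_sum_range]
  refine integrable_finsetSum _ fun i _ => Integrable.const_mul ?_ _
  rcases i.eq_zero_or_pos with rfl | hi
  · simp
  · exact ((memLp_id_gaussianReal' (μ := 0) (v := 1) i (by simp)).integrable_norm_pow
      hi.ne').mono (by fun_prop) (by simp)

lemma integrable_reLU_sub_rpow {p : ℝ} (hp1 : 0 ≤ p) (hp2 : p ≤ 2) (P : ℝ[X]) :
    Integrable (fun x => |max 0 x - P.eval x| ^ p) (gaussianReal 0 1) := by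
  refine (integrable_eval_gaussianReal (1 + 2 * X ^ 2 + 2 * P ^ 2)).mono' ?_
    (.of_forall fun x => ?_)
  · have : Continuous fun x : ℝ => |max 0 x - P.eval x| ^ p :=
      Continuous.rpow_const (by fun_prop) fun _ => Or.inr hp1
    exact this.aestronglyMeasurable
  · rw [Real.norm_of_nonneg (by positivity)]
    have h1 : |max 0 x - P.eval x| ^ p ≤ 1 + |max 0 x - P.eval x| ^ 2 := by
      rcases le_total |max 0 x - P.eval x| 1 with h | h
      · linarith [Real.rpow_le_one (abs_nonneg _) h hp1, sq_nonneg |max 0 x - P.eval x|]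
      · have := Real.rpow_le_rpow_of_exponent_le h hp2
        rw [Real.rpow_two] at this
        linarith
    have h2 : max 0 x ^ 2 ≤ x ^ 2 := by
      rcases le_total 0 x with h | h <;> simp [h, sq_nonneg]
    simp only [eval_add, eval_mul, eval_pow, eval_X, eval_one, eval_ofNat]
    rw [sq_abs] at h1
    nlinarith [sq_nonneg (max 0 x + P.eval x)]

open Real in
/-- The dual certificate: `∫ W(θ) cos(2 M θ) (ReLU - P)(R sin θ) dθ` is bounded away from zero. -/
lemma IsPosCosPoly.le_integral {a B b M : ℕ} {W : ℝ → ℝ} (hW : IsPosCosPoly a B b W)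
    (ha : 1 ≤ a) (h1 : a + b ≤ M) (h2 : M + b ≤ B) {R : ℝ} (hR : 0 ≤ R) (P : ℝ[X])
    (hP : P.natDegree < 2 * a) :
    R * W 0 / (4 * (B : ℝ) ^ 2) ≤ ∫ θ in (-(π / 2))..(π / 2),
      |W θ * cos (2 * M * θ)| * |max 0 (R * sin θ) - P.eval (R * sin θ)| := by
  obtain ⟨hc, hW⟩ := hW
  obtain ⟨hann, hpair⟩ := hW M h1 h2
  set T : ℝ → ℝ := fun θ => W θ * cos (2 * M * θ) with hT
  have hTc : Continuous T := by fun_prop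
  set Q : ℝ[X] := C (1 / 2) * X - P with hQ
  have hQdeg : Q.natDegree < 2 * a := by
    refine (natDegree_sub_le _ _).trans_lt (max_lt ?_ hP)
    exact ((natDegree_C_mul_le _ _).trans natDegree_X.le).trans_lt (by omega)
  have hQ0 : ∫ θ in (-(π / 2))..(π / 2), T θ * Q.eval (R * sin θ) = 0 := by
    simp only [eval_eq_sum_range, Finset.mul_sum]
    rw [intervalIntegral.integral_finsetSum
      (fun i _ => Continuous.intervalIntegrable (by fun_prop) _ _)]
    refine Finset.sum_eq_zero fun i hi => ?_
    have e : ∀ θ : ℝ, T θ * (Q.coeff i * (R * sin θ) ^ i) =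
        Q.coeff i * R ^ i * (T θ * sin θ ^ i) := fun θ => by ring
    simp only [e, intervalIntegral.integral_const_mul]
    rw [hann i (by simp at hi; omega), mul_zero]
  have hsplit : ∀ θ : ℝ, T θ * (max 0 (R * sin θ) - P.eval (R * sin θ)) =
      R / 2 * (T θ * |sin θ|) + T θ * Q.eval (R * sin θ) := fun θ => by
    have : max 0 (R * sin θ) = R / 2 * |sin θ| + 1 / 2 * (R * sin θ) := by
      rcases le_total 0 (sin θ) with h | h
      · rw [max_eq_right (by positivity), abs_of_nonneg h]; ring
      · rw [max_eq_left (mul_nonpos_of_nonneg_of_nonpos hR h), abs_of_nonpos h]; ring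
    rw [this, hQ]
    simp only [eval_sub, eval_mul, eval_C, eval_X]
    ring
  have hval : ∫ θ in (-(π / 2))..(π / 2), T θ * (max 0 (R * sin θ) - P.eval (R * sin θ)) ≤
      -(R * W 0 / (4 * (B : ℝ) ^ 2)) := by
    simp only [hsplit]
    rw [intervalIntegral.integral_add (Continuous.intervalIntegrable (by fun_prop) _ _)
      (Continuous.intervalIntegrable (by fun_prop) _ _), hQ0, add_zero,
      intervalIntegral.integral_const_mul]
    refine (mul_le_mul_of_nonneg_left hpair (by positivity)).trans (le_of_eq ?_)
    ring
  have habs := intervalIntegral.abs_integral_le_integral_abs (μ := volume)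
    (f := fun θ => T θ * (max 0 (R * sin θ) - P.eval (R * sin θ)))
    (by linarith [pi_pos] : -(π / 2) ≤ π / 2)
  simp only [abs_mul (T _)] at habs
  refine le_trans ?_ habs
  rw [le_abs']
  exact Or.inl hval

open Real in
lemma cos_sq_pow_mul_prod_le (r : ℕ) (hr : 1 ≤ r) {θ : ℝ} (hθ : θ ∈ Set.Icc (-(π / 2)) (π / 2)) :
    (cos θ ^ 2) ^ 2 ^ r * ∏ i ∈ Finset.range r, cos (2 ^ i * θ) ^ 2 ≤
      2 * exp (-(2 ^ r * sin θ ^ 2) / 2) * (1 + (2 ^ r * sin θ) ^ 2)⁻¹ * cos θ := by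
  have hc0 : 0 ≤ cos θ := cos_nonneg_of_mem_Icc hθ
  have hc1 := cos_le_one θ
  have hprod0 : 0 ≤ ∏ i ∈ Finset.range r, cos (2 ^ i * θ) ^ 2 :=
    Finset.prod_nonneg fun i _ => sq_nonneg _
  have hprod1 : ∏ i ∈ Finset.range r, cos (2 ^ i * θ) ^ 2 ≤ 1 :=
    Finset.prod_le_one (fun i _ => sq_nonneg _) fun i _ => cos_sq_le_one _
  have hsin := four_pow_mul_sin_sq_mul_prod r θ
  have h4 : (4 : ℝ) ^ r = (2 ^ r) ^ 2 := by rw [← pow_mul, mul_comm, pow_mul]; norm_num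
  have hprod : ∏ i ∈ Finset.range r, cos (2 ^ i * θ) ^ 2 ≤ 2 * (1 + (2 ^ r * sin θ) ^ 2)⁻¹ := by
    rw [← div_eq_mul_inv, le_div_iff₀ (by positivity)]
    rw [h4] at hsin
    have := sin_sq_le_one (2 ^ r * θ)
    rw [mul_pow]
    nlinarith
  have hcos : (cos θ ^ 2) ^ 2 ^ r ≤ cos θ * exp (-(2 ^ r * sin θ ^ 2) / 2) := by
    obtain ⟨n, hn⟩ : ∃ n, 2 ^ r = n + 1 := ⟨2 ^ r - 1, by have := Nat.one_le_two_pow (n := r); omega⟩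
    have hn2 : 1 ≤ n := by
      have : 2 ^ 1 ≤ 2 ^ r := Nat.pow_le_pow_right (by norm_num) hr
      omega
    have hn' : (2 : ℝ) ^ r = n + 1 := by exact_mod_cast hn
    have hn2' : (1 : ℝ) ≤ n := by exact_mod_cast hn2
    have e1 : cos θ ^ 2 ≤ exp (-sin θ ^ 2) := by
      have := add_one_le_exp (-sin θ ^ 2)
      have := sin_sq_add_cos_sq θ
      linarith
    rw [hn, hn', pow_succ]
    calc (cos θ ^ 2) ^ n * cos θ ^ 2 ≤ exp (-sin θ ^ 2) ^ n * cos θ := by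
          gcongr
          exact pow_le_of_le_one hc0 hc1 two_ne_zero
      _ = cos θ * exp (n * -sin θ ^ 2) := by rw [exp_nat_mul, mul_comm]
      _ ≤ _ := by
          gcongr
          nlinarith [sq_nonneg (sin θ)]
  calc (cos θ ^ 2) ^ 2 ^ r * ∏ i ∈ Finset.range r, cos (2 ^ i * θ) ^ 2
      ≤ cos θ * exp (-(2 ^ r * sin θ ^ 2) / 2) * (2 * (1 + (2 ^ r * sin θ) ^ 2)⁻¹) := by gcongr
    _ = _ := by ring

lemma le_add_mul_rpow {p lam a : ℝ} (hp : 1 ≤ p) (hl : 0 < lam) (ha : 0 ≤ a) :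
    a ≤ lam + lam ^ (1 - p) * a ^ p := by
  rcases le_total a lam with h | h
  · exact le_add_of_le_of_nonneg h (by positivity)
  · refine le_add_of_nonneg_of_le hl.le ?_
    have ha0 : 0 < a := hl.trans_le h
    calc a = a ^ (1 - p) * a ^ p := by rw [← Real.rpow_add ha0]; simp
      _ ≤ lam ^ (1 - p) * a ^ p := by
        gcongr ?_ * _
        exact Real.rpow_le_rpow_of_nonpos hl h (by linarith)

/-- Every polynomial of degree `< 2 m`, `m = 2ʳ`, has `‖ReLU - P‖_p^p ≥ c m^(-(p+1)/2)`. -/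
lemma le_integral_reLU_sub {p : ℝ} (hp1 : 1 ≤ p) (hp2 : p ≤ 2) {r : ℕ} (hr : 1 ≤ r) (P : ℝ[X])
    (hP : P.natDegree < 2 * 2 ^ r) :
    1 / 2400000 * ((2 : ℝ) ^ r) ^ (-((p + 1) / 2)) ≤
      ∫ x, |max 0 x - P.eval x| ^ p ∂(gaussianReal 0 1) := by
  have hn1 : 1 ≤ 2 ^ r := Nat.one_le_two_pow
  set m : ℝ := 2 ^ r with hm
  have hm1 : 1 ≤ m := one_le_pow₀ (by norm_num)
  have hm0 : 0 < m := by positivity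
  set R : ℝ := √m with hRdef
  have hR2 : R ^ 2 = m := Real.sq_sqrt hm0.le
  have hR : 0 < R := Real.sqrt_pos.2 hm0
  set h : ℝ := R⁻¹ with hh
  have hh0 : 0 < h := by positivity
  have hh2 : h ^ 2 = 1 / m := by rw [hh, inv_pow, hR2, one_div]
  have hheq : h = m ^ (-(1 / 2) : ℝ) := by
    rw [hh, hRdef, Real.rpow_neg hm0.le, ← Real.sqrt_eq_rpow]
  set F : ℝ → ℝ := fun x => |max 0 x - P.eval x| with hF
  have hFc : Continuous F := by fun_prop
  have hF0 : ∀ x, 0 ≤ F x := fun x => abs_nonneg _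
  set I := ∫ x, F x ^ p ∂(gaussianReal 0 1) with hI
  set w : ℝ → ℝ := fun x => Real.exp (-(x ^ 2) / 2) with hw
  set κ : ℝ → ℝ := fun x => (1 + (x / h) ^ 2)⁻¹ with hκ
  have hκ0 : ∀ x, 0 ≤ κ x := fun x => by positivity
  have hκ1 : ∀ x, κ x ≤ 1 := fun x => inv_le_one_of_one_le₀ (by linarith [sq_nonneg (x / h)])
  have hκc : Continuous κ :=
    Continuous.inv₀ (by fun_prop) fun x => by positivity
  have hw1 : ∀ x, w x ≤ 1 := fun x => Real.exp_le_one_iff.2 (by linarith [sq_nonneg x])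
  set ψ : ℝ → ℝ := fun x => 2 * w x * κ x * F x with hψ
  have hψc : Continuous ψ := by fun_prop
  -- the lower bound from duality
  have hlow : 1 / (100 * m) ≤ ∫ x in (-R)..R, ψ x := by
    have hW := isPosCosPoly_cos_pow_mul_prod hn1 (5 * 2 ^ r) (2 ^ r) r
    have h1 := hW.le_integral (M := 3 * 2 ^ r) hn1 (by omega) (by omega) hR.le P hP
    have hcov : ∫ θ in (-(Real.pi / 2))..(Real.pi / 2), ψ (R * Real.sin θ) * (R * Real.cos θ) =
        ∫ x in (-R)..R, ψ x := by
      have := intervalIntegral.integral_comp_mul_deriv (a := -(Real.pi / 2)) (b := Real.pi / 2)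
        (f := fun θ => R * Real.sin θ) (f' := fun θ => R * Real.cos θ) (g := ψ)
        (fun θ _ => (Real.hasDerivAt_sin θ).const_mul R) (by fun_prop) hψc
      simpa using this
    have h2 : ∫ θ in (-(Real.pi / 2))..(Real.pi / 2),
        |(Real.cos θ ^ 2) ^ 2 ^ r * (∏ i ∈ Finset.range r, Real.cos (2 ^ i * θ) ^ 2) *
          Real.cos (2 * (3 * 2 ^ r : ℕ) * θ)| *
          |max 0 (R * Real.sin θ) - P.eval (R * Real.sin θ)| ≤
        ∫ θ in (-(Real.pi / 2))..(Real.pi / 2), ψ (R * Real.sin θ) * Real.cos θ := by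
      refine intervalIntegral.integral_mono_on (by linarith [Real.pi_pos])
        (Continuous.intervalIntegrable (by fun_prop) _ _)
        (Continuous.intervalIntegrable (by fun_prop) _ _) fun θ hθ => ?_
      have hprod0 : 0 ≤ ∏ i ∈ Finset.range r, Real.cos (2 ^ i * θ) ^ 2 :=
        Finset.prod_nonneg fun i _ => sq_nonneg _
      have e1 : (R * Real.sin θ) ^ 2 = m * Real.sin θ ^ 2 := by rw [mul_pow, hR2]
      have e2 : R * Real.sin θ / h = m * Real.sin θ := by
        rw [hh, div_inv_eq_mul, ← hR2]; ring
      rw [abs_mul, abs_of_nonneg (by positivity)]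
      simp only [hψ, hw, hκ, e1, e2]
      calc (Real.cos θ ^ 2) ^ 2 ^ r * (∏ i ∈ Finset.range r, Real.cos (2 ^ i * θ) ^ 2) *
          |Real.cos (2 * (3 * 2 ^ r : ℕ) * θ)| * F (R * Real.sin θ)
          ≤ (Real.cos θ ^ 2) ^ 2 ^ r * (∏ i ∈ Finset.range r, Real.cos (2 ^ i * θ) ^ 2) *
            1 * F (R * Real.sin θ) := by
            gcongr
            exact Real.abs_cos_le_one _
        _ ≤ 2 * Real.exp (-(2 ^ r * Real.sin θ ^ 2) / 2) * (1 + (2 ^ r * Real.sin θ) ^ 2)⁻¹ *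
            Real.cos θ * F (R * Real.sin θ) := by
            rw [mul_one]
            exact mul_le_mul_of_nonneg_right (cos_sq_pow_mul_prod_le r hr hθ) (hF0 _)
        _ = _ := by ring
    have h3 := mul_le_mul_of_nonneg_left (h1.trans h2) hR.le
    rw [← intervalIntegral.integral_const_mul] at h3
    rw [← hcov]
    calc 1 / (100 * m)
        = R * (R * ((Real.cos 0 ^ 2) ^ 2 ^ r * ∏ i ∈ Finset.range r, Real.cos (2 ^ i * 0) ^ 2) /
            (4 * ((5 * 2 ^ r : ℕ) : ℝ) ^ 2)) := by
          simp only [mul_zero, Real.cos_zero, one_pow, Finset.prod_const_one, mul_one]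
          push_cast
          rw [← hm, mul_div_assoc', ← sq, hR2]
          field_simp
          norm_num
      _ ≤ _ := by simpa only [mul_zero] using h3
      _ = _ := intervalIntegral.integral_congr fun θ _ => by ring
  set lam : ℝ := h / 2000 with hlam
  have hlam0 : 0 < lam := by positivity
  -- the upper bound by the Young inequality
  have hGint : Integrable fun x => F x ^ p * w x := by
    have := integrable_reLU_sub_rpow (by linarith : 0 ≤ p) hp2 P
    rw [gaussianReal_of_var_ne_zero _ one_ne_zero, integrable_withDensity_iff_integrable_smul₀'
      (by fun_prop) (.of_forall fun x => gaussianPDF_lt_top)] at this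
    refine (this.const_mul (√(2 * Real.pi))).congr (.of_forall fun x => ?_)
    have : √(2 * Real.pi) ≠ 0 := by positivity
    simp only [toReal_gaussianPDF, gaussianPDFReal_zero_one, smul_eq_mul, hF, hw]
    field_simp
  have hGval : ∫ x, F x ^ p * w x = √(2 * Real.pi) * I := by
    rw [hI, integral_gaussianReal_eq_integral_smul one_ne_zero, ← integral_const_mul]
    refine integral_congr_ae (.of_forall fun x => ?_)
    have : √(2 * Real.pi) ≠ 0 := by positivity
    simp only [gaussianPDFReal_zero_one, smul_eq_mul, hw]
    field_simp
  have hκint : Integrable κ := integrable_inv_one_add_div_sq hh0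
  have hpt : ∀ x, ψ x ≤ 2 * lam * κ x + 2 * lam ^ (1 - p) * (F x ^ p * w x) := fun x => by
    have h1 := le_add_mul_rpow hp1 hlam0 (hF0 x)
    have hw0 : 0 ≤ w x := (Real.exp_pos _).le
    calc ψ x ≤ 2 * w x * κ x * (lam + lam ^ (1 - p) * F x ^ p) := by
          have := hκ0 x
          simp only [hψ]
          gcongr
      _ = w x * (2 * lam * κ x) + κ x * (2 * lam ^ (1 - p) * (F x ^ p * w x)) := by ring
      _ ≤ _ := by
          have := hκ0 x
          have := hF0 x
          exact add_le_add (mul_le_of_le_one_left (by positivity) (hw1 x))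
            (mul_le_of_le_one_left (by positivity) (hκ1 x))
  have hsum := (hκint.const_mul (2 * lam)).add (hGint.const_mul (2 * lam ^ (1 - p)))
  have hup : ∫ x in (-R)..R, ψ x ≤
      2 * lam * (h * Real.pi) + 2 * lam ^ (1 - p) * (√(2 * Real.pi) * I) := by
    rw [← integral_inv_one_add_div_sq hh0, ← hGval, ← integral_const_mul, ← integral_const_mul,
      ← integral_add (hκint.const_mul (2 * lam)) (hGint.const_mul (2 * lam ^ (1 - p)))]
    rw [intervalIntegral.integral_of_le (by linarith)]
    refine (setIntegral_mono (hψc.integrableOn_Ioc) hsum.integrableOn hpt).trans ?_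
    refine setIntegral_le_integral hsum (.of_forall fun x => ?_)
    have hw0 : 0 ≤ w x := (Real.exp_pos _).le
    have := hκ0 x
    have := hF0 x
    simp only [Pi.zero_apply, Pi.add_apply]
    positivity
  have hI0 : 0 ≤ I := integral_nonneg fun x => Real.rpow_nonneg (hF0 x) _
  have hsq : √(2 * Real.pi) ≤ 3 := by
    rw [Real.sqrt_le_left (by norm_num)]
    linarith [Real.pi_le_four]
  have hlamp : lam ^ (1 - p) ≤ 2000 * h ^ (1 - p) := by
    rw [hlam, Real.div_rpow hh0.le (by norm_num), div_eq_mul_inv, ← Real.rpow_neg (by norm_num),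
      mul_comm]
    gcongr
    calc (2000 : ℝ) ^ (-(1 - p)) ≤ 2000 ^ (1 : ℝ) := by gcongr <;> linarith
      _ = 2000 := by norm_num
  have hmain : 1 / 200 * h ^ 2 ≤ 12000 * (h ^ (1 - p) * I) := by
    have e1 : 2 * lam * (h * Real.pi) ≤ 4 / 1000 * h ^ 2 := by
      rw [hlam]
      have := mul_le_mul_of_nonneg_left Real.pi_le_four (sq_nonneg h)
      linarith
    have e2 : 2 * lam ^ (1 - p) * (√(2 * Real.pi) * I) ≤
        2 * (2000 * h ^ (1 - p)) * (3 * I) := by gcongr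
    have e3 : 1 / (100 * m) = 1 / 100 * h ^ 2 := by rw [hh2]; field_simp
    rw [e3] at hlow
    nlinarith [hlow.trans hup, sq_nonneg h]
  have hfin : h ^ (p + 1) = h ^ 2 * h ^ (p - 1) := by
    rw [← Real.rpow_two, ← Real.rpow_add hh0]
    congr 1
    ring
  have hone : h ^ (p - 1) * h ^ (1 - p) = 1 := by
    rw [← Real.rpow_add hh0]
    simp
  have hmh : m ^ (-((p + 1) / 2)) = h ^ (p + 1) := by
    rw [hheq, ← Real.rpow_mul hm0.le]
    congr 1
    ring
  rw [hmh, hfin]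
  have h5 := mul_le_mul_of_nonneg_left hmain (Real.rpow_nonneg hh0.le (p - 1))
  have h6 : h ^ (p - 1) * (12000 * (h ^ (1 - p) * I)) = 12000 * I := by
    linear_combination (12000 * I) * hone
  rw [h6] at h5
  linarith

end ReLUApprox

open ReLUApprox

/-- `L^p(γ₁)` polynomial approximation of ReLU, `p ∈ [1,2]`: there are constants
`c, C, ε₀ > 0` (depending only on `p`) such that for all `ε ∈ (0, ε₀)`:
(i) every polynomial `P` with `‖ReLU − P‖_p ≤ ε` has degree at least `c ε^{−2p/(p+1)}`;
(ii) some polynomial `P` of degree at most `C ε^{−2p/(p+1)}` has `‖ReLU − P‖_p ≤ ε`. -/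
theorem stmt_14 (p : ℝ) (hp1 : 1 ≤ p) (hp2 : p ≤ 2) :
    ∃ c > (0:ℝ), ∃ C > (0:ℝ), ∃ ε₀ > (0:ℝ), ∀ ε : ℝ, 0 < ε → ε < ε₀ →
      (∀ P : Polynomial ℝ,
        (∫ x, |max 0 x - P.eval x| ^ p ∂(gaussianReal 0 1)) ^ (1 / p) ≤ ε →
        c * ε ^ (-(2 * p / (p + 1))) ≤ (P.natDegree : ℝ)) ∧
      (∃ P : Polynomial ℝ,
        (P.natDegree : ℝ) ≤ C * ε ^ (-(2 * p / (p + 1))) ∧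
        (∫ x, |max 0 x - P.eval x| ^ p ∂(gaussianReal 0 1)) ^ (1 / p) ≤ ε) := by
  have hp0 : 0 < p := by linarith
  set q : ℝ := (p + 1) / 2 with hq
  have hq0 : 0 < q := by positivity
  have hα : 2 * p / (p + 1) = p / q := by rw [hq]; field_simp
  rw [hα]
  set A : ℝ := (1 / 2400000 : ℝ) ^ q⁻¹ with hA
  have hA0 : 0 < A := by positivity
  have hA1 : A ≤ 1 := Real.rpow_le_one (by norm_num) (by norm_num) (by positivity)
  set D : ℝ := (140000 : ℝ) ^ q⁻¹ with hD
  have hD1 : 1 ≤ D := Real.one_le_rpow (by norm_num) (by positivity)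
  have hle : ∀ {ε J : ℝ}, 0 < ε → 0 ≤ J → (J ^ (1 / p) ≤ ε ↔ J ≤ ε ^ p) := fun hε hJ => by
    rw [one_div]
    exact Real.rpow_inv_le_iff_of_pos hJ hε.le hp0
  have hnn : ∀ P : Polynomial ℝ, 0 ≤ ∫ x, |max 0 x - P.eval x| ^ p ∂(gaussianReal 0 1) :=
    fun P => integral_nonneg fun x => by positivity
  refine ⟨A / 4, by positivity, 8 * D, by positivity, (A / 4) ^ (q / p), by positivity,
    fun ε hε hε0 => ?_⟩
  have hX : 4 / A ≤ ε ^ (-(p / q)) := by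
    have h1 : ε ^ (p / q) ≤ A / 4 := by
      calc ε ^ (p / q) ≤ ((A / 4) ^ (q / p)) ^ (p / q) := by gcongr
        _ = A / 4 := by
          rw [← Real.rpow_mul (by positivity), div_mul_div_cancel₀ hp0.ne', div_self hq0.ne',
            Real.rpow_one]
    rw [Real.rpow_neg hε.le, ← inv_div]
    gcongr
  set Y := ε ^ (-(p / q)) with hY
  have hY0 : 0 < Y := by positivity
  have hY1 : 1 ≤ Y := le_trans (by rw [one_le_div hA0]; linarith) hX
  have hYq : Y ^ q = (ε ^ p)⁻¹ := by
    rw [hY, ← Real.rpow_mul hε.le, ← Real.rpow_neg hε.le]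
    congr 1
    field_simp
  constructor
  · intro P hP
    rw [hle hε (hnn P)] at hP
    set r := Nat.log 2 (P.natDegree + 1) + 1 with hr
    have hlt : P.natDegree + 1 < 2 ^ r := Nat.lt_pow_succ_log_self (by norm_num) _
    have hge : 2 ^ r ≤ 2 * (P.natDegree + 1) := by
      rw [hr, pow_succ]
      have := Nat.pow_log_le_self 2 (x := P.natDegree + 1) (by omega)
      omega
    have hlow := (le_integral_reLU_sub hp1 hp2 (r := r) (by omega) P (by omega)).trans hP
    set m : ℝ := 2 ^ r with hm
    have hm0 : 0 < m := by positivity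
    have hm2 : m ≤ 2 * (P.natDegree + 1) := by rw [hm]; exact_mod_cast hge
    have h1 : A * Y ≤ m := by
      rw [← Real.rpow_le_rpow_iff (by positivity) hm0.le hq0, Real.mul_rpow hA0.le hY0.le, hYq, hA,
        Real.rpow_inv_rpow (by norm_num) hq0.ne', ← div_eq_mul_inv, div_le_iff₀ (by positivity)]
      rw [Real.rpow_neg hm0.le, ← div_eq_mul_inv, div_le_iff₀ (by positivity)] at hlow
      linarith
    have h2 : 4 ≤ A * Y := by
      rw [div_le_iff₀ hA0] at hX
      linarith
    linarith
  · obtain ⟨n, hn1, hn2⟩ := exists_nat_pow_near (one_le_mul_of_one_le_of_one_le hD1 hY1)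
      (one_lt_two : (1 : ℝ) < 2)
    obtain ⟨P, hdeg, hint⟩ := exists_reLU_approx_integral hp1 hp2 (n + 1)
    refine ⟨P, ?_, ?_⟩
    · have : (P.natDegree : ℝ) ≤ 4 * 2 ^ (n + 1) := by exact_mod_cast hdeg
      rw [pow_succ] at this
      linarith
    · rw [hle hε (hnn P)]
      refine hint.trans ?_
      set m : ℝ := 2 ^ (n + 1) with hm
      have hm0 : 0 < m := by positivity
      have h1 : (D * Y) ^ q ≤ m ^ q := by gcongr
      rw [Real.mul_rpow (by positivity) hY0.le, hYq, hD,
        Real.rpow_inv_rpow (by norm_num) hq0.ne', ← div_eq_mul_inv,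
        div_le_iff₀ (by positivity)] at h1
      rw [Real.rpow_neg hm0.le, ← div_eq_mul_inv, div_le_iff₀ (by positivity)]
      linarith
end

section
/- Let f : ℝ → ℝ be the standard sigmoid function f(t) = 1/(1 + e^{−t}). There exist constants c > 0, C > 0, and ε₀ > 0 such that for all ε ∈ (0, ε₀): (i) every polynomial p : ℝ → ℝ satisfying ‖f − p‖₂ < ε (L²-norm with respect to γ₁) has degree at least c · log²(1/ε); and (ii) there exists a polynomial p of degree at most C · log²(1/ε) satisfying ‖f − p‖₂ < ε. -/
open MeasureTheory ProbabilityTheory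

lemma integrable_eval_gaussianReal (p : Polynomial ℝ) :
    Integrable (fun x => p.eval x) (gaussianReal 0 1) := by
  simp only [Polynomial.eval_eq_sum_range]
  refine integrable_finsetSum _ fun i _ => Integrable.const_mul ?_ _
  exact (memLp_id_gaussianReal (μ := 0) (v := 1) (i : NNReal)).integrable_norm_pow'.mono
    (by fun_prop) (by simp)

lemma integrable_eval_mul_of_bounded {g : ℝ → ℝ} (hg : Measurable g) {B : ℝ}
    (hB : ∀ x, |g x| ≤ B) (p : Polynomial ℝ) :
    Integrable (fun x => p.eval x * g x) (gaussianReal 0 1) :=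
  (integrable_eval_gaussianReal p).mul_bdd (c := B) hg.aestronglyMeasurable
    (Filter.Eventually.of_forall hB)

lemma integral_id_mul_gaussianReal {G G' : ℝ → ℝ} (hG : ∀ x, HasDerivAt G (G' x) x)
    (h0 : Integrable G (gaussianReal 0 1)) (h1 : Integrable (fun x => x * G x) (gaussianReal 0 1))
    (h2 : Integrable G' (gaussianReal 0 1)) :
    ∫ x, x * G x ∂(gaussianReal 0 1) = ∫ x, G' x ∂(gaussianReal 0 1) := by
  have key : ∀ F : ℝ → ℝ, Integrable F (gaussianReal 0 1) →
      Integrable fun x => gaussianPDFReal 0 1 x * F x := by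
    intro F hF
    rw [gaussianReal_of_var_ne_zero _ one_ne_zero,
      integrable_withDensity_iff_integrable_smul' (measurable_gaussianPDF _ _)
        (by simp [gaussianPDF_lt_top])] at hF
    simpa [toReal_gaussianPDF] using hF
  have hd : ∀ x, HasDerivAt (gaussianPDFReal 0 1) (-(x * gaussianPDFReal 0 1 x)) x := by
    intro x
    have h : gaussianPDFReal 0 1 = fun y => (√(2 * Real.pi))⁻¹ * Real.exp (-y ^ 2 / 2) := by
      ext y; simp [gaussianPDFReal]
    rw [h]
    refine (((hasDerivAt_pow 2 x).neg.div_const 2).exp.const_mul (√(2 * Real.pi))⁻¹).congr_deriv ?_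
    simp only [Pi.neg_apply]
    push_cast
    ring
  have hz := integral_eq_zero_of_hasDerivAt_of_integrable
    (f := fun x => gaussianPDFReal 0 1 x * G x) (fun x => (hd x).mul (hG x))
    (by
      refine ((key _ h2).sub (key _ h1)).congr (Filter.Eventually.of_forall fun x => ?_)
      simp; ring) (key _ h0)
  rw [integral_gaussianReal_eq_integral_smul one_ne_zero,
    integral_gaussianReal_eq_integral_smul one_ne_zero]
  simp only [smul_eq_mul]
  rw [← sub_eq_zero, ← integral_sub (key _ h1) (key _ h2), ← neg_eq_zero, ← integral_neg]
  refine Eq.trans (integral_congr_ae (Filter.Eventually.of_forall fun x => ?_)) hz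
  ring

/-- The probabilists' Hermite polynomials with real coefficients. -/
noncomputable def realHermite (n : ℕ) : Polynomial ℝ :=
  (Polynomial.hermite n).map (Int.castRingHom ℝ)

lemma realHermite_succ (n : ℕ) :
    realHermite (n + 1) = Polynomial.X * realHermite n - Polynomial.derivative (realHermite n) := by
  simp [realHermite, Polynomial.hermite_succ, Polynomial.derivative_map]

lemma integral_realHermite_succ_mul (n : ℕ) {g g' : ℝ → ℝ} (hg : ∀ x, HasDerivAt g (g' x) x)
    (h0 : ∀ p : Polynomial ℝ, Integrable (fun x => p.eval x * g x) (gaussianReal 0 1))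
    (h1 : ∀ p : Polynomial ℝ, Integrable (fun x => p.eval x * g' x) (gaussianReal 0 1)) :
    ∫ x, (realHermite (n + 1)).eval x * g x ∂(gaussianReal 0 1)
      = ∫ x, (realHermite n).eval x * g' x ∂(gaussianReal 0 1) := by
  have hX := h0 (Polynomial.X * realHermite n)
  have hd := h0 (Polynomial.derivative (realHermite n))
  simp only [Polynomial.eval_mul, Polynomial.eval_X, mul_assoc] at hX
  have := integral_id_mul_gaussianReal
    (G := fun x => (realHermite n).eval x * g x)
    (G' := fun x => (Polynomial.derivative (realHermite n)).eval x * g x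
      + (realHermite n).eval x * g' x)
    (fun x => ((realHermite n).hasDerivAt x).mul (hg x)) (h0 _) hX
    (hd.add (h1 _))
  rw [integral_add hd (h1 _)] at this
  simp only [realHermite_succ, Polynomial.eval_sub, Polynomial.eval_mul, Polynomial.eval_X, sub_mul,
    mul_assoc]
  rw [integral_sub hX hd, this]
  ring

lemma integral_realHermite_mul_eval (n : ℕ) (p : Polynomial ℝ) :
    ∫ x, (realHermite n).eval x * p.eval x ∂(gaussianReal 0 1)
      = ∫ x, (Polynomial.derivative^[n] p).eval x ∂(gaussianReal 0 1) := by
  induction n generalizing p with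
  | zero => simp [realHermite]
  | succ n ih =>
    have h : ∀ p q : Polynomial ℝ, Integrable (fun x => q.eval x * p.eval x) (gaussianReal 0 1) :=
      fun p q => by simpa using integrable_eval_gaussianReal (q * p)
    rw [integral_realHermite_succ_mul n p.hasDerivAt (h p) (h _), ih, Function.iterate_succ_apply]

lemma integral_realHermite_mul_eval_of_lt {n : ℕ} {p : Polynomial ℝ} (h : p.natDegree < n) :
    ∫ x, (realHermite n).eval x * p.eval x ∂(gaussianReal 0 1) = 0 := by
  simp [integral_realHermite_mul_eval, Polynomial.iterate_derivative_eq_zero h]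

lemma integral_realHermite_sq (n : ℕ) :
    ∫ x, (realHermite n).eval x ^ 2 ∂(gaussianReal 0 1) = n.factorial := by
  have h : Polynomial.derivative^[n] (realHermite n) = Polynomial.C (n.factorial : ℝ) := by
    ext m
    rw [Polynomial.coeff_iterate_derivative, Polynomial.coeff_C, realHermite,
      Polynomial.coeff_map]
    split_ifs with hm
    · subst hm; simp [Polynomial.coeff_hermite_self, Nat.descFactorial_self]
    · rw [Polynomial.coeff_hermite_of_lt (by omega)]; simp
  simp only [sq, integral_realHermite_mul_eval, h]
  simp

lemma integral_cos_gaussianReal (t : ℝ) :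
    ∫ x, Real.cos (t * x) ∂(gaussianReal 0 1) = Real.exp (-t ^ 2 / 2) := by
  have h := charFun_gaussianReal (μ := 0) (v := 1) t
  rw [charFun_apply_real] at h
  have hi : Integrable (fun x : ℝ => Complex.exp (t * x * Complex.I)) (gaussianReal 0 1) := by
    refine (integrable_const (1 : ℝ)).mono (by fun_prop) (Filter.Eventually.of_forall fun x => ?_)
    rw [← Complex.ofReal_mul, Complex.norm_exp_ofReal_mul_I]; simp
  have h2 := congrArg Complex.re h
  rw [← RCLike.re_eq_complex_re, ← integral_re hi] at h2
  have e : ((t : ℂ) * ((0:ℝ):ℂ) * Complex.I - ((1 : NNReal):ℝ) * t ^ 2 / 2)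
      = ((-t ^ 2 / 2 : ℝ) : ℂ) := by
    push_cast; ring
  rw [e, RCLike.re_eq_complex_re, Complex.exp_ofReal_re] at h2
  rw [← h2]
  congr 1 with x
  rw [← Complex.ofReal_mul, Complex.exp_ofReal_mul_I_re]

lemma integrable_eval_mul_sin (t : ℝ) (p : Polynomial ℝ) :
    Integrable (fun x => p.eval x * Real.sin (t * x)) (gaussianReal 0 1) :=
  integrable_eval_mul_of_bounded (by fun_prop) (fun x => Real.abs_sin_le_one _) p

lemma integrable_eval_mul_cos (t : ℝ) (p : Polynomial ℝ) :
    Integrable (fun x => p.eval x * Real.cos (t * x)) (gaussianReal 0 1) :=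
  integrable_eval_mul_of_bounded (by fun_prop) (fun x => Real.abs_cos_le_one _) p

lemma integral_realHermite_succ_mul_sin (n : ℕ) (t : ℝ) :
    ∫ x, (realHermite (n + 1)).eval x * Real.sin (t * x) ∂(gaussianReal 0 1)
      = t * ∫ x, (realHermite n).eval x * Real.cos (t * x) ∂(gaussianReal 0 1) := by
  rw [integral_realHermite_succ_mul n (g' := fun x => t * Real.cos (t * x)) (fun x => ?_)
    (integrable_eval_mul_sin t) fun p => ?_, ← integral_const_mul]
  · congr 1 with x; ring
  · simpa [mul_comm] using ((hasDerivAt_id x).const_mul t).sin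
  · convert (integrable_eval_mul_cos t p).const_mul t using 2; ring

lemma integral_realHermite_succ_mul_cos (n : ℕ) (t : ℝ) :
    ∫ x, (realHermite (n + 1)).eval x * Real.cos (t * x) ∂(gaussianReal 0 1)
      = -t * ∫ x, (realHermite n).eval x * Real.sin (t * x) ∂(gaussianReal 0 1) := by
  rw [integral_realHermite_succ_mul n (g' := fun x => -t * Real.sin (t * x)) (fun x => ?_)
    (integrable_eval_mul_cos t) fun p => ?_, ← integral_const_mul]
  · congr 1 with x; ring
  · simpa [mul_comm] using ((hasDerivAt_id x).const_mul t).cos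
  · convert (integrable_eval_mul_sin t p).const_mul (-t) using 2; ring

lemma integral_realHermite_odd_mul_sin (m : ℕ) (t : ℝ) :
    ∫ x, (realHermite (2 * m + 1)).eval x * Real.sin (t * x) ∂(gaussianReal 0 1)
      = (-1) ^ m * (t ^ (2 * m + 1) * Real.exp (-t ^ 2 / 2)) := by
  induction m with
  | zero =>
    rw [integral_realHermite_succ_mul_sin]
    simp [realHermite, integral_cos_gaussianReal]
  | succ m ih =>
    rw [integral_realHermite_succ_mul_sin, show 2 * (m + 1) = 2 * m + 1 + 1 by ring,
      integral_realHermite_succ_mul_cos, ih]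
    ring

lemma integral_even_pow_gaussianReal_le (m : ℕ) :
    ∫ x, x ^ (2 * m) ∂(gaussianReal 0 1) ≤ 2 ^ m * m.factorial := by
  have hi : ∀ k : ℕ, Integrable (fun x : ℝ => x ^ k) (gaussianReal 0 1) := fun k => by
    simpa using integrable_eval_gaussianReal (Polynomial.X ^ k)
  induction m with
  | zero => simp
  | succ m ih =>
    have h := integral_id_mul_gaussianReal (G := fun x => x ^ (2 * m + 1))
      (fun x => hasDerivAt_pow (2 * m + 1) x) (hi _)
      (by simpa [← pow_succ'] using hi (2 * m + 1 + 1)) ((hi _).const_mul _)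
    simp only [← pow_succ', integral_const_mul, Nat.add_sub_cancel] at h
    rw [show 2 * (m + 1) = 2 * m + 1 + 1 by ring, h, Nat.factorial_succ]
    have h0 : 0 ≤ ∫ x, x ^ (2 * m) ∂(gaussianReal 0 1) :=
      integral_nonneg fun x => by simp only [pow_mul]; positivity
    push_cast
    calc ((2 * m + 1 : ℝ)) * ∫ x, x ^ (2 * m) ∂(gaussianReal 0 1)
        ≤ (2 * m + 2) * (2 ^ m * m.factorial) := by gcongr; norm_num
      _ = _ := by ring

lemma hasSum_coth_sub_inv {x : ℝ} (hx : x ≠ 0) :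
    HasSum (fun n : ℕ => 2 * x / (x ^ 2 + (Real.pi * (n + 1)) ^ 2))
      (Real.cosh x / Real.sinh x - 1 / x) := by
  set z : ℂ := Complex.I * (x / Real.pi : ℝ) with hz
  have hpi := Real.pi_ne_zero
  have hpi' : (Real.pi : ℂ) ≠ 0 := by exact_mod_cast hpi
  have hx' : (x : ℂ) ≠ 0 := by exact_mod_cast hx
  have hmem : z ∈ Complex.integerComplement := by
    rintro ⟨n, hn⟩
    have := congrArg Complex.im hn
    simp [hz] at this
    exact (div_ne_zero hx hpi) this.symm
  have hsum := (summable_cotTerm hmem).hasSum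
  rw [← cot_series_rep' hmem] at hsum
  have h := hsum.mul_left (Complex.I / Real.pi)
  rw [← Complex.hasSum_ofReal]
  have hs : (Real.sinh x : ℂ) ≠ 0 := by exact_mod_cast (Real.sinh_ne_zero.mpr hx)
  convert! h using 1
  · ext n
    have hp : x ^ 2 + (Real.pi * (n + 1)) ^ 2 ≠ 0 := by positivity
    have hp' : (x : ℂ) ^ 2 + (Real.pi * (n + 1)) ^ 2 ≠ 0 := by exact_mod_cast hp
    rw [cotTerm_identity hmem]
    have e : (z + (n + 1)) * (z - (n + 1))
        = -((x : ℂ) ^ 2 + (Real.pi * (n + 1)) ^ 2) / Real.pi ^ 2 := by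
      rw [hz]; push_cast; field_simp; linear_combination (x : ℂ) ^ 2 * Complex.I_sq
    rw [e, hz]
    push_cast
    field_simp
    simp [neg_div]
  · have e : (Real.pi : ℂ) * z = x * Complex.I := by rw [hz]; push_cast; field_simp
    rw [e, Complex.cot, Complex.cos_mul_I, Complex.sin_mul_I, hz]
    push_cast at hs ⊢
    field_simp

lemma coth_sub_half_coth_half {x : ℝ} (hx : x ≠ 0) :
    Real.cosh x / Real.sinh x - 1 / 2 * (Real.cosh (x / 2) / Real.sinh (x / 2))
      = 1 / (1 + Real.exp (-x)) - 1 / 2 := by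
  have hs : Real.sinh (x / 2) ≠ 0 := Real.sinh_ne_zero.mpr (by simpa using hx)
  have hsinh : Real.sinh x = 2 * Real.sinh (x / 2) * Real.cosh (x / 2) := by
    rw [← Real.sinh_two_mul]; congr 1; ring
  have hcosh : Real.cosh x = Real.cosh (x / 2) ^ 2 + Real.sinh (x / 2) ^ 2 := by
    rw [← Real.cosh_two_mul]; congr 1; ring
  have hexp : Real.exp (-x) = (Real.cosh (x / 2) - Real.sinh (x / 2)) ^ 2 := by
    rw [Real.cosh_sub_sinh, sq, ← Real.exp_add]; congr 1; ring
  have hsq := Real.cosh_sq (x / 2)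
  have hc := Real.cosh_pos (x / 2)
  have hne : 1 + (Real.cosh (x / 2) - Real.sinh (x / 2)) ^ 2 ≠ 0 := by positivity
  rw [hexp, hsinh, hcosh]
  generalize Real.cosh (x / 2) = c at *
  generalize Real.sinh (x / 2) = s at *
  have h1 : (c ^ 2 + s ^ 2) / (2 * s * c) - 1 / 2 * (c / s) = s / (2 * c) := by
    field_simp; ring
  have h2 : 1 / (1 + (c - s) ^ 2) = (c + s) / (2 * c) := by
    rw [div_eq_div_iff hne (by positivity)]
    linear_combination (s - c) * hsq
  rw [h1, h2]
  field_simp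
  ring

lemma hasSum_sigmoid_sub_half (x : ℝ) :
    HasSum (fun k : ℕ => 2 * x / (x ^ 2 + (Real.pi * (2 * k + 1)) ^ 2))
      (1 / (1 + Real.exp (-x)) - 1 / 2) := by
  rcases eq_or_ne x 0 with rfl | hx
  · norm_num
  set f : ℕ → ℝ := fun n => 2 * x / (x ^ 2 + (Real.pi * (n + 1)) ^ 2) with hf
  have hS : HasSum f (Real.cosh x / Real.sinh x - 1 / x) := hasSum_coth_sub_inv hx
  have hodd : HasSum (fun k : ℕ => f (2 * k + 1))
      (1 / 2 * (Real.cosh (x / 2) / Real.sinh (x / 2) - 1 / (x / 2))) := by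
    have e : (fun k : ℕ => f (2 * k + 1)) = fun k : ℕ =>
        1 / 2 * (2 * (x / 2) / ((x / 2) ^ 2 + (Real.pi * (k + 1)) ^ 2)) := by
      ext k
      have h4 : x ^ 2 + (Real.pi * (((2 * k + 1 : ℕ) : ℝ) + 1)) ^ 2
          = 4 * ((x / 2) ^ 2 + (Real.pi * (k + 1)) ^ 2) := by push_cast; ring
      have hne : (x / 2) ^ 2 + (Real.pi * (k + 1)) ^ 2 ≠ 0 := by positivity
      rw [hf]
      beta_reduce
      rw [h4]
      generalize (x / 2) ^ 2 + (Real.pi * (k + 1)) ^ 2 = d at *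
      field_simp
      ring
    rw [e]
    exact (hasSum_coth_sub_inv (by simpa using hx)).mul_left _
  have heven : Summable fun k : ℕ => f (2 * k) :=
    hS.summable.comp_injective fun a b h => by simpa using h
  have hu := (heven.hasSum.even_add_odd hodd).unique hS
  have hx2 : 1 / x = 1 / 2 * (1 / (x / 2)) := by field_simp
  have hval : ∑' k : ℕ, f (2 * k) = 1 / (1 + Real.exp (-x)) - 1 / 2 := by
    rw [← coth_sub_half_coth_half hx]
    linarith
  rw [← hval]
  simpa [hf] using heven.hasSum

lemma integral_exp_neg_mul_sin_Ioi {a : ℝ} (ha : 0 < a) (x : ℝ) :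
    ∫ t in Set.Ioi 0, Real.exp (-(a * t)) * Real.sin (t * x) = x / (x ^ 2 + a ^ 2) := by
  have hre : (-(a : ℂ) + x * Complex.I).re < 0 := by simpa using ha
  have hi := integrableOn_exp_mul_complex_Ioi hre 0
  have h := congrArg Complex.im (integral_exp_mul_complex_Ioi hre 0)
  rw [← RCLike.im_eq_complex_im, ← integral_im hi] at h
  convert h using 1
  · congr 1 with t
    rw [RCLike.im_eq_complex_im, Complex.exp_im]
    simp; ring_nf
  · rw [RCLike.im_eq_complex_im]
    simp [Complex.div_im, Complex.normSq]
    ring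

lemma integrableOn_mul_exp_neg_Ioi {a : ℝ} (ha : 0 < a) :
    IntegrableOn (fun t : ℝ => t * Real.exp (-(a * t))) (Set.Ioi 0) := by
  have := integrableOn_rpow_mul_exp_neg_mul_rpow (s := 1) (p := 1) (by norm_num) one_pos ha
  simpa using this

lemma integral_mul_exp_neg_Ioi {a : ℝ} (ha : 0 < a) :
    ∫ t in Set.Ioi 0, t * Real.exp (-(a * t)) = 1 / a ^ 2 := by
  have := Real.integral_rpow_mul_exp_neg_mul_Ioi (a := 2) (r := a) (by norm_num) ha
  norm_num at this
  simpa using this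

lemma mul_inv_sinh_le {t : ℝ} (ht : 0 < t) : t * (Real.sinh (Real.pi * t))⁻¹ ≤ Real.exp (-t) := by
  have hs : 0 < Real.sinh (Real.pi * t) := Real.sinh_pos_iff.mpr (by positivity)
  rw [← div_eq_mul_inv, div_le_iff₀ hs, Real.sinh_eq, mul_div_assoc', mul_sub, ← Real.exp_add,
    ← Real.exp_add, le_div_iff₀ two_pos]
  have h1 := Real.add_one_le_exp (-t + Real.pi * t)
  have h2 : Real.exp (-t + -(Real.pi * t)) ≤ 1 :=
    Real.exp_le_one_iff.mpr (by nlinarith [Real.pi_pos])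
  nlinarith [Real.pi_gt_three]

lemma two_mul_exp_le_inv_sinh {t : ℝ} (ht : 0 < t) :
    2 * Real.exp (-(Real.pi * t)) ≤ (Real.sinh (Real.pi * t))⁻¹ := by
  have hs : 0 < Real.sinh (Real.pi * t) := Real.sinh_pos_iff.mpr (by positivity)
  rw [le_inv_comm₀ (by positivity) hs, mul_inv, ← Real.exp_neg, neg_neg, Real.sinh_eq]
  linarith [Real.exp_pos (-(Real.pi * t))]

lemma hasSum_inv_sinh {t : ℝ} (ht : 0 < t) :
    HasSum (fun k : ℕ => 2 * Real.exp (-(Real.pi * (2 * k + 1) * t)))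
      (Real.sinh (Real.pi * t))⁻¹ := by
  have hlt : Real.exp (-(2 * Real.pi * t)) < 1 :=
    Real.exp_lt_one_iff.mpr (by nlinarith [Real.pi_pos])
  convert! (hasSum_geometric_of_lt_one (Real.exp_pos _).le hlt).mul_left
    (2 * Real.exp (-(Real.pi * t))) using 1
  · ext k
    rw [← Real.exp_nat_mul, mul_assoc 2, ← Real.exp_add]
    ring_nf
  · have e : Real.exp (-(2 * Real.pi * t)) = Real.exp (-(Real.pi * t)) ^ 2 := by
      rw [sq, ← Real.exp_add]; ring_nf
    have hne : 1 - Real.exp (-(2 * Real.pi * t)) ≠ 0 := by linarith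
    rw [e] at hne ⊢
    rw [Real.sinh_eq, ← neg_neg (Real.pi * t), Real.exp_neg (-(Real.pi * t)), neg_neg]
    have := Real.exp_pos (-(Real.pi * t))
    field_simp

lemma abs_sin_mul_le {t : ℝ} (ht : 0 < t) (x : ℝ) : |Real.sin (t * x)| ≤ t * |x| := by
  simpa [abs_mul, abs_of_pos ht] using Real.abs_sin_le_abs (x := t * x)

lemma integral_sin_div_sinh (x : ℝ) :
    ∫ t in Set.Ioi 0, (Real.sinh (Real.pi * t))⁻¹ * Real.sin (t * x)
      = 1 / (1 + Real.exp (-x)) - 1 / 2 := by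
  set F : ℕ → ℝ → ℝ := fun k t => 2 * Real.exp (-(Real.pi * (2 * k + 1) * t)) * Real.sin (t * x)
  have ha : ∀ k : ℕ, 0 < Real.pi * (2 * k + 1) := fun k => by positivity
  have hbound : ∀ k : ℕ, ∀ t ∈ Set.Ioi (0 : ℝ),
      ‖F k t‖ ≤ 2 * |x| * (t * Real.exp (-(Real.pi * (2 * k + 1) * t))) := fun k t ht => by
    simp only [F, norm_mul, Real.norm_eq_abs, abs_two, Real.abs_exp]
    have := mul_le_mul_of_nonneg_left (abs_sin_mul_le ht x)
      (Real.exp_pos (-(Real.pi * (2 * k + 1) * t))).le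
    linarith
  have hdom : ∀ k : ℕ, IntegrableOn
      (fun t => 2 * |x| * (t * Real.exp (-(Real.pi * (2 * k + 1) * t)))) (Set.Ioi 0) :=
    fun k => (integrableOn_mul_exp_neg_Ioi (ha k)).const_mul _
  have hinteg : ∀ k : ℕ, IntegrableOn (F k) (Set.Ioi 0) := fun k =>
    (hdom k).mono' (by fun_prop) ((ae_restrict_mem measurableSet_Ioi).mono (hbound k))
  have hsum : Summable fun k : ℕ => ∫ t in Set.Ioi 0, ‖F k t‖ := by
    have h2 : Summable fun k : ℕ => 2 * |x| * (1 / ((k + 1 : ℕ) : ℝ) ^ 2) :=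
      ((summable_nat_add_iff 1).mpr
        (Real.summable_one_div_nat_pow (p := 2).mpr one_lt_two)).mul_left _
    refine h2.of_nonneg_of_le (fun k => integral_nonneg fun t => norm_nonneg _) fun k => ?_
    refine (setIntegral_mono_on (hinteg k).norm (hdom k) measurableSet_Ioi (hbound k)).trans ?_
    rw [integral_const_mul, integral_mul_exp_neg_Ioi (ha k)]
    gcongr
    push_cast
    nlinarith [Real.pi_gt_three, (Nat.cast_nonneg k : (0 : ℝ) ≤ k)]
  have h := hasSum_integral_of_summable_integral_norm hinteg hsum
  have h3 : ∀ k : ℕ, ∫ t in Set.Ioi 0, F k t = 2 * x / (x ^ 2 + (Real.pi * (2 * k + 1)) ^ 2) := by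
    intro k
    have e : F k = fun t => 2 * (Real.exp (-(Real.pi * (2 * k + 1) * t)) * Real.sin (t * x)) :=
      funext fun t => mul_assoc _ _ _
    rw [e, integral_const_mul, integral_exp_neg_mul_sin_Ioi (ha k)]
    ring
  simp only [h3] at h
  rw [← h.unique (hasSum_sigmoid_sub_half x)]
  refine setIntegral_congr_fun measurableSet_Ioi fun t ht => ?_
  exact ((hasSum_inv_sinh ht).mul_right _).tsum_eq.symm

/-- The standard sigmoid function. -/
noncomputable def sigmoidFun (x : ℝ) : ℝ := 1 / (1 + Real.exp (-x))

lemma measurable_sigmoidFun : Measurable sigmoidFun := by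
  unfold sigmoidFun
  fun_prop

lemma abs_sigmoidFun_le_one (x : ℝ) : |sigmoidFun x| ≤ 1 := by
  have := Real.exp_pos (-x)
  rw [sigmoidFun, abs_of_nonneg (by positivity), div_le_one (by positivity)]
  linarith

lemma integrable_sigmoidFun_sub_eval_sq (p : Polynomial ℝ) :
    Integrable (fun x => (sigmoidFun x - p.eval x) ^ 2) (gaussianReal 0 1) := by
  have h := integrable_eval_mul_of_bounded measurable_sigmoidFun abs_sigmoidFun_le_one
  have h1 : Integrable (fun x => sigmoidFun x ^ 2) (gaussianReal 0 1) :=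
    (integrable_const (1 : ℝ)).mono' (measurable_sigmoidFun.pow_const 2).aestronglyMeasurable
      (Filter.Eventually.of_forall fun x => by
        simpa [sq_le_one_iff_abs_le_one] using abs_sigmoidFun_le_one x)
  have h2 := integrable_eval_gaussianReal (p ^ 2)
  refine ((h1.sub ((h p).const_mul 2)).add h2).congr (Filter.Eventually.of_forall fun x => ?_)
  simp
  ring

lemma measurable_inv_sinh : Measurable fun t : ℝ => (Real.sinh (Real.pi * t))⁻¹ :=
  (Real.continuous_sinh.measurable.comp (measurable_const_mul _)).inv

lemma integrableOn_mul_inv_sinh :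
    IntegrableOn (fun t : ℝ => t * (Real.sinh (Real.pi * t))⁻¹) (Set.Ioi 0) := by
  refine (integrableOn_exp_neg_Ioi 0).mono'
    (measurable_id.mul measurable_inv_sinh).aestronglyMeasurable
    ((ae_restrict_mem measurableSet_Ioi).mono fun t (ht : 0 < t) => ?_)
  have : 0 < Real.sinh (Real.pi * t) := Real.sinh_pos_iff.mpr (by positivity)
  rw [Real.norm_of_nonneg (by positivity)]
  exact mul_inv_sinh_le ht

lemma norm_inv_sinh_mul_sin_le (t x : ℝ) :
    ‖(Real.sinh (Real.pi * t))⁻¹ * Real.sin (t * x)‖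
      ≤ |x| * |t * (Real.sinh (Real.pi * t))⁻¹| := by
  rw [norm_mul, Real.norm_eq_abs, Real.norm_eq_abs, abs_mul t]
  have := mul_le_mul_of_nonneg_left (Real.abs_sin_le_abs (x := t * x))
    (abs_nonneg (Real.sinh (Real.pi * t))⁻¹)
  rw [abs_mul t x] at this
  linarith

lemma integrableOn_inv_sinh_mul_sin (x : ℝ) :
    IntegrableOn (fun t : ℝ => (Real.sinh (Real.pi * t))⁻¹ * Real.sin (t * x)) (Set.Ioi 0) :=
  (integrableOn_mul_inv_sinh.abs.const_mul |x|).mono'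
    (measurable_inv_sinh.mul (by fun_prop)).aestronglyMeasurable
    (Filter.Eventually.of_forall fun t => norm_inv_sinh_mul_sin_le t x)

lemma sigmoidFun_eq (x : ℝ) :
    sigmoidFun x
      = 1 / 2 + ∫ t in Set.Ioi 0, (Real.sinh (Real.pi * t))⁻¹ * Real.sin (t * x) := by
  rw [integral_sin_div_sinh, sigmoidFun]
  ring

lemma integral_realHermite_odd_mul_sigmoidFun (m : ℕ) :
    ∫ x, (realHermite (2 * m + 1)).eval x * sigmoidFun x ∂(gaussianReal 0 1)
      = (-1) ^ m * ∫ t in Set.Ioi 0,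
          (Real.sinh (Real.pi * t))⁻¹ * (t ^ (2 * m + 1) * Real.exp (-t ^ 2 / 2)) := by
  set H := realHermite (2 * m + 1) with hH
  have hprod : Integrable (Function.uncurry fun x t : ℝ =>
      H.eval x * ((Real.sinh (Real.pi * t))⁻¹ * Real.sin (t * x)))
      ((gaussianReal 0 1).prod (volume.restrict (Set.Ioi 0))) := by
    have h1 : Integrable (fun x => |H.eval x * x|) (gaussianReal 0 1) := by
      have h := (integrable_eval_gaussianReal (H * Polynomial.X)).abs
      simp only [Polynomial.eval_mul, Polynomial.eval_X] at h
      exact h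
    refine (h1.mul_prod integrableOn_mul_inv_sinh.abs).mono' ?_
      (Filter.Eventually.of_forall fun z => ?_)
    · refine Measurable.aestronglyMeasurable ?_
      exact (H.continuous.measurable.comp measurable_fst).mul
        ((measurable_inv_sinh.comp measurable_snd).mul (by fun_prop))
    · simp only [Function.uncurry, norm_mul (H.eval z.1), Real.norm_eq_abs (H.eval z.1)]
      rw [abs_mul (H.eval z.1), mul_assoc]
      gcongr
      exact norm_inv_sinh_mul_sin_le _ _
  have h0 : ∫ x, H.eval x * (1 / 2) ∂(gaussianReal 0 1) = 0 := by
    simpa using integral_realHermite_mul_eval_of_lt (n := 2 * m + 1)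
      (p := Polynomial.C (1 / 2)) (by simp)
  have hadd : ∀ x, H.eval x * sigmoidFun x = H.eval x * (1 / 2)
      + ∫ t in Set.Ioi 0, H.eval x * ((Real.sinh (Real.pi * t))⁻¹ * Real.sin (t * x)) :=
    fun x => by rw [sigmoidFun_eq, mul_add, integral_const_mul]
  have hinner : Integrable (fun x => ∫ t in Set.Ioi 0,
      H.eval x * ((Real.sinh (Real.pi * t))⁻¹ * Real.sin (t * x))) (gaussianReal 0 1) :=
    hprod.integral_prod_left
  simp only [hadd]
  rw [integral_add ((integrable_eval_gaussianReal H).mul_const _) hinner, h0,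
    zero_add, integral_integral_swap hprod, ← integral_const_mul]
  congr 1 with t
  have e : ∀ x, H.eval x * ((Real.sinh (Real.pi * t))⁻¹ * Real.sin (t * x))
      = (Real.sinh (Real.pi * t))⁻¹ * (H.eval x * Real.sin (t * x)) := fun x => by ring
  simp_rw [e]
  rw [integral_const_mul, hH, integral_realHermite_odd_mul_sin]
  ring

lemma factorial_mul_exp_le {k : ℕ} (hk : 1 ≤ k) :
    (k.factorial : ℝ) * Real.exp k ≤ Real.exp 1 * k * (k : ℝ) ^ k := by
  induction k, hk using Nat.le_induction with
  | base => simp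
  | succ k hk ih =>
    have h1 : (k : ℝ) ≤ (k + 1) * Real.exp (-(1 / (k + 1))) := by
      have h := Real.add_one_le_exp (-(1 / ((k : ℝ) + 1)))
      calc (k : ℝ) = (k + 1) * (-(1 / (k + 1)) + 1) := by field_simp; ring
        _ ≤ _ := by gcongr
    have h2 : Real.exp 1 * (k : ℝ) ^ (k + 1) ≤ (k + 1 : ℝ) ^ (k + 1) := by
      have h := pow_le_pow_left₀ (Nat.cast_nonneg k) h1 (k + 1)
      rw [mul_pow, ← Real.exp_nat_mul] at h
      have e : ((k + 1 : ℕ) : ℝ) * -(1 / (k + 1)) = -1 := by push_cast; field_simp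
      rw [e] at h
      calc Real.exp 1 * (k : ℝ) ^ (k + 1)
          ≤ Real.exp 1 * ((k + 1 : ℝ) ^ (k + 1) * Real.exp (-1)) := by gcongr
        _ = (k + 1 : ℝ) ^ (k + 1) := by rw [mul_left_comm, ← Real.exp_add]; simp
    rw [Nat.factorial_succ]
    push_cast
    calc ((k : ℝ) + 1) * k.factorial * Real.exp (k + 1)
        = (k + 1) * Real.exp 1 * (k.factorial * Real.exp k) := by rw [Real.exp_add]; ring
      _ ≤ (k + 1) * Real.exp 1 * (Real.exp 1 * k * (k : ℝ) ^ k) := by gcongr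
      _ = (k + 1) * Real.exp 1 * (Real.exp 1 * (k : ℝ) ^ (k + 1)) := by ring
      _ ≤ (k + 1) * Real.exp 1 * (k + 1 : ℝ) ^ (k + 1) := by gcongr
      _ = _ := by ring

lemma le_integral_inv_sinh_mul_pow_mul_exp {k : ℕ} (hk : 1 ≤ k) :
    √k ^ k * Real.exp (-(k / 2) - √k - 1 / 2 - Real.pi * (√k + 1))
      ≤ ∫ t in Set.Ioi 0, (Real.sinh (Real.pi * t))⁻¹ * (t ^ k * Real.exp (-t ^ 2 / 2)) := by
  set s := √(k : ℝ) with hs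
  have hk' : (1 : ℝ) ≤ k := by exact_mod_cast hk
  have hs0 : 0 < s := Real.sqrt_pos.mpr (by linarith)
  have hsq : s ^ 2 = k := Real.sq_sqrt (by linarith)
  have hpos : ∀ t ∈ Set.Ioi (0 : ℝ),
      0 ≤ (Real.sinh (Real.pi * t))⁻¹ * (t ^ k * Real.exp (-t ^ 2 / 2)) := by
    intro t (ht : 0 < t)
    have : 0 < Real.sinh (Real.pi * t) := Real.sinh_pos_iff.mpr (by positivity)
    positivity
  have hinteg : IntegrableOn
      (fun t : ℝ => (Real.sinh (Real.pi * t))⁻¹ * (t ^ k * Real.exp (-t ^ 2 / 2)))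
      (Set.Ioi 0) := by
    refine (Real.GammaIntegral_convergent (s := k) (by linarith)).mono'
      (measurable_inv_sinh.mul (by fun_prop)).aestronglyMeasurable
      ((ae_restrict_mem measurableSet_Ioi).mono fun t (ht : 0 < t) => ?_)
    rw [Real.norm_of_nonneg (hpos t ht), ← Nat.cast_pred hk, Real.rpow_natCast]
    have h1 := mul_inv_sinh_le ht
    have h2 : Real.exp (-t ^ 2 / 2) ≤ 1 :=
    Real.exp_le_one_iff.mpr (by nlinarith)
    calc _ = t * (Real.sinh (Real.pi * t))⁻¹ * t ^ (k - 1) * Real.exp (-t ^ 2 / 2) := by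
          rw [← mul_pow_sub_one (by omega : k ≠ 0) t]; ring
      _ ≤ Real.exp (-t) * t ^ (k - 1) * 1 := by gcongr
      _ = _ := mul_one _
  have hsub : Set.Ioc s (s + 1) ⊆ Set.Ioi 0 := fun t ht => hs0.trans ht.1
  have hconst : ∀ t ∈ Set.Ioc s (s + 1),
      s ^ k * Real.exp (-(k / 2) - s - 1 / 2 - Real.pi * (s + 1))
        ≤ (Real.sinh (Real.pi * t))⁻¹ * (t ^ k * Real.exp (-t ^ 2 / 2)) := by
    intro t ht
    have ht0 : 0 < t := hsub ht
    have h1 := two_mul_exp_le_inv_sinh ht0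
    have h2 : Real.exp (-(Real.pi * (s + 1))) ≤ Real.exp (-(Real.pi * t)) := by
      gcongr
      exact ht.2
    have h3 : Real.exp (-(k / 2) - s - 1 / 2) ≤ Real.exp (-t ^ 2 / 2) := by
      gcongr
      nlinarith [ht.2]
    have h4 : s ^ k ≤ t ^ k := by gcongr; exact ht.1.le
    rw [sub_eq_add_neg _ (Real.pi * (s + 1)), Real.exp_add]
    calc _ = Real.exp (-(Real.pi * (s + 1))) * (s ^ k * Real.exp (-(k / 2) - s - 1 / 2)) := by ring
      _ ≤ _ := by
        gcongr
        linarith [Real.exp_pos (-(Real.pi * t))]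
  calc _ = ∫ t in Set.Ioc s (s + 1),
        s ^ k * Real.exp (-(k / 2) - s - 1 / 2 - Real.pi * (s + 1)) := by simp
    _ ≤ ∫ t in Set.Ioc s (s + 1),
        (Real.sinh (Real.pi * t))⁻¹ * (t ^ k * Real.exp (-t ^ 2 / 2)) :=
      setIntegral_mono_on (integrableOn_const (by simp)) (hinteg.mono_set hsub)
        measurableSet_Ioc hconst
    _ ≤ _ := setIntegral_mono_set hinteg
      ((ae_restrict_mem measurableSet_Ioi).mono hpos) hsub.eventuallyLE

lemma factorial_mul_exp_le_integral_sq {k : ℕ} (hk : 1 ≤ k) :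
    k.factorial * Real.exp (-(20 * √k))
      ≤ (∫ t in Set.Ioi 0, (Real.sinh (Real.pi * t))⁻¹ * (t ^ k * Real.exp (-t ^ 2 / 2))) ^ 2 := by
  have hk' : (1 : ℝ) ≤ k := by exact_mod_cast hk
  have hs1 : 1 ≤ √(k : ℝ) := Real.one_le_sqrt.mpr hk'
  refine le_trans ?_ (pow_le_pow_left₀ (by positivity) (le_integral_inv_sinh_mul_pow_mul_exp hk) 2)
  have hkk : (k : ℝ) ≤ Real.exp (2 * √k) := by
    have h := Real.add_one_le_exp √(k : ℝ)
    calc (k : ℝ) = √k ^ 2 := (Real.sq_sqrt (by linarith)).symm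
      _ ≤ Real.exp √k ^ 2 := by gcongr; linarith
      _ = _ := by rw [← Real.exp_nat_mul]; norm_num
  have hfac : (k.factorial : ℝ) ≤ Real.exp 1 * k * (k : ℝ) ^ k * Real.exp (-k) := by
    rw [Real.exp_neg, ← div_eq_mul_inv, le_div_iff₀ (Real.exp_pos _)]
    exact factorial_mul_exp_le hk
  have hpow : (√(k : ℝ) ^ k) ^ 2 = (k : ℝ) ^ k := by
    rw [← pow_mul, mul_comm, pow_mul, Real.sq_sqrt (by linarith)]
  rw [mul_pow, hpow, ← Real.exp_nat_mul]
  calc (k.factorial : ℝ) * Real.exp (-(20 * √k))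
      ≤ Real.exp 1 * Real.exp (2 * √k) * (k : ℝ) ^ k * Real.exp (-k) * Real.exp (-(20 * √k)) := by
        grw [hfac]
        gcongr
    _ = (k : ℝ) ^ k * Real.exp (1 + 2 * √k - k - 20 * √k) := by
        simp only [sub_eq_add_neg, Real.exp_add]; ring
    _ ≤ _ := by
        gcongr
        push_cast
        nlinarith [Real.pi_lt_d2, Real.pi_pos]

lemma exp_neg_sqrt_le_integral_sq {k m : ℕ} (hk : k = 2 * m + 1) {p : Polynomial ℝ}
    (hp : p.natDegree < k) :
    Real.exp (-(20 * √k)) ≤ ∫ x, (sigmoidFun x - p.eval x) ^ 2 ∂(gaussianReal 0 1) := by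
  set I := ∫ x, (realHermite k).eval x * sigmoidFun x ∂(gaussianReal 0 1) with hI
  have hfac : (0 : ℝ) < k.factorial := by positivity
  have hIsq : k.factorial * Real.exp (-(20 * √k)) ≤ I ^ 2 := by
    rw [hI, hk, integral_realHermite_odd_mul_sigmoidFun, mul_pow, ← pow_mul, mul_comm m, pow_mul]
    simpa [← hk] using factorial_mul_exp_le_integral_sq (k := k) (by omega)
  set H := realHermite k with hH
  have i1 := integrable_sigmoidFun_sub_eval_sq p
  have i2 := integrable_eval_mul_of_bounded measurable_sigmoidFun abs_sigmoidFun_le_one H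
  have i3 : Integrable (fun x => H.eval x * p.eval x) (gaussianReal 0 1) := by
    simpa using integrable_eval_gaussianReal (H * p)
  have i4 : Integrable (fun x => H.eval x ^ 2) (gaussianReal 0 1) := by
    have h := integrable_eval_gaussianReal (H ^ 2)
    simp only [Polynomial.eval_pow] at h
    exact h
  have hnn : 0 ≤ ∫ x, (sigmoidFun x - p.eval x - I / k.factorial * H.eval x) ^ 2
      ∂(gaussianReal 0 1) := integral_nonneg fun x => sq_nonneg _
  have e : ∀ x, (sigmoidFun x - p.eval x - I / k.factorial * H.eval x) ^ 2
      = (sigmoidFun x - p.eval x) ^ 2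
        - 2 * (I / k.factorial) * (H.eval x * sigmoidFun x - H.eval x * p.eval x)
        + (I / k.factorial) ^ 2 * H.eval x ^ 2 := fun x => by ring
  have i5 : Integrable (fun x => 2 * (I / k.factorial)
      * (H.eval x * sigmoidFun x - H.eval x * p.eval x)) (gaussianReal 0 1) :=
    (i2.sub i3).const_mul _
  simp only [e] at hnn
  rw [integral_add (by exact i1.sub i5) (i4.const_mul _),
    integral_sub i1 i5, integral_const_mul, integral_const_mul,
    integral_sub i2 i3, hH, integral_realHermite_mul_eval_of_lt hp, integral_realHermite_sq,
    ← hH, ← hI] at hnn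
  have e2 : 2 * (I / k.factorial) * (I - 0) - (I / k.factorial) ^ 2 * k.factorial
      = I ^ 2 / k.factorial := by field_simp; ring
  have h3 : Real.exp (-(20 * √k)) ≤ I ^ 2 / k.factorial := by
    rw [le_div_iff₀ hfac]; linarith
  linarith

lemma norm_exp_mul_I_sub_sum_le (n : ℕ) {y : ℝ} (hy : 0 ≤ y) :
    ‖Complex.exp (y * Complex.I) - ∑ k ∈ Finset.range n, (y * Complex.I) ^ k / k.factorial‖
      ≤ y ^ n / n.factorial := by
  induction n generalizing y with
  | zero => simp [Complex.norm_exp_ofReal_mul_I]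
  | succ n ih =>
    set R : ℕ → ℝ → ℂ := fun n y => Complex.exp (y * Complex.I)
      - ∑ k ∈ Finset.range n, (y * Complex.I) ^ k / k.factorial with hR
    have hlin : ∀ y : ℝ, HasDerivAt (fun y : ℝ => (y : ℂ) * Complex.I) Complex.I y := fun y => by
      simpa using (Complex.ofRealCLM.hasDerivAt (x := y)).mul_const Complex.I
    have hd : ∀ y : ℝ, HasDerivAt (R (n + 1)) (Complex.I * R n y) y := by
      intro y
      have hterm : ∀ k : ℕ, HasDerivAt
          (fun y : ℝ => ((y : ℂ) * Complex.I) ^ (k + 1) / (k + 1).factorial)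
          (Complex.I * (((y : ℂ) * Complex.I) ^ k / k.factorial)) y := by
        intro k
        refine (((hlin y).fun_pow (k + 1)).div_const _).congr_deriv ?_
        have h1 : (k.factorial : ℂ) ≠ 0 := by exact_mod_cast k.factorial_ne_zero
        have h2 : (k : ℂ) + 1 ≠ 0 := by exact_mod_cast k.succ_ne_zero
        rw [Nat.factorial_succ, add_tsub_cancel_right]
        push_cast
        field_simp
      have hsum := (HasDerivAt.fun_sum (u := Finset.range n) fun k _ => hterm k).add_const 1
      have h := (hlin y).cexp.sub hsum
      refine (h.congr_deriv ?_).congr_of_eventuallyEq (Filter.Eventually.of_forall fun z => ?_)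
      · rw [hR, ← Finset.mul_sum]; ring
      · simp [hR, Finset.sum_range_succ' _ n]
    have hB : ∀ y : ℝ, HasDerivAt (fun y : ℝ => y ^ (n + 1) / (n + 1).factorial)
        (y ^ n / n.factorial) y := by
      intro y
      refine ((hasDerivAt_pow (n + 1) y).div_const _).congr_deriv ?_
      rw [Nat.factorial_succ, add_tsub_cancel_right]
      push_cast
      field_simp
    refine image_norm_le_of_norm_deriv_right_le_deriv_boundary (f := R (n + 1)) (a := 0) (b := y)
      (f' := fun y => Complex.I * R n y) (fun z _ => (hd z).continuousAt.continuousWithinAt)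
      (fun z _ => (hd z).hasDerivWithinAt) ?_ hB (fun z hz => ?_) ⟨hy, le_rfl⟩
    · simp [hR, Finset.sum_range_succ' _ n]
    · simpa [hR] using ih hz.1

lemma abs_sin_sub_sum_le (n : ℕ) (y : ℝ) :
    |Real.sin y - ∑ k ∈ Finset.range n, (Complex.I ^ k).im / k.factorial * y ^ k|
      ≤ |y| ^ n / n.factorial := by
  have hnn : ∀ y : ℝ, 0 ≤ y →
      |Real.sin y - ∑ k ∈ Finset.range n, (Complex.I ^ k).im / k.factorial * y ^ k|
        ≤ y ^ n / n.factorial := by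
    intro y hy
    refine le_trans (le_of_eq_of_le ?_ (Complex.abs_im_le_norm _))
      (norm_exp_mul_I_sub_sum_le n hy)
    rw [Complex.sub_im, Complex.exp_ofReal_mul_I_im, Complex.im_sum]
    congr 3 with k
    have : ((y : ℂ) * Complex.I) ^ k / k.factorial
        = ((y ^ k / k.factorial : ℝ) : ℂ) * Complex.I ^ k := by
      push_cast; ring
    rw [this, Complex.im_ofReal_mul]
    ring
  rcases le_total 0 y with hy | hy
  · simpa [abs_of_nonneg hy] using hnn y hy
  · have h := hnn (-y) (by linarith)
    rw [abs_of_nonpos hy]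
    refine le_of_eq_of_le ?_ h
    have hodd : ∀ k : ℕ, (Complex.I ^ k).im / k.factorial * (-y) ^ k
        = -((Complex.I ^ k).im / k.factorial * y ^ k) := by
      intro k
      rcases k.even_or_odd with hk | hk
      · obtain ⟨m, rfl⟩ := hk
        have : Complex.I ^ (m + m) = (((-1) ^ m : ℝ) : ℂ) := by
          rw [← two_mul, pow_mul, Complex.I_sq]; push_cast; rfl
        rw [this, Complex.ofReal_im]
        simp
      · rw [hk.neg_pow, mul_neg]
    rw [Finset.sum_congr rfl fun k _ => hodd k, Finset.sum_neg_distrib, Real.sin_neg,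
      ← abs_neg]
    congr 1
    ring

/-- The Taylor polynomial of `sin (t x)` in `x`, averaged over `t ∈ (0, T]` against
`1 / sinh (π t)`, which approximates the sigmoid. -/
noncomputable def sigmoidApprox (n : ℕ) (T : ℝ) : Polynomial ℝ :=
  Polynomial.C (1 / 2) + ∑ k ∈ Finset.range n, Polynomial.monomial k
    (∫ t in Set.Ioc 0 T, (Complex.I ^ k).im / k.factorial * ((Real.sinh (Real.pi * t))⁻¹ * t ^ k))

lemma natDegree_sigmoidApprox_le (n : ℕ) (T : ℝ) : (sigmoidApprox n T).natDegree ≤ n := by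
  refine Polynomial.natDegree_add_le_of_degree_le (by simp) ?_
  refine Polynomial.natDegree_sum_le_of_forall_le _ _ fun k hk => ?_
  exact (Polynomial.natDegree_monomial_le _).trans (Finset.mem_range.mp hk).le

lemma eval_sigmoidApprox (n : ℕ) (T x : ℝ) :
    (sigmoidApprox n T).eval x = 1 / 2 + ∫ t in Set.Ioc 0 T, (Real.sinh (Real.pi * t))⁻¹
        * ∑ k ∈ Finset.range n, (Complex.I ^ k).im / k.factorial * (t * x) ^ k
    ∧ IntegrableOn (fun t => (Real.sinh (Real.pi * t))⁻¹
        * ∑ k ∈ Finset.range n, (Complex.I ^ k).im / k.factorial * (t * x) ^ k) (Set.Ioc 0 T) := by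
  have hterm : ∀ k : ℕ, IntegrableOn (fun t => (Complex.I ^ k).im / k.factorial
      * ((Real.sinh (Real.pi * t))⁻¹ * t ^ k)) (Set.Ioc 0 T) := by
    intro k
    rcases k with _ | k
    · simp
    · refine Integrable.const_mul ?_ _
      refine ((integrableOn_mul_inv_sinh.mono_set Set.Ioc_subset_Ioi_self).abs.const_mul
        (T ^ k)).mono' (measurable_inv_sinh.mul (by fun_prop)).aestronglyMeasurable
        ((ae_restrict_mem measurableSet_Ioc).mono fun t ht => ?_)
      have ht0 : 0 ≤ t := ht.1.le
      rw [pow_succ', ← mul_assoc, mul_comm (Real.sinh _)⁻¹, norm_mul, mul_comm,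
        Real.norm_of_nonneg (by positivity : 0 ≤ t ^ k), Real.norm_eq_abs]
      gcongr
      exact ht.2
  have e : ∀ t : ℝ, (Real.sinh (Real.pi * t))⁻¹
        * ∑ k ∈ Finset.range n, (Complex.I ^ k).im / k.factorial * (t * x) ^ k
      = ∑ k ∈ Finset.range n, (Complex.I ^ k).im / k.factorial
        * ((Real.sinh (Real.pi * t))⁻¹ * t ^ k) * x ^ k := by
    intro t
    rw [Finset.mul_sum]
    refine Finset.sum_congr rfl fun k _ => ?_
    ring
  simp_rw [e]
  refine ⟨?_, integrable_finsetSum _ fun k _ => (hterm k).mul_const _⟩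
  rw [integral_finsetSum _ fun k _ => (hterm k).mul_const _]
  simp [sigmoidApprox, Polynomial.eval_finsetSum, integral_mul_const]

lemma abs_sigmoidFun_sub_sigmoidApprox_le {n : ℕ} (hn : 1 ≤ n) {T : ℝ} (hT : 1 ≤ T) (x : ℝ) :
    |sigmoidFun x - (sigmoidApprox n T).eval x|
      ≤ T ^ n / n.factorial * |x| ^ n + Real.exp (-T) := by
  have hT0 : 0 < T := by linarith
  have hw := integrableOn_inv_sinh_mul_sin x
  have hsplit := setIntegral_union (Set.Ioc_disjoint_Ioi_same (a := 0) (b := T)) measurableSet_Ioi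
    (hw.mono_set Set.Ioc_subset_Ioi_self) (hw.mono_set (Set.Ioi_subset_Ioi hT0.le))
  rw [Set.Ioc_union_Ioi_eq_Ioi hT0.le] at hsplit
  obtain ⟨hev, hinteg⟩ := eval_sigmoidApprox n T x
  have hexp := integrableOn_exp_neg_Ioi 0
  rw [sigmoidFun_eq, hev, hsplit]
  have hmain : ‖∫ t in Set.Ioc 0 T, ((Real.sinh (Real.pi * t))⁻¹ * Real.sin (t * x)
      - (Real.sinh (Real.pi * t))⁻¹
        * ∑ k ∈ Finset.range n, (Complex.I ^ k).im / k.factorial * (t * x) ^ k)‖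
      ≤ T ^ n / n.factorial * |x| ^ n := by
    have hb : IntegrableOn (fun t => T ^ n / n.factorial * |x| ^ n * Real.exp (-t))
        (Set.Ioi 0) := hexp.const_mul _
    refine (norm_integral_le_of_norm_le (hb.mono_set Set.Ioc_subset_Ioi_self)
      ((ae_restrict_mem measurableSet_Ioc).mono fun t ht => ?_)).trans ?_
    · have ht0 : 0 < t := ht.1
      have hs : 0 < Real.sinh (Real.pi * t) := Real.sinh_pos_iff.mpr (by positivity)
      rw [← mul_sub, norm_mul, Real.norm_of_nonneg (by positivity), Real.norm_eq_abs]
      calc (Real.sinh (Real.pi * t))⁻¹ * |_|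
          ≤ (Real.sinh (Real.pi * t))⁻¹ * (|t * x| ^ n / n.factorial) := by
            gcongr
            exact abs_sin_sub_sum_le n (t * x)
        _ = t * (Real.sinh (Real.pi * t))⁻¹ * (t ^ (n - 1) * (|x| ^ n / n.factorial)) := by
            rw [abs_mul, abs_of_pos ht0, mul_pow, ← mul_pow_sub_one (by omega : n ≠ 0) t]
            ring
        _ ≤ Real.exp (-t) * (T ^ n * (|x| ^ n / n.factorial)) := by
            gcongr
            · exact mul_inv_sinh_le ht0
            · calc t ^ (n - 1) ≤ T ^ (n - 1) := by gcongr; exact ht.2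
                _ ≤ T ^ n := pow_le_pow_right₀ hT (Nat.sub_le n 1)
        _ = _ := by ring
    · refine (setIntegral_mono_set hb (Filter.Eventually.of_forall fun t => ?_)
        Set.Ioc_subset_Ioi_self.eventuallyLE).trans ?_
      · simp only [Pi.zero_apply]; positivity
      · rw [integral_const_mul, integral_exp_neg_Ioi_zero, mul_one]
  have htail : ‖∫ t in Set.Ioi T, (Real.sinh (Real.pi * t))⁻¹ * Real.sin (t * x)‖
      ≤ Real.exp (-T) := by
    rw [← integral_exp_neg_Ioi T]
    refine norm_integral_le_of_norm_le (integrableOn_exp_neg_Ioi T)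
      ((ae_restrict_mem measurableSet_Ioi).mono fun t (ht : T < t) => ?_)
    have ht0 : 0 < t := hT0.trans ht
    have hs : 0 < Real.sinh (Real.pi * t) := Real.sinh_pos_iff.mpr (by positivity)
    rw [norm_mul, Real.norm_of_nonneg (by positivity), Real.norm_eq_abs]
    calc _ ≤ (Real.sinh (Real.pi * t))⁻¹ * 1 := by gcongr; exact Real.abs_sin_le_one _
      _ = 1 * (Real.sinh (Real.pi * t))⁻¹ := by ring
      _ ≤ t * (Real.sinh (Real.pi * t))⁻¹ := by gcongr; linarith
      _ ≤ _ := mul_inv_sinh_le ht0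
  rw [integral_sub (hw.mono_set Set.Ioc_subset_Ioi_self) hinteg] at hmain
  refine le_trans (le_of_eq_of_le ?_ (norm_add_le _ _)) (add_le_add hmain htail)
  rw [Real.norm_eq_abs]
  congr 1
  ring

lemma integral_sigmoidFun_sub_sigmoidApprox_sq_le {n : ℕ} {T : ℝ} (hT : 1 ≤ T)
    (hn : 15 * T ^ 2 ≤ n) :
    ∫ x, (sigmoidFun x - (sigmoidApprox n T).eval x) ^ 2 ∂(gaussianReal 0 1)
      ≤ 4 * Real.exp (-2 * T) := by
  have hn0 : (15 : ℝ) ≤ n := by nlinarith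
  have hn1 : 1 ≤ n := by
    have : (1 : ℝ) ≤ n := by linarith
    exact_mod_cast this
  have hpw : ∀ x, (sigmoidFun x - (sigmoidApprox n T).eval x) ^ 2
      ≤ 2 * (T ^ n / n.factorial) ^ 2 * x ^ (2 * n) + 2 * Real.exp (-2 * T) := by
    intro x
    have h := pow_le_pow_left₀ (abs_nonneg _) (abs_sigmoidFun_sub_sigmoidApprox_le hn1 hT x) 2
    rw [sq_abs] at h
    have e1 : (|x| ^ n) ^ 2 = x ^ (2 * n) := by rw [← pow_mul, mul_comm, pow_mul, sq_abs, ← pow_mul]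
    have e2 : Real.exp (-T) ^ 2 = Real.exp (-2 * T) := by
      rw [← Real.exp_nat_mul]; push_cast; ring_nf
    rw [← e1, ← e2]
    nlinarith [sq_nonneg (T ^ n / n.factorial * |x| ^ n - Real.exp (-T))]
  have hi : Integrable (fun x : ℝ => x ^ (2 * n)) (gaussianReal 0 1) := by
    simpa using integrable_eval_gaussianReal (Polynomial.X ^ (2 * n))
  have hbound : Integrable (fun x : ℝ => 2 * (T ^ n / n.factorial) ^ 2 * x ^ (2 * n)
      + 2 * Real.exp (-2 * T)) (gaussianReal 0 1) := (hi.const_mul _).add (integrable_const _)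
  refine (integral_mono (integrable_sigmoidFun_sub_eval_sq _) hbound hpw).trans ?_
  rw [integral_add (hi.const_mul _) (integrable_const _), integral_const_mul, integral_const]
  have hfac : (0 : ℝ) < n.factorial := by positivity
  have hmom : 2 * (T ^ n / n.factorial) ^ 2 * ∫ x, x ^ (2 * n) ∂(gaussianReal 0 1)
      ≤ 2 * ((2 * T ^ 2) ^ n / n.factorial) := by
    grw [integral_even_pow_gaussianReal_le n]
    apply le_of_eq
    field_simp
    ring
  have hsmall : (2 * T ^ 2) ^ n / n.factorial ≤ Real.exp (-2 * T) := by
    have he : 2 * T ^ 2 ≤ n * Real.exp (-2) := by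
      have h1 : Real.exp 2 ≤ 7.5 := by
        have := Real.exp_one_lt_d9
        calc Real.exp 2 = Real.exp 1 ^ 2 := by rw [← Real.exp_nat_mul]; norm_num
          _ ≤ 2.7182818286 ^ 2 := by gcongr
          _ ≤ 7.5 := by norm_num
      rw [Real.exp_neg, ← div_eq_mul_inv, le_div_iff₀ (Real.exp_pos _)]
      nlinarith [sq_nonneg T]
    calc (2 * T ^ 2) ^ n / n.factorial ≤ (n * Real.exp (-2)) ^ n / n.factorial := by gcongr
      _ = (n : ℝ) ^ n / n.factorial * Real.exp (-2) ^ n := by ring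
      _ ≤ Real.exp n * Real.exp (-2) ^ n := by
        gcongr
        exact Real.pow_div_factorial_le_exp _ (by positivity) n
      _ = Real.exp (-n) := by
        rw [← Real.exp_nat_mul, ← Real.exp_add]; ring_nf
      _ ≤ _ := by
        gcongr
        nlinarith
  simp only [probReal_univ, one_smul]
  linarith

/-- `L²(γ₁)` polynomial approximation of the sigmoid `1/(1+e^{−t})`: there are constants
`c, C, ε₀ > 0` such that for all `ε ∈ (0, ε₀)`:
(i) every polynomial `p` with `‖f − p‖₂ < ε` has degree at least `c log²(1/ε)`;
(ii) some polynomial `p` of degree at most `C log²(1/ε)` has `‖f − p‖₂ < ε`. -/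
theorem stmt_15 : ∃ c > (0:ℝ), ∃ C > (0:ℝ), ∃ ε₀ > (0:ℝ), ∀ ε : ℝ, 0 < ε → ε < ε₀ →
    (∀ p : Polynomial ℝ,
      (∫ x, (1 / (1 + Real.exp (-x)) - p.eval x) ^ 2 ∂(gaussianReal 0 1)) ^ (1/(2:ℝ)) < ε →
      c * (Real.log (1 / ε)) ^ 2 ≤ (p.natDegree : ℝ)) ∧
    (∃ p : Polynomial ℝ,
      (p.natDegree : ℝ) ≤ C * (Real.log (1 / ε)) ^ 2 ∧
      (∫ x, (1 / (1 + Real.exp (-x)) - p.eval x) ^ 2 ∂(gaussianReal 0 1)) ^ (1/(2:ℝ)) < ε) := by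
  refine ⟨1 / 200, by norm_num, 64, by norm_num, Real.exp (-20), Real.exp_pos _,
    fun ε hε hε₀ => ?_⟩
  set L := Real.log (1 / ε) with hL
  have hεL : ε = Real.exp (-L) := by
    rw [hL, one_div, Real.log_inv, neg_neg, Real.exp_log hε]
  have hL20 : 20 < L := by
    rw [hεL, Real.exp_lt_exp] at hε₀
    linarith
  have hnorm : ∀ p : Polynomial ℝ,
      (∫ x, (1 / (1 + Real.exp (-x)) - p.eval x) ^ 2 ∂(gaussianReal 0 1)) ^ (1/(2:ℝ)) < ε ↔
      ∫ x, (sigmoidFun x - p.eval x) ^ 2 ∂(gaussianReal 0 1) < Real.exp (-2 * L) := by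
    intro p
    rw [← Real.sqrt_eq_rpow, Real.sqrt_lt' hε, hεL, ← Real.exp_nat_mul]
    push_cast
    rw [mul_neg, neg_mul]
    rfl
  refine ⟨fun p hp => ?_, sigmoidApprox ⌈15 * (L + 1) ^ 2⌉₊ (L + 1), ?_, ?_⟩
  · rw [hnorm] at hp
    set m := (p.natDegree + 1) / 2
    have hlow := exp_neg_sqrt_le_integral_sq (k := 2 * m + 1) rfl (p := p) (by omega)
    have h := hlow.trans_lt hp
    rw [Real.exp_lt_exp] at h
    have hk : ((2 * m + 1 : ℕ) : ℝ) ≤ p.natDegree + 2 := by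
      have : 2 * m + 1 ≤ p.natDegree + 2 := by omega
      exact_mod_cast this
    have hsq := Real.sq_sqrt (Nat.cast_nonneg (α := ℝ) (2 * m + 1))
    nlinarith [Real.sqrt_nonneg ((2 * m + 1 : ℕ) : ℝ)]
  · have h1 : ((sigmoidApprox ⌈15 * (L + 1) ^ 2⌉₊ (L + 1)).natDegree : ℝ)
        ≤ (⌈15 * (L + 1) ^ 2⌉₊ : ℝ) := by
      exact_mod_cast natDegree_sigmoidApprox_le _ _
    have h2 := Nat.ceil_lt_add_one (show 0 ≤ 15 * (L + 1) ^ 2 by positivity)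
    nlinarith
  · rw [hnorm]
    refine (integral_sigmoidFun_sub_sigmoidApprox_sq_le (by linarith)
      (Nat.le_ceil _)).trans_lt ?_
    have h4 : 4 < Real.exp 2 := by
      have := Real.exp_one_gt_d9
      calc (4 : ℝ) < 2.7182818283 ^ 2 := by norm_num
        _ ≤ Real.exp 1 ^ 2 := by gcongr
        _ = Real.exp 2 := by rw [← Real.exp_nat_mul]; norm_num
    calc 4 * Real.exp (-2 * (L + 1)) < Real.exp 2 * Real.exp (-2 * (L + 1)) := by gcongr
      _ = Real.exp (-2 * L) := by rw [← Real.exp_add]; ring_nf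
end

section
/- Let f : ℝ → ℝ be the standard sigmoid function f(t) = 1/(1 + e^{−t}). There exist constants c > 0 and ε₀ > 0 such that for all ε ∈ (0, ε₀), every polynomial p : ℝ → ℝ satisfying E_{x∼γ₁}[|f(x) − p(x)|] < ε has degree at least c · log(1/ε). -/
open MeasureTheory ProbabilityTheory

lemma hasSum_coth {x : ℝ} (hx : x ≠ 0) :
    HasSum (fun n : ℕ ↦ 2 * x / (x ^ 2 + (Real.pi * (n + 1)) ^ 2))
      (Real.cosh x / Real.sinh x - 1 / x) := by
  have hπ : (Real.pi : ℂ) ≠ 0 := by exact_mod_cast Real.pi_ne_zero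
  have hxc : (x : ℂ) ≠ 0 := by exact_mod_cast hx
  set z : ℂ := x * Complex.I / Real.pi with hz
  have him : z.im = x / Real.pi := by simp [hz]
  have hmem : z ∈ Complex.integerComplement := by
    rintro ⟨n, hn⟩
    have := congrArg Complex.im hn
    rw [him, Complex.intCast_im] at this
    exact div_ne_zero hx Real.pi_ne_zero this.symm
  have hsum := (Summable.hasSum_iff_tendsto_nat (summable_cotTerm hmem)).mpr
    (tendsto_logDeriv_euler_cot_sub hmem)
  have hs : (Complex.sinh x) ≠ 0 := by
    rw [← Complex.ofReal_sinh]; exact_mod_cast (Real.sinh_ne_zero.2 hx)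
  have hsum' := hsum.mul_left (Complex.I / Real.pi)
  have hval : Complex.I / Real.pi * (Real.pi * Complex.cot (Real.pi * z) - 1 / z) =
      ((Real.cosh x / Real.sinh x - 1 / x : ℝ) : ℂ) := by
    rw [show (Real.pi : ℂ) * z = x * Complex.I by rw [hz]; field_simp, Complex.cot,
      Complex.cos_mul_I, Complex.sin_mul_I, hz]
    push_cast
    field_simp
  rw [hval] at hsum'
  rw [← Complex.hasSum_ofReal]
  convert! hsum' using 2 with n
  rw [cotTerm_identity hmem, hz]
  have h1 : ((x : ℂ) ^ 2 + (Real.pi * (n + 1)) ^ 2) ≠ 0 := by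
    have : x ^ 2 + (Real.pi * (n + 1)) ^ 2 ≠ 0 := by positivity
    exact_mod_cast this
  have h2 : ((x * Complex.I / Real.pi + (n + 1)) * (x * Complex.I / Real.pi - (n + 1)) : ℂ)
      = - ((x : ℂ) ^ 2 + (Real.pi * (n + 1)) ^ 2) / Real.pi ^ 2 := by
    field_simp
    ring_nf
    simp only [Complex.I_sq]
    ring
  push_cast
  rw [h2]
  field_simp
  simp only [Complex.I_sq]
  ring

lemma hasSum_sigmoid_odd_part {x : ℝ} (hx : x ≠ 0) :
    HasSum (fun n : ℕ ↦ 4 / (x ^ 2 + (Real.pi * (n + 1)) ^ 2)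
        - 4 / (x ^ 2 + (2 * Real.pi * (n + 1)) ^ 2))
      ((1 / (1 + Real.exp (-x)) - 1 / (1 + Real.exp x)) / x) := by
  have h1 := (hasSum_coth hx).mul_left 2
  have h2 := hasSum_coth (div_ne_zero hx two_ne_zero)
  convert! (h1.sub h2).div_const x using 2 with n
  · field_simp
    ring
  · have hs := Real.sinh_ne_zero.2 (div_ne_zero hx two_ne_zero)
    have hc := (Real.cosh_pos (x / 2)).ne'
    obtain ⟨y, rfl⟩ : ∃ y, x = 2 * y := ⟨x / 2, by ring⟩
    rw [mul_div_cancel_left₀ _ (two_ne_zero)] at hs hc ⊢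
    rw [Real.sinh_two_mul, Real.cosh_two_mul]
    have e : (1 / (1 + Real.exp (-(2 * y))) - 1 / (1 + Real.exp (2 * y)))
        = Real.sinh y / Real.cosh y := by
      rw [Real.sinh_eq, Real.cosh_eq, Real.exp_neg, Real.exp_neg,
        show 2 * y = y + y by ring, Real.exp_add]
      have := Real.exp_pos y
      field_simp
      ring
    rw [e]
    field_simp
    ring

lemma sum_nodalWeight_div_add {s : Finset ℕ} {v : ℕ → ℝ} (hv : Set.InjOn v s) (hs : s.Nonempty)
    {b : ℝ} (hb : ∀ i ∈ s, 0 < v i + b) :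
    ∑ i ∈ s, Lagrange.nodalWeight s v i / (v i + b) =
      (-1) ^ (s.card + 1) / ∏ i ∈ s, (v i + b) := by
  have hne : ∀ i ∈ s, -b ≠ v i := fun i hi h ↦ by linarith [hb i hi]
  have h := Lagrange.eval_interpolate_not_at_node (r := 1) hne
  rw [Lagrange.interpolate_one hv hs, Lagrange.eval_nodal, Polynomial.eval_one] at h
  have h3 : ∏ i ∈ s, (-b - v i) = (-1) ^ s.card * ∏ i ∈ s, (v i + b) := by
    rw [← Finset.prod_const, ← Finset.prod_mul_distrib]
    exact Finset.prod_congr rfl fun i _ ↦ by ring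
  have h4 : ∑ i ∈ s, Lagrange.nodalWeight s v i * (-b - v i)⁻¹ * (1 : ℕ → ℝ) i =
      - ∑ i ∈ s, Lagrange.nodalWeight s v i / (v i + b) := by
    rw [← Finset.sum_neg_distrib]
    refine Finset.sum_congr rfl fun i _ ↦ ?_
    rw [show -b - v i = -(v i + b) by ring, inv_neg, Pi.one_apply]
    ring
  rw [h3, h4] at h
  have hp : ∏ i ∈ s, (v i + b) ≠ 0 := (Finset.prod_pos hb).ne'
  rw [eq_div_iff hp, pow_succ]
  have hsq : ((-1 : ℝ) ^ s.card) * (-1) ^ s.card = 1 := by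
    rw [← mul_pow]; simp
  linear_combination (-1 : ℝ) ^ s.card * h - (∏ i ∈ s, (v i + b)) *
    (∑ i ∈ s, Lagrange.nodalWeight s v i / (v i + b)) * hsq

lemma Polynomial.exists_odd_part (p : Polynomial ℝ) :
    ∃ P : Polynomial ℝ, P.natDegree ≤ p.natDegree ∧
      ∀ x, p.eval x - p.eval (-x) = x * P.eval (x ^ 2) := by
  refine ⟨∑ l ∈ Finset.range (p.natDegree + 1),
    Polynomial.C (2 * p.coeff (2 * l + 1)) * Polynomial.X ^ l, ?_, fun x ↦ ?_⟩
  · refine Polynomial.natDegree_sum_le_of_forall_le _ _ fun l hl ↦ ?_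
    exact (Polynomial.natDegree_C_mul_X_pow_le _ _).trans
      (Nat.lt_succ_iff.1 (Finset.mem_range.1 hl))
  · have hlt : p.natDegree < 2 * (p.natDegree + 1) := by omega
    have split : ∀ (f : ℕ → ℝ) (n : ℕ), ∑ k ∈ Finset.range (2 * n), f k =
        ∑ l ∈ Finset.range n, (f (2 * l) + f (2 * l + 1)) := by
      intro f n
      induction n with
      | zero => simp
      | succ n ih =>
        rw [mul_add, mul_one, Finset.sum_range_succ, Finset.sum_range_succ, ih,
          Finset.sum_range_succ]
        ring
    rw [Polynomial.eval_eq_sum_range' hlt, Polynomial.eval_eq_sum_range' hlt,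
      ← Finset.sum_sub_distrib, split, Polynomial.eval_finsetSum, Finset.mul_sum]
    refine Finset.sum_congr rfl fun l _ ↦ ?_
    rw [Polynomial.eval_mul, Polynomial.eval_C, Polynomial.eval_pow, Polynomial.eval_X,
      (even_two_mul l).neg_pow, (odd_two_mul_add_one l).neg_pow]
    ring

lemma prod_abs_sub_range_erase {N j : ℕ} (hj : j < N) :
    ∏ i ∈ (Finset.range N).erase j, |(j : ℝ) - i| = j.factorial * (N - 1 - j).factorial := by
  obtain ⟨m, rfl⟩ : ∃ m, N = j + 1 + m := ⟨N - (j + 1), by omega⟩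
  have hdisj : (Finset.range (j + 1 + m)).erase j =
      Finset.range j ∪ (Finset.range m).map (addLeftEmbedding (j + 1)) := by
    ext i
    simp only [Finset.mem_erase, Finset.mem_range, Finset.mem_union, Finset.mem_map,
      addLeftEmbedding_apply]
    constructor
    · rintro ⟨h1, h2⟩
      rcases lt_or_gt_of_ne h1 with h | h
      · exact Or.inl h
      · exact Or.inr ⟨i - (j + 1), by omega, by omega⟩
    · rintro (h | ⟨a, h1, rfl⟩) <;> omega
  rw [hdisj, Finset.prod_union, Finset.prod_map, show j + 1 + m - 1 - j = m by omega]
  · congr 1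
    · rw [← Finset.prod_range_reflect, ← Finset.prod_range_add_one_eq_factorial]
      push_cast
      refine Finset.prod_congr rfl fun i hi ↦ ?_
      have : i + 1 ≤ j := Finset.mem_range.1 hi
      rw [show j - 1 - i = j - (i + 1) by omega, Nat.cast_sub this]
      push_cast
      rw [show (j : ℝ) - (j - (i + 1)) = i + 1 by ring]
      exact abs_of_pos (by positivity)
    · rw [← Finset.prod_range_add_one_eq_factorial]
      push_cast
      refine Finset.prod_congr rfl fun i _ ↦ ?_
      simp only [addLeftEmbedding_apply]
      push_cast
      rw [show (j : ℝ) - (j + 1 + i) = -(i + 1) by ring, abs_neg]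
      exact abs_of_pos (by positivity)
  · rw [Finset.disjoint_left]
    simp only [Finset.mem_range, Finset.mem_map, addLeftEmbedding_apply]
    rintro a h ⟨b, _, rfl⟩
    omega

lemma abs_nodalWeight_range_le {N : ℕ} {v : ℕ → ℝ}
    (hv : ∀ i < N, ∀ j < N, |(j : ℝ) - i| / N ≤ |v j - v i|) {j : ℕ} (hj : j < N) :
    |Lagrange.nodalWeight (Finset.range N) v j| ≤ 6 ^ N := by
  have hN : 0 < N := by omega
  have hN' : (0 : ℝ) < N := by exact_mod_cast hN
  have hpos : (0 : ℝ) < j.factorial * (N - 1 - j).factorial := by positivity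
  have h1 : |Lagrange.nodalWeight (Finset.range N) v j| ≤
      (N : ℝ) ^ (N - 1) / (j.factorial * (N - 1 - j).factorial) := by
    rw [Lagrange.nodalWeight, Finset.prod_inv_distrib, abs_inv, Finset.abs_prod,
      ← inv_div ((j.factorial : ℝ) * (N - 1 - j).factorial)]
    refine inv_anti₀ (by positivity) ?_
    calc (j.factorial : ℝ) * (N - 1 - j).factorial / N ^ (N - 1)
        = ∏ i ∈ (Finset.range N).erase j, |(j : ℝ) - i| / N := by
          rw [Finset.prod_div_distrib, prod_abs_sub_range_erase hj, Finset.prod_const,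
            Finset.card_erase_of_mem (Finset.mem_range.2 hj), Finset.card_range]
      _ ≤ _ := Finset.prod_le_prod (fun _ _ ↦ by positivity) fun i hi ↦
          hv i (Finset.mem_range.1 (Finset.mem_of_mem_erase hi)) j hj
  have h2 : ((N - 1).choose j : ℝ) * (j.factorial * (N - 1 - j).factorial) =
      (N - 1).factorial := by
    have := Nat.choose_mul_factorial_mul_factorial (show j ≤ N - 1 by omega)
    rw [← mul_assoc]; exact_mod_cast this
  have h3 : ((N - 1).choose j : ℝ) ≤ 2 ^ N := by
    have := (Nat.choose_le_two_pow (N - 1) j).trans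
      (Nat.pow_le_pow_right two_pos (Nat.sub_le N 1))
    exact_mod_cast this
  have h4 : (N : ℝ) ^ (N - 1) / (N - 1).factorial ≤ 3 ^ N := by
    refine (Real.pow_div_factorial_le_exp _ hN'.le (N - 1)).trans ?_
    rw [← mul_one (N : ℝ), Real.exp_nat_mul]
    exact pow_le_pow_left₀ (Real.exp_pos 1).le (Real.exp_one_lt_d9.le.trans (by norm_num)) N
  have hf : (0 : ℝ) < (N - 1).factorial := by positivity
  refine h1.trans ?_
  calc (N : ℝ) ^ (N - 1) / (j.factorial * (N - 1 - j).factorial)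
      = (N - 1).choose j * ((N : ℝ) ^ (N - 1) / (N - 1).factorial) := by
        rw [← h2]
        have : ((N - 1).choose j : ℝ) ≠ 0 := by
          intro h; rw [h, zero_mul] at h2; exact hf.ne h2
        field_simp
    _ ≤ 2 ^ N * 3 ^ N := by gcongr
    _ = 6 ^ N := by rw [← mul_pow]; norm_num

lemma continuous_sigmoid_sub (p : Polynomial ℝ) :
    Continuous fun x ↦ 1 / (1 + Real.exp (-x)) - p.eval x := by
  refine Continuous.sub (continuous_const.div (by fun_prop) fun x ↦ ?_) p.continuous
  positivity

lemma integrable_sigmoid_sub (p : Polynomial ℝ) :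
    Integrable (fun x ↦ 1 / (1 + Real.exp (-x)) - p.eval x) (gaussianReal 0 1) := by
  refine Integrable.sub ?_ ?_
  · refine Integrable.of_bound (C := 1) ?_ (Filter.Eventually.of_forall fun x ↦ ?_)
    · exact (continuous_const.div (by fun_prop)
        fun x ↦ (by positivity)).aestronglyMeasurable
    · rw [Real.norm_of_nonneg (by positivity)]
      exact (div_le_one (by positivity)).2 (by linarith [Real.exp_pos (-x)])
  · simp_rw [Polynomial.eval_eq_sum_range]
    refine integrable_finsetSum _ fun n _ ↦ Integrable.const_mul ?_ _
    have h := (memLp_id_gaussianReal' (μ := 0) (v := 1) n (by simp)).integrable_norm_pow'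
    refine (integrable_norm_iff (by fun_prop)).1 ?_
    simpa using h

lemma intervalIntegral_abs_le_gaussianReal {f : ℝ → ℝ} (hc : Continuous f)
    (hf : Integrable f (gaussianReal 0 1)) {a b : ℝ} (ha : -2 ≤ a) (hab : a ≤ b) (hb : b ≤ 2) :
    ∫ x in a..b, |f x| ≤ 20 * ∫ x, |f x| ∂(gaussianReal 0 1) := by
  have hpdf : ∀ x ∈ Set.Icc a b, 1 ≤ 20 * gaussianPDFReal 0 1 x := by
    intro x hx
    have hx2 : x ^ 2 ≤ 4 := by nlinarith [hx.1, hx.2]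
    rw [gaussianPDFReal]
    have h1 : √(2 * Real.pi * ((1 : NNReal) : ℝ)) ≤ 2.55 := by
      rw [Real.sqrt_le_left (by norm_num)]
      have := Real.pi_lt_d2
      push_cast; norm_num; norm_num at this; linarith
    have h2 : Real.exp 2 ≤ 7.5 := by
      rw [show (2 : ℝ) = 1 + 1 by norm_num, Real.exp_add]
      have hlt : Real.exp 1 ≤ 2.72 := Real.exp_one_lt_d9.le.trans (by norm_num)
      exact (mul_le_mul hlt hlt (Real.exp_pos 1).le (by norm_num)).trans (by norm_num)
    have h3 : (2.55 : ℝ)⁻¹ ≤ (√(2 * Real.pi * ((1 : NNReal) : ℝ)))⁻¹ :=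
      inv_anti₀ (Real.sqrt_pos.2 (by have := Real.pi_pos; push_cast; linarith)) h1
    have h4 : (7.5 : ℝ)⁻¹ ≤ Real.exp (-(x - 0) ^ 2 / (2 * ((1 : NNReal) : ℝ))) := by
      refine (inv_anti₀ (Real.exp_pos 2) h2).trans ?_
      rw [← Real.exp_neg]
      refine Real.exp_le_exp.2 ?_
      push_cast; linarith
    have h5 := mul_le_mul h3 h4 (by norm_num) (by positivity)
    refine le_trans ?_ (mul_le_mul_of_nonneg_left h5 (by norm_num : (0 : ℝ) ≤ 20))
    norm_num
  have hint : Integrable (fun x ↦ gaussianPDFReal 0 1 x * |f x|) := by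
    have h := hf.abs
    rw [gaussianReal_of_var_ne_zero 0 one_ne_zero,
      integrable_withDensity_iff_integrable_smul' (measurable_gaussianPDF 0 1)
        (Filter.Eventually.of_forall fun _ ↦ gaussianPDF_lt_top)] at h
    simpa only [toReal_gaussianPDF, smul_eq_mul] using h
  rw [integral_gaussianReal_eq_integral_smul one_ne_zero, ← integral_const_mul,
    intervalIntegral.integral_of_le hab, ← integral_Icc_eq_integral_Ioc]
  have hint' := hint.const_mul 20
  simp only [smul_eq_mul]
  refine le_trans (setIntegral_mono_on (hc.abs.integrableOn_Icc) hint'.integrableOn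
    measurableSet_Icc fun x hx ↦ ?_) (setIntegral_le_integral hint'
      (Filter.Eventually.of_forall fun x ↦ ?_))
  · rw [← mul_assoc]
    exact le_mul_of_one_le_left (abs_nonneg _) (hpdf x hx)
  · have := gaussianPDFReal_nonneg 0 1 x
    simp only [Pi.zero_apply]
    positivity

lemma exists_mem_Icc_mul_abs_le {f : ℝ → ℝ} (hf : Continuous f) {a b : ℝ} (hab : a < b) :
    ∃ x ∈ Set.Icc a b, (b - a) * |f x| ≤ ∫ x in a..b, |f x| := by
  obtain ⟨x, hx, h⟩ := exists_le_setAverage (μ := volume) (s := Set.Icc a b) (f := fun x ↦ |f x|)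
    (by simp [hab]) (by simp) hf.abs.integrableOn_Icc
  refine ⟨x, hx, ?_⟩
  rw [setAverage_eq, Real.volume_real_Icc_of_le hab.le, smul_eq_mul,
    integral_Icc_eq_integral_Ioc, ← intervalIntegral.integral_of_le hab.le] at h
  have h' := mul_le_mul_of_nonneg_left h (sub_pos.2 hab).le
  rwa [mul_inv_cancel_left₀ (sub_pos.2 hab).ne'] at h'

lemma two_div_le_abs_sum_nodalWeight_mul {N : ℕ} (hN : 0 < N) {x : ℕ → ℝ}
    (hx : ∀ j < N, x j ∈ Set.Icc 1 2) (hinj : Set.InjOn (fun j ↦ x j ^ 2) (Finset.range N)) :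
    2 / 14 ^ N ≤ |∑ j ∈ Finset.range N, Lagrange.nodalWeight (Finset.range N) (fun j ↦ x j ^ 2) j *
      ((1 / (1 + Real.exp (-x j)) - 1 / (1 + Real.exp (x j))) / x j)| := by
  set w := Lagrange.nodalWeight (Finset.range N) (fun j ↦ x j ^ 2) with hw
  have hne : (Finset.range N).Nonempty := Finset.nonempty_range_iff.2 hN.ne'
  have hsum : HasSum (fun k : ℕ ↦ (-1) ^ (N + 1) * ∑ j ∈ Finset.range N, w j *
      (4 / (x j ^ 2 + (Real.pi * (k + 1)) ^ 2) - 4 / (x j ^ 2 + (2 * Real.pi * (k + 1)) ^ 2)))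
      ((-1) ^ (N + 1) * ∑ j ∈ Finset.range N, w j *
      ((1 / (1 + Real.exp (-x j)) - 1 / (1 + Real.exp (x j))) / x j)) := by
    refine (hasSum_sum fun j hj ↦ (hasSum_sigmoid_odd_part ?_).mul_left _).mul_left _
    have := (hx j (Finset.mem_range.1 hj)).1
    positivity
  have hlag : ∀ b : ℝ, 0 < b → ∑ j ∈ Finset.range N, w j * (4 / (x j ^ 2 + b)) =
      4 * ((-1) ^ (N + 1) / ∏ j ∈ Finset.range N, (x j ^ 2 + b)) := by
    intro b hb
    have h := sum_nodalWeight_div_add hinj hne (b := b) fun i _ ↦ by positivity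
    rw [Finset.card_range] at h
    rw [← h, Finset.mul_sum]
    exact Finset.sum_congr rfl fun j _ ↦ by ring
  have hterm : ∀ k : ℕ, (-1) ^ (N + 1) * ∑ j ∈ Finset.range N, w j *
      (4 / (x j ^ 2 + (Real.pi * (k + 1)) ^ 2) - 4 / (x j ^ 2 + (2 * Real.pi * (k + 1)) ^ 2)) =
      4 * (1 / ∏ j ∈ Finset.range N, (x j ^ 2 + (Real.pi * (k + 1)) ^ 2) -
        1 / ∏ j ∈ Finset.range N, (x j ^ 2 + (2 * Real.pi * (k + 1)) ^ 2)) := by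
    intro k
    have hsq : ((-1 : ℝ) ^ (N + 1)) * (-1) ^ (N + 1) = 1 := by
      rw [← mul_pow]; simp
    simp_rw [mul_sub, Finset.sum_sub_distrib]
    rw [hlag _ (by positivity), hlag _ (by positivity)]
    linear_combination (4 * (1 / ∏ j ∈ Finset.range N, (x j ^ 2 + (Real.pi * (k + 1)) ^ 2) -
        1 / ∏ j ∈ Finset.range N, (x j ^ 2 + (2 * Real.pi * (k + 1)) ^ 2))) * hsq
  have hnonneg : ∀ k : ℕ, k ≠ 0 → 0 ≤ (-1) ^ (N + 1) * ∑ j ∈ Finset.range N, w j *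
      (4 / (x j ^ 2 + (Real.pi * (k + 1)) ^ 2) -
        4 / (x j ^ 2 + (2 * Real.pi * (k + 1)) ^ 2)) := by
    intro k _
    rw [hterm]
    refine mul_nonneg (by norm_num) (sub_nonneg.2 (one_div_le_one_div_of_le
      (Finset.prod_pos fun _ _ ↦ by positivity)
      (Finset.prod_le_prod (fun _ _ ↦ by positivity) fun j _ ↦ ?_)))
    have hpk : 0 < Real.pi * (k + 1) := by positivity
    nlinarith
  have hle := le_hasSum hsum 0 hnonneg
  rw [hterm] at hle
  have habs : ∀ S : ℝ, (-1) ^ (N + 1) * S ≤ |S| := by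
    intro S
    refine (le_abs_self _).trans ?_
    rw [abs_mul, abs_pow, abs_neg, abs_one, one_pow, one_mul]
  refine le_trans ?_ (hle.trans (habs _))
  have hπ₁ := Real.pi_gt_three
  have hπ₂ : Real.pi ^ 2 ≤ 10 := by nlinarith [Real.pi_lt_d2, Real.pi_pos]
  set A := ∏ j ∈ Finset.range N, (x j ^ 2 + (Real.pi * (((0 : ℕ) : ℝ) + 1)) ^ 2) with hA
  set B := ∏ j ∈ Finset.range N, (x j ^ 2 + (2 * Real.pi * (((0 : ℕ) : ℝ) + 1)) ^ 2) with hB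
  have hApos : 0 < A := Finset.prod_pos fun _ _ ↦ by positivity
  have hx2 : ∀ j ∈ Finset.range N, x j ^ 2 ≤ 4 := fun j hj ↦ by
    have := hx j (Finset.mem_range.1 hj)
    nlinarith [this.1, this.2]
  have hA14 : A ≤ 14 ^ N := by
    rw [show (14 : ℝ) ^ N = ∏ _j ∈ Finset.range N, 14 by simp]
    refine Finset.prod_le_prod (fun _ _ ↦ by positivity) fun j hj ↦ ?_
    have := hx2 j hj
    push_cast; nlinarith
  have hAB : 2 * A ≤ B := by
    have h2 : (2 : ℝ) ≤ 2 ^ N := le_self_pow₀ (by norm_num) hN.ne'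
    refine (mul_le_mul_of_nonneg_right h2 hApos.le).trans ?_
    rw [show (2 : ℝ) ^ N = ∏ _j ∈ Finset.range N, 2 by simp, hA, ← Finset.prod_mul_distrib]
    refine Finset.prod_le_prod (fun _ _ ↦ by positivity) fun j hj ↦ ?_
    have := hx2 j hj
    push_cast; nlinarith
  have h1 : 1 / B ≤ 1 / (2 * A) := one_div_le_one_div_of_le (by positivity) hAB
  have h2 : 1 / (14 : ℝ) ^ N ≤ 1 / A := one_div_le_one_div_of_le hApos hA14
  have h3 : 1 / (2 * A) = (1 / A) / 2 := by field_simp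
  have h4 : 2 / (14 : ℝ) ^ N = 2 * (1 / 14 ^ N) := by ring
  rw [h4]
  linarith

lemma exists_separated_nodes {f : ℝ → ℝ} (hf : Continuous f) {N : ℕ} (hN : 0 < N) :
    ∃ x : ℕ → ℝ, (∀ j < N, x j ∈ Set.Icc 1 2) ∧
      (∀ i < N, ∀ j < N, |(j : ℝ) - i| / N ≤ |x j ^ 2 - x i ^ 2|) ∧
      ∀ j < N, |f (x j)| ≤ 2 * N * ∫ y in (1 : ℝ)..2, |f y| := by
  have hN' : (0 : ℝ) < N := by exact_mod_cast hN
  have hex : ∀ j : ℕ, ∃ y ∈ Set.Icc (1 + (j : ℝ) / N) (1 + (j + 1 / 2) / N),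
      (1 + (j + 1 / 2) / N - (1 + (j : ℝ) / N)) * |f y| ≤
        ∫ t in (1 + (j : ℝ) / N)..(1 + (j + 1 / 2) / N), |f t| := fun j ↦
    exists_mem_Icc_mul_abs_le hf (by gcongr; linarith)
  choose x hx hfx using hex
  have hub : ∀ j < N, (j + 1 / 2 : ℝ) / N ≤ 1 := by
    intro j hj
    have : (j : ℝ) + 1 ≤ N := by exact_mod_cast hj
    rw [div_le_one hN']; linarith
  have hmem : ∀ j < N, x j ∈ Set.Icc 1 2 := by
    intro j hj
    have h0 : 0 ≤ (j : ℝ) / N := by positivity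
    exact ⟨by linarith [(hx j).1], by linarith [(hx j).2, hub j hj]⟩
  have hsep : ∀ i < N, ∀ j < N, i < j → ((j : ℝ) - i) / N ≤ x j ^ 2 - x i ^ 2 := by
    intro i hi j hj hij
    have hij' : (i : ℝ) + 1 ≤ j := by exact_mod_cast hij
    have h1 : ((j : ℝ) - i) / N / 2 ≤ x j - x i := by
      have h2 : (j : ℝ) / N - (i + 1 / 2) / N ≤ x j - x i := by linarith [(hx j).1, (hx i).2]
      refine le_trans ?_ h2
      rw [← sub_div, div_right_comm]
      gcongr
      linarith
    have h3 : 0 ≤ ((j : ℝ) - i) / N := div_nonneg (by linarith) hN'.le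
    nlinarith [(hmem i hi).1, (hmem j hj).1]
  refine ⟨x, hmem, fun i hi j hj ↦ ?_, fun j hj ↦ ?_⟩
  · rcases lt_trichotomy i j with h | rfl | h
    · have hij : (i : ℝ) < j := by exact_mod_cast h
      rw [abs_of_pos (sub_pos.2 hij)]
      exact (hsep i hi j hj h).trans (le_abs_self _)
    · simp
    · have hij : (j : ℝ) < i := by exact_mod_cast h
      rw [abs_sub_comm, abs_of_pos (sub_pos.2 hij), abs_sub_comm]
      exact (hsep j hj i hi h).trans (le_abs_self _)
  · have h1 : ∫ t in (1 + (j : ℝ) / N)..(1 + (j + 1 / 2) / N), |f t| ≤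
        ∫ y in (1 : ℝ)..2, |f y| := by
      have h0 : 0 ≤ (j : ℝ) / N := by positivity
      refine intervalIntegral.integral_mono_interval (by linarith) (by gcongr; linarith)
        (by linarith [hub j hj]) (Filter.Eventually.of_forall fun _ ↦ abs_nonneg _)
        (hf.abs.intervalIntegrable _ _)
    have h2 := (hfx j).trans h1
    have h3 : (1 + (j + 1 / 2) / N - (1 + (j : ℝ) / N)) = 1 / (2 * N) := by
      field_simp; ring
    rw [h3, one_div_mul_eq_div, div_le_iff₀ (by positivity)] at h2
    linarith

lemma sum_nodalWeight_mul_eq_zero {N : ℕ} {x : ℕ → ℝ} (hx : ∀ j < N, x j ≠ 0)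
    (hinj : Set.InjOn (fun j ↦ x j ^ 2) (Finset.range N)) {p : Polynomial ℝ}
    (hp : p.natDegree + 1 < N) :
    ∑ j ∈ Finset.range N, Lagrange.nodalWeight (Finset.range N) (fun j ↦ x j ^ 2) j *
      ((p.eval (x j) - p.eval (-x j)) / x j) = 0 := by
  obtain ⟨P, hP, hodd⟩ := Polynomial.exists_odd_part p
  have hdeg : P.degree < (Finset.range N).card := by
    rw [Finset.card_range]
    exact Polynomial.degree_le_natDegree.trans_lt (by exact_mod_cast (by omega))
  have h := Lagrange.coeff_eq_sum hinj hdeg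
  rw [Finset.card_range, Polynomial.coeff_eq_zero_of_natDegree_lt (by omega)] at h
  rw [h]
  refine Finset.sum_congr rfl fun j hj ↦ ?_
  rw [hodd, mul_div_cancel_left₀ _ (hx j (Finset.mem_range.1 hj)), Lagrange.nodalWeight,
    Finset.prod_inv_distrib, mul_comm, div_eq_mul_inv]

lemma one_le_mul_gaussian_error (p : Polynomial ℝ) :
    1 ≤ 40 * 336 ^ (p.natDegree + 2) *
      ∫ x, |1 / (1 + Real.exp (-x)) - p.eval x| ∂(gaussianReal 0 1) := by
  set e : ℝ → ℝ := fun x ↦ 1 / (1 + Real.exp (-x)) - p.eval x with he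
  set ε := ∫ x, |e x| ∂(gaussianReal 0 1) with hε
  have hc : Continuous e := continuous_sigmoid_sub p
  have hi : Integrable e (gaussianReal 0 1) := integrable_sigmoid_sub p
  have hε0 : 0 ≤ ε := integral_nonneg fun _ ↦ abs_nonneg _
  set N := p.natDegree + 2 with hN
  have hN0 : 0 < N := by omega
  set q : ℝ → ℝ := fun x ↦ e x - e (-x) with hq
  have hcn : Continuous fun x ↦ e (-x) := hc.comp continuous_neg
  have hqc : Continuous q := hc.sub hcn
  have hqint : ∫ y in (1 : ℝ)..2, |q y| ≤ 40 * ε := by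
    have h1 := intervalIntegral_abs_le_gaussianReal hc hi (a := 1) (b := 2)
      (by norm_num) (by norm_num) (by norm_num)
    have h2 := intervalIntegral_abs_le_gaussianReal hc hi (a := -2) (b := -1)
      (by norm_num) (by norm_num) (by norm_num)
    rw [← intervalIntegral.integral_comp_neg (fun x ↦ |e x|)] at h2
    calc ∫ y in (1 : ℝ)..2, |q y| ≤ ∫ y in (1 : ℝ)..2, (|e y| + |e (-y)|) :=
          intervalIntegral.integral_mono_on (by norm_num) (hqc.abs.intervalIntegrable _ _)
            ((hc.abs.add hcn.abs).intervalIntegrable _ _) fun y _ ↦ abs_sub _ _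
      _ = (∫ y in (1 : ℝ)..2, |e y|) + ∫ y in (1 : ℝ)..2, |e (-y)| :=
          intervalIntegral.integral_add (hc.abs.intervalIntegrable _ _)
            (hcn.abs.intervalIntegrable _ _)
      _ ≤ 40 * ε := by linarith
  obtain ⟨x, hx, hsep, hqx⟩ := exists_separated_nodes hqc hN0
  have hN' : (0 : ℝ) < N := by exact_mod_cast hN0
  have hinj : Set.InjOn (fun j ↦ x j ^ 2) (Finset.range N) := by
    intro j hj i hi hji
    have h := hsep i (Finset.mem_range.1 hi) j (Finset.mem_range.1 hj)
    simp only at hji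
    rw [hji, sub_self, abs_zero, div_le_iff₀ hN', zero_mul] at h
    exact_mod_cast sub_eq_zero.1 (abs_eq_zero.1 (h.antisymm (abs_nonneg _)))
  have hlow := two_div_le_abs_sum_nodalWeight_mul hN0 hx hinj
  set w := Lagrange.nodalWeight (Finset.range N) (fun j ↦ x j ^ 2) with hw
  have hzero := sum_nodalWeight_mul_eq_zero (p := p)
    (fun j hj ↦ (zero_lt_one.trans_le (hx j hj).1).ne') hinj (by omega)
  have heq : ∑ j ∈ Finset.range N, w j *
      ((1 / (1 + Real.exp (-x j)) - 1 / (1 + Real.exp (x j))) / x j) =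
      ∑ j ∈ Finset.range N, w j * (q (x j) / x j) := by
    rw [← sub_zero (∑ j ∈ Finset.range N, w j *
      ((1 / (1 + Real.exp (-x j)) - 1 / (1 + Real.exp (x j))) / x j)), ← hzero,
      ← Finset.sum_sub_distrib]
    refine Finset.sum_congr rfl fun j _ ↦ ?_
    simp only [hq, he, neg_neg]
    ring
  have hup : |∑ j ∈ Finset.range N, w j * (q (x j) / x j)| ≤
      N * (6 ^ N * (2 * N * (40 * ε))) := by
    refine (Finset.abs_sum_le_sum_abs _ _).trans ?_
    have hb : ∀ j ∈ Finset.range N, |w j * (q (x j) / x j)| ≤ 6 ^ N * (2 * N * (40 * ε)) := by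
      intro j hj
      have hj' := Finset.mem_range.1 hj
      have hx1 := (hx j hj').1
      rw [abs_mul]
      refine mul_le_mul (abs_nodalWeight_range_le hsep hj') ?_ (abs_nonneg _) (by positivity)
      rw [abs_div, abs_of_pos (by linarith : 0 < x j)]
      refine (div_le_self (abs_nonneg _) hx1).trans ((hqx j hj').trans ?_)
      gcongr
    refine (Finset.sum_le_card_nsmul _ _ _ hb).trans ?_
    rw [Finset.card_range, nsmul_eq_mul]
  rw [heq] at hlow
  have hN2 : (N : ℝ) * N ≤ 4 ^ N := by
    have h2 : (N : ℝ) ≤ 2 ^ N := by exact_mod_cast Nat.lt_two_pow_self.le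
    calc (N : ℝ) * N ≤ 2 ^ N * 2 ^ N := by gcongr
      _ = 4 ^ N := by rw [← mul_pow]; norm_num
  have hfin := hlow.trans hup
  rw [div_le_iff₀ (by positivity)] at hfin
  have h336 : (336 : ℝ) ^ N = 4 ^ N * (6 ^ N * 14 ^ N) := by
    rw [← mul_pow, ← mul_pow]; norm_num
  rw [h336]
  have hmul := mul_le_mul_of_nonneg_right hN2 (by positivity : 0 ≤ (6 ^ N * 14 ^ N) * (80 * ε))
  linarith

/-- `L¹(γ₁)` degree lower bound for the sigmoid `f(t) = 1/(1+e^{−t})`: there are constants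
`c, ε₀ > 0` such that for all `ε ∈ (0, ε₀)`, every polynomial `p` with
`E_{x∼γ₁}[|f(x) − p(x)|] < ε` has degree at least `c log(1/ε)`. -/
theorem stmt_17 : ∃ c > (0:ℝ), ∃ ε₀ > (0:ℝ), ∀ ε : ℝ, 0 < ε → ε < ε₀ →
    ∀ p : Polynomial ℝ,
      (∫ x, |1 / (1 + Real.exp (-x)) - p.eval x| ∂(gaussianReal 0 1)) < ε →
      c * Real.log (1 / ε) ≤ (p.natDegree : ℝ) := by
  have hlog : 0 < Real.log 336 := Real.log_pos (by norm_num)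
  refine ⟨1 / (4 * Real.log 336), by positivity, 1 / (40 * 336 ^ 2), by positivity,
    fun ε hε hε₀ p hp ↦ ?_⟩
  have hbound : 1 / ε ≤ 40 * 336 ^ (p.natDegree + 2) := by
    rw [div_le_iff₀ hε]
    exact (one_le_mul_gaussian_error p).trans (by gcongr)
  have hdeg : 1 ≤ p.natDegree := by
    by_contra! h
    rw [Nat.lt_one_iff.1 h, zero_add] at hbound
    exact absurd ((one_div_le hε (by positivity)).1 hbound) (not_le.2 hε₀)
  have hpow : 1 / ε ≤ 336 ^ (4 * p.natDegree) := by
    refine hbound.trans ?_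
    calc (40 : ℝ) * 336 ^ (p.natDegree + 2) ≤ 336 * 336 ^ (p.natDegree + 2) := by
          gcongr; norm_num
      _ = 336 ^ (p.natDegree + 3) := by ring
      _ ≤ _ := pow_le_pow_right₀ (by norm_num) (by omega)
  have hl := Real.log_le_log (by positivity) hpow
  rw [Real.log_pow] at hl
  push_cast at hl
  rw [one_div_mul_eq_div, div_le_iff₀ (by positivity)]
  linarith
end
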